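/- Uniform exponential growth with uniform base: Let K be a field and Γ a finitely generated subgroup of GL_n(K) that is not virtually solvable. Then there exists ε = ε(Γ) > 0 such that for every finite symmetric generating set Σ of Γ with 1 ∈ Σ and every integer n ≥ 1, #(Σⁿ) ≥ #Σ·(1+ε)^{n−1}. -/

import Mathlib

open Matrix Pointwise
set_option linter.unusedSectionVars false

namespace UEG

/-- Uniform doubling property of a group. -/
def Dbl (G : Type*) [Group G] : Prop :=
  ∃ M : ℕ, ∀ S : Finset G, (1 : G) ∈ S → (∀ s ∈ S, s⁻¹ ∈ S) →
    Subgroup.closure (S : Set G) = ⊤ → ∀ X : Finset G,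
      2 * X.card ≤ ((S : Set G) ^ M * (X : Set G)).ncard

lemma Dbl.infinite {G : Type*} [Group G] (h : Dbl G) : Infinite G := by
  classical
  by_contra hfin
  rw [not_infinite_iff_finite] at hfin
  have := Fintype.ofFinite G
  obtain ⟨M, hM⟩ := h
  have h1 := hM Finset.univ (Finset.mem_univ _) (fun _ _ => Finset.mem_univ _)
    (by simp) Finset.univ
  have h2 : (((Finset.univ : Finset G) : Set G) ^ M * ((Finset.univ : Finset G) : Set G)).ncard
      ≤ (Finset.univ : Finset G).card := by
    rw [← Set.ncard_coe_finset]
    exact Set.ncard_le_ncard (by simp) (Set.toFinite _)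
  have h3 : 0 < (Finset.univ : Finset G).card := Finset.card_pos.mpr ⟨1, Finset.mem_univ _⟩
  omega

lemma three_halves {G : Type*} [Group G] [Infinite G] [DecidableEq G] (S : Finset G)
    (h1 : (1 : G) ∈ S) (hg : Subgroup.closure (S : Set G) = ⊤) :
    (3 / 2 : ℝ) * S.card ≤ (S * S).card := by
  by_contra hlt
  push Not at hlt
  have hlt' : ((S * S).card : ℚ) < (3 / 2 : ℚ) * S.card := by
    have : (((S * S).card : ℚ) : ℝ) < (((3 / 2 : ℚ) * S.card : ℚ) : ℝ) := by
      push_cast; linarith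
    exact_mod_cast this
  obtain ⟨H, hH, -, h3⟩ := Finset.doubling_lt_three_halves hlt'
  have h4 := (h3 1 h1).1
  rw [one_smul] at h4
  have h5 : H = ⊤ := by
    rw [eq_top_iff, ← hg, Subgroup.closure_le]; exact h4
  subst h5
  have : Finite G := Finite.of_injective (fun g : G => (⟨g, trivial⟩ : (⊤ : Subgroup G)))
    (fun a b hab => congrArg Subtype.val hab)
  exact not_finite G

lemma Dbl.growth {G : Type*} [Group G] (h : Dbl G) :
    ∃ ε : ℝ, 0 < ε ∧ ∀ S : Finset G, (1 : G) ∈ S → (∀ s ∈ S, s⁻¹ ∈ S) →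
        Subgroup.closure (S : Set G) = ⊤ → ∀ n : ℕ, 1 ≤ n →
          (S.card : ℝ) * (1 + ε) ^ (n - 1) ≤ ((S : Set G) ^ n).ncard := by
  classical
  have hinf := h.infinite
  obtain ⟨M0, hM⟩ := h
  set M := M0 + 1 with hMdef
  obtain ⟨ε, hε, hεM⟩ : ∃ ε : ℝ, 0 < ε ∧ (1 + ε) ^ (2 * M) ≤ 3 / 2 := by
    have hc : Filter.Tendsto (fun x : ℝ => (1 + x) ^ (2 * M)) (nhds 0) (nhds ((1 + 0) ^ (2 * M))) :=
      (Continuous.tendsto (by fun_prop) 0)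
    have hev := hc.eventually (ge_mem_nhds (show (1 + 0 : ℝ) ^ (2 * M) < 3 / 2 by norm_num))
    obtain ⟨δ, hδ, hb⟩ := Metric.eventually_nhds_iff.mp hev
    refine ⟨δ / 2, by positivity, hb ?_⟩
    rw [Real.dist_eq, sub_zero, abs_of_pos (by positivity)]
    linarith
  refine ⟨ε, hε, fun S h1 hs hg n hn => ?_⟩
  have hdbl : ∀ X : Finset G, 2 * X.card ≤ (S ^ M * X).card := by
    intro X
    refine (hM S h1 hs hg X).trans ?_
    rw [← Finset.coe_pow, ← Finset.coe_mul, Set.ncard_coe_finset]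
    refine Finset.card_le_card (Finset.mul_subset_mul_right ?_)
    exact Finset.pow_subset_pow_right h1 (by omega)
  rw [← Finset.coe_pow, Set.ncard_coe_finset]
  have hpow : ∀ k : ℕ, 2 ^ k * S.card ≤ (S ^ (M * k + 1)).card := by
    intro k
    induction k with
    | zero => simp
    | succ k ih =>
      have := hdbl (S ^ (M * k + 1))
      rw [← pow_add] at this
      have e : M + (M * k + 1) = M * (k + 1) + 1 := by ring
      rw [e] at this
      rw [pow_succ]
      nlinarith
  obtain ⟨m, rfl⟩ : ∃ m, n = m + 1 := ⟨n - 1, by omega⟩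
  rw [Nat.add_sub_cancel]
  have hScard : (0 : ℝ) ≤ S.card := by positivity
  have hε1 : (1 : ℝ) ≤ 1 + ε := by linarith
  rcases Nat.eq_zero_or_pos m with rfl | hm
  · simp
  rcases lt_or_ge m M with hmM | hmM
  · have h3 := three_halves S h1 hg
    have h4 : (S * S).card ≤ (S ^ (m + 1)).card := by
      rw [← pow_two]
      exact Finset.card_le_card (Finset.pow_subset_pow_right h1 (by omega))
    have h5 : (1 + ε) ^ m ≤ (1 + ε) ^ (2 * M) := pow_le_pow_right₀ hε1 (by omega)
    have h6 : ((S * S).card : ℝ) ≤ (S ^ (m + 1)).card := by exact_mod_cast h4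
    nlinarith
  · set k := m / M with hk
    have hMpos : 0 < M := by omega
    have hk1 : 1 ≤ k := by
      rw [hk]; exact (Nat.one_le_div_iff hMpos).mpr hmM
    have hmk : m ≤ 2 * M * k := by
      have := Nat.lt_mul_div_succ m hMpos
      rw [← hk] at this
      nlinarith
    have h5 : (1 + ε) ^ m ≤ (1 + ε) ^ (2 * M * k) := pow_le_pow_right₀ hε1 hmk
    have h6 : (1 + ε) ^ (2 * M * k) ≤ 2 ^ k := by
      rw [pow_mul]
      exact pow_le_pow_left₀ (by positivity) (by linarith) k
    have h7 : (S ^ (M * k + 1)).card ≤ (S ^ (m + 1)).card :=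
      Finset.card_le_card (Finset.pow_subset_pow_right h1 (by
        have := Nat.mul_div_le m M
        rw [← hk] at this; omega))
    have h8 : ((2 : ℝ) ^ k * S.card) ≤ (S ^ (m + 1)).card := by exact_mod_cast (hpow k).trans h7
    nlinarith

/-- Cosets are reached by short words. -/
lemma exists_short_rep {G : Type*} [Group G] (H : Subgroup G) [H.FiniteIndex] [DecidableEq G]
    (S : Finset G) (h1 : (1 : G) ∈ S) (hs : ∀ s ∈ S, s⁻¹ ∈ S)
    (hg : Subgroup.closure (S : Set G) = ⊤) (g : G) :
    ∃ r ∈ S ^ H.index, g * r⁻¹ ∈ H := by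
  classical
  -- A i: set of cosets hit by S^i
  let Q := Quotient (QuotientGroup.rightRel H)
  have hQ : Finite Q := by
    have : Finite (G ⧸ H) := inferInstance
    exact Finite.of_equiv _ (QuotientGroup.quotientRightRelEquivQuotientLeftRel H).symm
  have := Fintype.ofFinite Q
  have hcard : Fintype.card Q = H.index := by
    rw [← Nat.card_eq_fintype_card, Subgroup.index,
      Nat.card_congr (QuotientGroup.quotientRightRelEquivQuotientLeftRel H)]
  let π : G → Q := Quotient.mk _
  have hπ : ∀ a b : G, π a = π b ↔ b * a⁻¹ ∈ H := fun a b => by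
    rw [← QuotientGroup.rightRel_apply]; exact Quotient.eq
  let A : ℕ → Finset Q := fun i => (S ^ i).image π
  have hmono : ∀ i, A i ⊆ A (i + 1) := fun i =>
    Finset.image_subset_image (Finset.pow_subset_pow_right h1 (Nat.le_succ i))
  have hstab : ∀ i, A (i + 1) = A i → ∀ x, π x ∈ A i := by
    intro i hi x
    have hx : x ∈ Subgroup.closure (S : Set G) := by rw [hg]; trivial
    have key : ∀ y s, s ∈ S → π y ∈ A i → π (y * s) ∈ A i := by
      intro y s hsS hy
      obtain ⟨z, hz, hzy⟩ := Finset.mem_image.mp hy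
      rw [← hi]
      refine Finset.mem_image.mpr ⟨z * s, ?_, ?_⟩
      · rw [pow_succ]; exact Finset.mul_mem_mul hz hsS
      · rw [hπ] at hzy ⊢
        simpa [mul_assoc] using hzy
    refine Subgroup.closure_induction_right (p := fun x _ => π x ∈ A i) ?_ ?_ ?_ hx
    · exact Finset.mem_image_of_mem _ (Finset.one_mem_pow h1)
    · intro y _ s hs' hy
      exact key y s hs' hy
    · intro y _ s hs' hy
      exact key y s⁻¹ (hs s hs') hy
  have hgrow : ∀ i, (∀ x, π x ∈ A i) ∨ i + 1 ≤ (A i).card := by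
    intro i
    induction i with
    | zero => right; simp [A]
    | succ i ih =>
      rcases ih with ih | ih
      · left; intro x; exact hmono i (ih x)
      · by_cases he : A (i + 1) = A i
        · left; intro x; exact hmono i (hstab i he x)
        · right
          have : (A i).card < (A (i + 1)).card :=
            Finset.card_lt_card ((hmono i).ssubset_of_ne (Ne.symm he))
          omega
  have hall : π g ∈ A H.index := by
    rcases hgrow H.index with h | h
    · exact h g
    · have := Finset.card_le_univ (A H.index)
      omega
  obtain ⟨r, hr, hrg⟩ := Finset.mem_image.mp hall
  exact ⟨r, hr, (hπ _ _).mp hrg⟩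

lemma Dbl.of_finiteIndex {G : Type*} [Group G] (H : Subgroup G) [H.FiniteIndex] (h : Dbl H) :
    Dbl G := by
  classical
  obtain ⟨M, hM⟩ := h
  set m := H.index with hm
  refine ⟨(2 * m + 1) * M, fun S h1 hs hg X => ?_⟩
  have hinvpow : ∀ k, ∀ x ∈ S ^ k, x⁻¹ ∈ S ^ k := by
    have hSinv : S⁻¹ = S := by
      ext x; rw [Finset.mem_inv']
      exact ⟨fun hx => by simpa using hs _ hx, hs x⟩
    intro k x hx
    rw [← Finset.mem_inv', ← inv_pow, hSinv]
    exact hx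
  set S' : Finset H := (S ^ (2 * m + 1)).preimage (fun h : H => (h : G))
    Subtype.val_injective.injOn with hS'
  have memS' : ∀ x : H, x ∈ S' ↔ (x : G) ∈ S ^ (2 * m + 1) := fun x => by simp [hS']
  have hgen : Subgroup.closure (S' : Set H) = ⊤ := by
    have key : ∀ g : G, ∃ h ∈ Subgroup.closure (S' : Set H), ∃ r ∈ S ^ m, g = h * r := by
      intro g
      have step : ∀ y s, s ∈ S → (∃ h ∈ Subgroup.closure (S' : Set H), ∃ r ∈ S ^ m, y = h * r) →
          (∃ h ∈ Subgroup.closure (S' : Set H), ∃ r ∈ S ^ m, y * s = h * r) := by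
        rintro y s hsS ⟨h, hh, r, hr, rfl⟩
        obtain ⟨r', hr', hrH⟩ := exists_short_rep H S h1 hs hg (r * s)
        refine ⟨h * ⟨r * s * r'⁻¹, hrH⟩, mul_mem hh (Subgroup.subset_closure ?_), r', hr', ?_⟩
        · rw [Finset.mem_coe, memS']
          have : 2 * m + 1 = m + 1 + m := by ring
          rw [this, pow_add, pow_add, pow_one]
          exact Finset.mul_mem_mul (Finset.mul_mem_mul hr hsS) (hinvpow _ _ hr')
        · simp [mul_assoc]
      have hx : g ∈ Subgroup.closure (S : Set G) := by rw [hg]; trivial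
      refine Subgroup.closure_induction_right
        (p := fun y _ => ∃ h ∈ Subgroup.closure (S' : Set H), ∃ r ∈ S ^ m, y = h * r) ?_ ?_ ?_ hx
      · exact ⟨1, one_mem _, 1, Finset.one_mem_pow h1, by simp⟩
      · intro y _ s hs' hy
        exact step y s hs' hy
      · intro y _ s hs' hy
        exact step y s⁻¹ (hs s hs') hy
    rw [eq_top_iff]
    intro x _
    obtain ⟨h, hh, r, hr, hx⟩ := key x
    have hrH : r ∈ H := by
      have : r = ((h⁻¹ * x : H) : G) := by simp [hx]
      rw [this]; exact Subtype.property _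
    have : x = h * ⟨r, hrH⟩ := Subtype.ext (by simpa using hx)
    rw [this]
    refine mul_mem hh (Subgroup.subset_closure ?_)
    rw [Finset.mem_coe, memS']
    exact Finset.pow_subset_pow_right h1 (by omega) hr
  have hS'1 : (1 : H) ∈ S' := by rw [memS']; exact Finset.one_mem_pow h1
  have hS's : ∀ s ∈ S', s⁻¹ ∈ S' := fun s hs' => by
    rw [memS'] at hs' ⊢; exact hinvpow _ _ hs'
  have hdbl := hM S' hS'1 hS's hgen
  have hS'pow : ∀ k, ∀ x ∈ S' ^ k, (x : G) ∈ S ^ ((2 * m + 1) * k) := by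
    intro k
    induction k with
    | zero => intro x hx; simpa using hx
    | succ k ih =>
      intro x hx
      rw [pow_succ] at hx
      obtain ⟨a, ha, b, hb, rfl⟩ := Finset.mem_mul.mp hx
      rw [mul_add, mul_one, pow_add]
      exact Finset.mul_mem_mul (ih a ha) ((memS' b).mp hb)
  rw [← Finset.coe_pow, ← Finset.coe_mul, Set.ncard_coe_finset]
  set Y := S ^ ((2 * m + 1) * M) * X with hY
  let π : G → Quotient (QuotientGroup.rightRel H) := Quotient.mk _
  have hπ : ∀ a b : G, π a = π b ↔ b * a⁻¹ ∈ H := fun a b => by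
    rw [← QuotientGroup.rightRel_apply]; exact Quotient.eq
  have hXY : X ⊆ Y := fun x hx => by
    rw [hY, ← one_mul x]; exact Finset.mul_mem_mul (Finset.one_mem_pow h1) hx
  rw [Finset.card_eq_sum_card_fiberwise (f := π) (s := X) (t := Y.image π)
      (fun x hx => Finset.mem_image_of_mem _ (hXY hx)),
    Finset.card_eq_sum_card_fiberwise (f := π) (s := Y) (t := Y.image π)
      (fun x hx => Finset.mem_image_of_mem _ hx), Finset.mul_sum]
  refine Finset.sum_le_sum fun c _ => ?_
  obtain ⟨y, rfl⟩ : ∃ y, π y = c := Quotient.exists_rep c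
  set Xc : Finset H := X.preimage (fun h : H => (h : G) * y)
    (fun a _ b _ hab => Subtype.ext (mul_right_cancel hab)) with hXc
  have memXc : ∀ h : H, h ∈ Xc ↔ (h : G) * y ∈ X := fun h => Finset.mem_preimage
  have e1 : (X.filter (fun x => π x = π y)).card = Xc.card := by
    have : X.filter (fun x => π x = π y) = Xc.image (fun h : H => (h : G) * y) := by
      ext x
      simp only [Finset.mem_filter, Finset.mem_image]
      constructor
      · rintro ⟨hx, hxy⟩
        rw [eq_comm, hπ] at hxy
        exact ⟨⟨x * y⁻¹, hxy⟩, (memXc _).mpr (by simpa using hx), by simp⟩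
      · rintro ⟨h, hh, rfl⟩
        refine ⟨(memXc _).mp hh, ?_⟩
        rw [eq_comm, hπ]; simp
    rw [this, Finset.card_image_of_injective]
    exact fun a b hab => Subtype.ext (mul_right_cancel hab)
  have e2 : ((S' : Set H) ^ M * (Xc : Set H)).ncard ≤ (Y.filter (fun x => π x = π y)).card := by
    rw [← Finset.coe_pow, ← Finset.coe_mul, Set.ncard_coe_finset]
    refine Finset.card_le_card_of_injOn (fun h : H => (h : G) * y) ?_
      (fun a _ b _ hab => Subtype.ext (mul_right_cancel hab))
    intro h hh
    obtain ⟨a, ha, b, hb, rfl⟩ := Finset.mem_mul.mp (Finset.mem_coe.mp hh)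
    simp only [Finset.coe_filter, Set.mem_ofPred_eq]
    refine ⟨?_, ?_⟩
    · rw [hY, Subgroup.coe_mul, mul_assoc]
      exact Finset.mul_mem_mul (hS'pow _ _ ha) ((memXc _).mp hb)
    · rw [eq_comm, hπ]; simp only [mul_inv_cancel_right]; exact Subtype.property _
  rw [e1]
  exact (hdbl Xc).trans e2

end UEG


namespace UEG

/-- The commutator of `q`-th powers. -/
def cq {G : Type*} [Group G] (q : ℕ) (x y : G) : G := x ^ q * y ^ q * (x ^ q)⁻¹ * (y ^ q)⁻¹

lemma cq_conj {G : Type*} [Group G] (q : ℕ) (x y z : G) :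
    z * cq q x y * z⁻¹ = cq q (z * x * z⁻¹) (z * y * z⁻¹) := by
  simp only [cq, conj_pow]; group

/-- The subgroup generated by commutators of `q`-th powers. -/
def Nq (G : Type*) [Group G] (q : ℕ) : Subgroup G :=
  Subgroup.closure {g | ∃ x y : G, g = cq q x y}

lemma cq_mem {G : Type*} [Group G] (q : ℕ) (x y : G) : cq q x y ∈ Nq G q :=
  Subgroup.subset_closure ⟨x, y, rfl⟩

lemma Nq_conj {G : Type*} [Group G] (q : ℕ) (z g : G) (hg : g ∈ Nq G q) :
    z * g * z⁻¹ ∈ Nq G q := by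
  induction hg using Subgroup.closure_induction with
  | mem x hx =>
    obtain ⟨x, y, rfl⟩ := hx
    rw [cq_conj]; exact cq_mem _ _ _
  | one => simp
  | mul a b _ _ ha hb =>
    have := mul_mem ha hb
    simpa [mul_assoc] using this
  | inv a _ ha =>
    have := inv_mem ha
    simpa [mul_assoc] using this

/-- Irreducibility, unbundled. -/
def Irr {F M V : Type*} [Field F] [Monoid M] [AddCommGroup V] [Module F V]
    (ρ : M →* Module.End F V) : Prop :=
  Nontrivial V ∧ ∀ W : Submodule F V, (∀ g, ∀ v ∈ W, ρ g v ∈ W) → W = ⊥ ∨ W = ⊤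

lemma burnside {F M V : Type*} [Field F] [IsAlgClosed F] [Monoid M] [AddCommGroup V] [Module F V]
    [FiniteDimensional F V] (ρ : M →* Module.End F V) (h : Irr ρ) :
    Submodule.span F (Set.range ρ) = ⊤ := by
  classical
  set A := Algebra.adjoin F (Set.range ρ) with hA
  have hspan : Subalgebra.toSubmodule A = Submodule.span F (Set.range ρ) := by
    rw [hA, Algebra.adjoin_eq_span]
    have : (Submonoid.closure (Set.range ρ) : Set (Module.End F V)) = Set.range ρ := by
      have h2 : Set.range ρ = ((MonoidHom.mrange ρ : Submonoid _) : Set (Module.End F V)) := rfl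
      rw [h2, Submonoid.closure_eq]
    rw [this]
  have := h.1
  have hsimple : IsSimpleModule A V := by
    rw [isSimpleModule_iff]
    refine { eq_bot_or_eq_top := fun W => ?_ }
    rcases h.2 (W.restrictScalars F) (fun g v hv =>
      W.smul_mem ⟨ρ g, Algebra.subset_adjoin ⟨g, rfl⟩⟩ hv) with h0 | h0
    · left; simpa using h0
    · right; simpa using h0
  have hbij := IsSimpleModule.algebraMap_end_bijective_of_isAlgClosed (A := A) (V := V) F
  rw [← hspan, eq_top_iff]
  intro f _
  have hf : ∀ (e : Module.End A V) (v : V), f (e • v) = e • f v := by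
    intro e v
    obtain ⟨t, rfl⟩ := hbij.2 e
    simp
  let f' : Module.End (Module.End A V) V :=
    { toFun := f, map_add' := map_add f, map_smul' := hf }
  obtain ⟨s, hs⟩ := Module.Finite.fg_top (R := F) (M := V)
  obtain ⟨r, hr⟩ := jacobson_density (R := A) f' s
  have : f = (r : Module.End F V) := by
    apply LinearMap.ext_on hs
    intro v hv
    exact hr v hv
  rw [this]; exact r.2

lemma trace_separating {F V : Type*} [Field F] [AddCommGroup V] [Module F V]
    [FiniteDimensional F V] (a : Module.End F V)
    (h : ∀ b : Module.End F V, LinearMap.trace F V (a * b) = 0) : a = 0 := by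
  classical
  let b := Module.finBasis F V
  apply (LinearMap.toMatrix b b).injective
  rw [map_zero]
  rw [Matrix.ext_iff_trace_mul_right]
  intro x
  have := h ((LinearMap.toMatrix b b).symm x)
  rw [LinearMap.trace_eq_matrix_trace F b, LinearMap.toMatrix_mul] at this
  simpa using this

/-- Regular functions on a group: abstract version of the coordinate ring of a connected group. -/
structure RegAlg (F G : Type*) [Field F] [Group G] where
  A : Subalgebra F (G → F)
  dom : ∀ f ∈ A, ∀ g ∈ A, f * g = 0 → f = 0 ∨ g = 0

variable {F G : Type*} [Field F] [Group G]

lemma RegAlg.prop_of_prod (O : RegAlg F G) (f g : G → F) (hf : f ∈ O.A) (hg : g ∈ O.A)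
    (s : Multiset F) (h : ∀ x, ∃ r ∈ s, f x = r * g x) : ∃ κ, ∀ x, f x = κ * g x := by
  have h' : ∀ x, (s.map (fun r => f x - r * g x)).prod = 0 := fun x => by
    rw [Multiset.prod_eq_zero_iff, Multiset.mem_map]
    obtain ⟨r, hr, hx⟩ := h x
    exact ⟨r, hr, by rw [hx, sub_self]⟩
  clear h
  induction s using Multiset.induction with
  | empty => simpa using h' 1
  | cons a s ih =>
    have hmem : ∀ r : F, (f - r • g) ∈ O.A := fun r =>
      O.A.sub_mem hf (O.A.smul_mem hg r)
    have hp : (s.map (fun r => f - r • g)).prod ∈ O.A := by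
      apply Subalgebra.multiset_prod_mem
      intro g hg
      obtain ⟨r, -, rfl⟩ := Multiset.mem_map.mp hg
      exact hmem r
    have hx : ∀ x, (s.map (fun r => f - r • g)).prod x
        = (s.map (fun r => f x - r * g x)).prod := by
      intro x
      have := map_multiset_prod (Pi.evalRingHom (fun _ : G => F) x)
        (s.map (fun r => f - r • g))
      rw [Multiset.map_map] at this
      exact this
    rcases O.dom _ (hmem a) _ hp (by
      funext x
      rw [Pi.mul_apply, hx]
      simpa using h' x) with h1 | h1
    · exact ⟨a, fun x => by simpa [sub_eq_zero] using congrFun h1 x⟩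
    · exact ih (fun x => by rw [← hx, h1]; rfl)

lemma RegAlg.const_of_finite (O : RegAlg F G) (f : G → F) (hf : f ∈ O.A)
    (h : (Set.range f).Finite) : ∃ c, ∀ x, f x = c := by
  obtain ⟨κ, hκ⟩ := O.prop_of_prod f 1 hf O.A.one_mem h.toFinset.val (fun x => ⟨f x, by simp, by simp⟩)
  exact ⟨κ, fun x => by simpa using hκ x⟩

lemma RegAlg.prop_of_pow (O : RegAlg F G) [IsAlgClosed F] (f g : G → F) (hf : f ∈ O.A)
    (hg : g ∈ O.A) (m : ℕ) (hm : 0 < m) (c : F) (h : ∀ x, f x ^ m = c * g x ^ m) :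
    ∃ κ, ∀ x, f x = κ * g x := by
  obtain ⟨κ0, hκ0⟩ := IsAlgClosed.exists_pow_nat_eq c hm
  apply O.prop_of_prod f g hf hg (Polynomial.nthRoots m c)
  intro x
  by_cases hx : g x = 0
  · refine ⟨κ0, (Polynomial.mem_nthRoots hm).mpr hκ0, ?_⟩
    have := h x
    rw [hx, zero_pow hm.ne', mul_zero] at this
    rw [hx, mul_zero]
    exact pow_eq_zero_iff hm.ne' |>.mp this
  · refine ⟨f x / g x, (Polynomial.mem_nthRoots hm).mpr ?_, by field_simp⟩
    rw [div_pow, h x]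
    field_simp

/-- A representation with regular matrix coefficients. -/
def RegRep (O : RegAlg F G) {V : Type*} [AddCommGroup V] [Module F V]
    (ρ : G →* Module.End F V) : Prop :=
  ∀ (φ : Module.Dual F V) (v : V), (fun x => φ (ρ x v)) ∈ O.A ∧ (fun x => φ (ρ x⁻¹ v)) ∈ O.A

section rep
variable {V : Type*} [AddCommGroup V] [Module F V] [FiniteDimensional F V]
  (O : RegAlg F G) (ρ : G →* Module.End F V)

/-- families of endomorphisms with regular coefficients -/
def RegFam {V W : Type*} [AddCommGroup V] [Module F V] [AddCommGroup W] [Module F W]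
    (O : RegAlg F G) (T : G → V →ₗ[F] W) : Prop :=
  ∀ (φ : Module.Dual F W) (v : V), (fun x => φ (T x v)) ∈ O.A

lemma RegFam.comp {V W U : Type*} [AddCommGroup V] [Module F V] [AddCommGroup W] [Module F W]
    [AddCommGroup U] [Module F U] [FiniteDimensional F W]
    {O : RegAlg F G} {T : G → W →ₗ[F] U} {T' : G → V →ₗ[F] W} (h : RegFam O T) (h' : RegFam O T') :
    RegFam O (fun x => T x ∘ₗ T' x) := by
  intro φ v
  let b := Module.finBasis F W
  have : (fun x => φ ((T x ∘ₗ T' x) v)) = ∑ i, (fun x => b.coord i (T' x v)) *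
      (fun x => φ (T x (b i))) := by
    funext x
    have key := congrArg (fun w => φ (T x w)) (b.sum_repr (T' x v))
    simp only [map_sum, map_smul, smul_eq_mul] at key
    simp [← key]
  rw [this]
  exact O.A.sum_mem fun i _ => O.A.mul_mem (h' _ _) (h _ _)

lemma RegFam.const {V W : Type*} [AddCommGroup V] [Module F V] [AddCommGroup W] [Module F W]
    {O : RegAlg F G} (a : V →ₗ[F] W) : RegFam O (fun _ => a) := by
  intro φ v
  exact O.A.algebraMap_mem (φ (a v))

lemma RegFam.mul {O : RegAlg F G} {T T' : G → Module.End F V} (h : RegFam O T)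
    (h' : RegFam O T') : RegFam O (fun x => T x * T' x) := h.comp h'

lemma RegFam.pow {O : RegAlg F G} {T : G → Module.End F V} (h : RegFam O T) (m : ℕ) :
    RegFam O (fun x => T x ^ m) := by
  induction m with
  | zero => simpa using RegFam.const (O := O) (1 : Module.End F V)
  | succ m ih => simpa only [pow_succ] using ih.mul h

lemma RegFam.toMatrix {O : RegAlg F G} {T : G → Module.End F V} (h : RegFam O T)
    {ι : Type*} [Fintype ι] [DecidableEq ι] (b : Module.Basis ι F V) (i j : ι) :
    (fun x => LinearMap.toMatrix b b (T x) i j) ∈ O.A := by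
  simp only [LinearMap.toMatrix_apply]
  exact h (b.coord i) (b j)

lemma RegFam.trace {O : RegAlg F G} {T : G → Module.End F V} (h : RegFam O T) :
    (fun x => LinearMap.trace F V (T x)) ∈ O.A := by
  classical
  let b := Module.finBasis F V
  simp only [LinearMap.trace_eq_matrix_trace F b, Matrix.trace, Matrix.diag]
  have := O.A.sum_mem (t := Finset.univ) (f := fun i => fun x => LinearMap.toMatrix b b (T x) i i)
    fun i _ => h.toMatrix b i i
  convert this using 1
  funext x
  simp

lemma RegFam.charpoly_coeff {O : RegAlg F G} {T : G → Module.End F V} (h : RegFam O T) (m : ℕ) :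
    (fun x => (T x).charpoly.coeff m) ∈ O.A := by
  classical
  let b := Module.finBasis F V
  let M : Matrix (Fin _) (Fin _) O.A := Matrix.of fun i j =>
    ⟨fun x => LinearMap.toMatrix b b (T x) i j, h.toMatrix b i j⟩
  have : (fun x => (T x).charpoly.coeff m) = ((M.charpoly.coeff m : O.A) : G → F) := by
    funext x
    let e : O.A →+* F := (Pi.evalRingHom (fun _ : G => F) x).comp O.A.val.toRingHom
    have h1 : (M.map e).charpoly = M.charpoly.map e := Matrix.charpoly_map M e
    have h2 : M.map e = LinearMap.toMatrix b b (T x) := rfl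
    rw [← LinearMap.charpoly_toMatrix (T x) b, ← h2, h1, Polynomial.coeff_map]
    rfl
  rw [this]
  exact Subtype.property _

lemma RegFam.det {O : RegAlg F G} {T : G → Module.End F V} (h : RegFam O T) :
    (fun x => LinearMap.det (T x)) ∈ O.A := by
  classical
  let b := Module.finBasis F V
  let M : Matrix (Fin _) (Fin _) O.A := Matrix.of fun i j =>
    ⟨fun x => LinearMap.toMatrix b b (T x) i j, h.toMatrix b i j⟩
  have : (fun x => LinearMap.det (T x)) = ((M.det : O.A) : G → F) := by
    funext x
    let e : O.A →+* F := (Pi.evalRingHom (fun _ : G => F) x).comp O.A.val.toRingHom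
    have h1 : e M.det = (M.map e).det := RingHom.map_det e M
    have h2 : M.map e = LinearMap.toMatrix b b (T x) := rfl
    rw [← LinearMap.det_toMatrix b, ← h2, ← h1]
    rfl
  rw [this]
  exact Subtype.property _

end rep
end UEG


namespace UEG

lemma finite_multisets {α : Type*} (T : Set α) (hT : T.Finite) (n : ℕ) :
    {m : Multiset α | (∀ a ∈ m, a ∈ T) ∧ Multiset.card m = n}.Finite := by
  classical
  refine Set.Finite.subset ((n • hT.toFinset.val).powerset.toFinset.finite_toSet) ?_
  rintro m ⟨h1, h2⟩
  simp only [Finset.mem_coe, Multiset.mem_toFinset, Multiset.mem_powerset]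
  rw [Multiset.le_iff_count]
  intro a
  rw [Multiset.count_nsmul]
  by_cases ha : a ∈ m
  · have : Multiset.count a hT.toFinset.val = 1 :=
      Multiset.count_eq_one_of_mem hT.toFinset.nodup (by simpa using h1 a ha)
    rw [this, ← h2, mul_one]
    exact Multiset.count_le_card a m
  · rw [Multiset.count_eq_zero_of_notMem ha]; exact Nat.zero_le _

section
variable {F G : Type*} [Field F] [Group G] [IsAlgClosed F]
variable {V : Type*} [AddCommGroup V] [Module F V] [FiniteDimensional F V]

/-- minimal nonzero invariant subspaces -/
lemma exists_min_inv [Nontrivial V] (P : Submodule F V → Prop) (htop : P ⊤) :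
    ∃ W : Submodule F V, W ≠ ⊥ ∧ P W ∧ ∀ W' ≤ W, W' ≠ ⊥ → P W' → W' = W := by
  have hwf : WellFounded ((· < ·) : Submodule F V → Submodule F V → Prop) := wellFounded_lt
  obtain ⟨W, ⟨hW1, hW2⟩, hmin⟩ := hwf.has_min {W : Submodule F V | W ≠ ⊥ ∧ P W}
    ⟨⊤, top_ne_bot, htop⟩
  refine ⟨W, hW1, hW2, fun W' hle hne hP => ?_⟩
  by_contra hne'
  exact hmin W' ⟨hne, hP⟩ (lt_of_le_of_ne hle hne')

lemma exists_common_eigenvector [Nontrivial V] (X : Set (Module.End F V))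
    (hX : ∀ a ∈ X, ∀ b ∈ X, a * b = b * a) :
    ∃ v : V, v ≠ 0 ∧ ∀ a ∈ X, ∃ c : F, a v = c • v := by
  obtain ⟨W, hW, hinv, hmin⟩ := exists_min_inv (fun W : Submodule F V => ∀ a ∈ X, ∀ v ∈ W, a v ∈ W)
    (fun _ _ _ _ => trivial)
  obtain ⟨v, hvW, hv⟩ := (Submodule.ne_bot_iff W).mp hW
  refine ⟨v, hv, fun a ha => ?_⟩
  have hnt : Nontrivial W := (Submodule.nontrivial_iff_ne_bot).mpr hW
  obtain ⟨c, hc⟩ := Module.End.exists_eigenvalue (a.restrict (hinv a ha))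
  obtain ⟨u, hu⟩ := hc.exists_hasEigenvector
  have h1 : W ⊓ LinearMap.ker (a - c • 1) = W := by
    refine hmin _ inf_le_left ?_ ?_
    · rw [Submodule.ne_bot_iff]
      refine ⟨u, ⟨u.2, ?_⟩, ?_⟩
      · have := congrArg Subtype.val hu.apply_eq_smul
        simp only [LinearMap.coe_restrict_apply, Submodule.coe_smul] at this
        simp [this]
      · have := hu.2
        simpa using this
    · rintro b hb w ⟨hw1, hw2⟩
      refine ⟨hinv b hb w hw1, ?_⟩
      have hab : a (b w) = b (a w) := congrArg (fun t : Module.End F V => t w) (hX a ha b hb)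
      simp only [SetLike.mem_coe, LinearMap.mem_ker, LinearMap.sub_apply, LinearMap.smul_apply, Module.End.one_apply] at hw2 ⊢
      rw [hab, ← map_smul, ← map_sub, hw2, map_zero]
  have h2 : v ∈ W ⊓ LinearMap.ker (a - c • 1) := by rw [h1]; exact hvW
  refine ⟨c, ?_⟩
  have := h2.2
  simpa [sub_eq_zero] using this

lemma finite_eigenvalues (a : Module.End F V) : {c : F | ∃ v : V, v ≠ 0 ∧ a v = c • v}.Finite := by
  refine Set.Finite.subset (Module.End.finite_hasEigenvalue a) ?_
  rintro c ⟨v, hv, hav⟩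
  exact Module.End.hasEigenvalue_of_hasEigenvector (x := v)
    (Module.End.hasEigenvector_iff.mpr ⟨Module.End.mem_eigenspace_iff.mpr hav, hv⟩)

variable (O : RegAlg F G) (ρ : G →* Module.End F V)

lemma RegRep.fam {O : RegAlg F G} {ρ : G →* Module.End F V} (h : RegRep O ρ) :
    RegFam O (fun x => ρ x) := fun φ v => (h φ v).1

lemma RegRep.fam_inv {O : RegAlg F G} {ρ : G →* Module.End F V} (h : RegRep O ρ) :
    RegFam O (fun x => ρ x⁻¹) := fun φ v => (h φ v).2

lemma Irr.top_of {ρ : G →* Module.End F V} (hirr : Irr ρ) (W : Submodule F V) (v : V) (hv : v ≠ 0)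
    (h : ∀ y, ρ y v ∈ W) : W = ⊤ := by
  have h1 : Submodule.span F (Set.range fun y => ρ y v) = ⊤ := by
    refine (hirr.2 _ ?_).resolve_left ?_
    · intro g u hu
      induction hu using Submodule.span_induction with
      | mem x hx =>
        obtain ⟨y, rfl⟩ := hx
        refine Submodule.subset_span ⟨g * y, ?_⟩
        simp
      | zero => simp
      | add x y _ _ hx hy => rw [map_add]; exact add_mem hx hy
      | smul a x _ hx => rw [map_smul]; exact Submodule.smul_mem _ _ hx
    · exact (Submodule.ne_bot_iff _).mpr ⟨v, Submodule.subset_span ⟨1, by simp⟩, hv⟩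
  rw [eq_top_iff, ← h1, Submodule.span_le]
  rintro _ ⟨y, rfl⟩
  exact h y

lemma lemC {O : RegAlg F G} {ρ : G →* Module.End F V} (hreg : RegRep O ρ) (hirr : Irr ρ)
    (X : Set G) (hconj : ∀ x ∈ X, ∀ y, y⁻¹ * x * y ∈ X)
    (hcomm : ∀ x ∈ X, ∀ y ∈ X, ρ x * ρ y = ρ y * ρ x) (x : G) (hx : x ∈ X) :
    ∃ c : F, ρ x = c • 1 := by
  have := hirr.1
  obtain ⟨v, hv, hvX⟩ := exists_common_eigenvector (ρ '' X) (by
    rintro _ ⟨a, ha, rfl⟩ _ ⟨b, hb, rfl⟩; exact hcomm a ha b hb)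
  have h1 : ∀ y : G, ∃ c : F, ρ (y⁻¹ * x * y) v = c • v := fun y =>
    hvX _ ⟨_, hconj x hx y, rfl⟩
  choose c hc using h1
  obtain ⟨φ, hφ⟩ := Module.Projective.exists_dual_eq_one F hv
  have hcO : c ∈ O.A := by
    have h2 := ((hreg.fam_inv.mul (RegFam.const (O := O) (ρ x))).mul hreg.fam) φ v
    convert h2 using 1
    funext y
    have := hc y
    rw [map_mul, map_mul] at this
    rw [this]; simp [hφ]
  have h3 : ∀ y, ρ x (ρ y v) = c y • ρ y v := by
    intro y
    have h4 := congrArg (ρ y) (hc y)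
    rw [map_smul, ← Module.End.mul_apply, ← map_mul] at h4
    rw [← h4, ← Module.End.mul_apply, ← map_mul]
    congr 2; group
  have hinj : ∀ y, ρ y v ≠ 0 := by
    intro y h0
    apply hv
    have : ρ y⁻¹ (ρ y v) = v := by
      rw [← Module.End.mul_apply, ← map_mul]; simp
    rw [← this, h0, map_zero]
  obtain ⟨c0, hc0⟩ := O.const_of_finite c hcO
    ((finite_eigenvalues (ρ x)).subset (by rintro _ ⟨y, rfl⟩; exact ⟨_, hinj y, h3 y⟩))
  refine ⟨c0, ?_⟩
  have h5 : LinearMap.ker (ρ x - c0 • 1) = ⊤ := by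
    apply hirr.top_of _ v hv
    intro y
    simp [h3 y, hc0 y]
  rw [LinearMap.ker_eq_top] at h5
  exact sub_eq_zero.mp h5

lemma Irr.not_scalar {ρ : G →* Module.End F V} (hirr : Irr ρ) (h2 : 2 ≤ Module.finrank F V) :
    ¬ ∀ x, ∃ c : F, ρ x = c • 1 := by
  intro h
  have := hirr.1
  obtain ⟨v, hv⟩ := exists_ne (0 : V)
  have h1 : Submodule.span F {v} = ⊤ := by
    apply hirr.top_of _ v hv
    intro y
    obtain ⟨c, hc⟩ := h y
    rw [hc]
    exact Submodule.mem_span_singleton.mpr ⟨c, by simp⟩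
  have h3 := finrank_span_singleton (K := F) hv
  rw [h1, finrank_top] at h3
  omega

lemma scalar_of_trace {ρ : G →* Module.End F V} (hirr : Irr ρ) (a : Module.End F V) 
    (h : ∀ y, LinearMap.trace F V (a * ρ y) = 0) : a = 0 := by
  apply trace_separating
  intro b
  have hb : b ∈ Submodule.span F (Set.range ρ) := by rw [burnside ρ hirr]; trivial
  induction hb using Submodule.span_induction with
  | mem x hx =>
    obtain ⟨y, rfl⟩ := hx
    exact h y
  | zero => simp
  | add x y _ _ hx hy => rw [mul_add, map_add, hx, hy, add_zero]
  | smul c x _ hx => rw [mul_smul_comm, map_smul, hx, smul_zero]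

lemma trace_pow_of_pow_scalar (a : Module.End F V) (q : ℕ) (hq : 0 < q) (s : F) (hs : s ≠ 0)
    (ha : a ^ q = s • 1) :
    ∃ m : Multiset F, (∀ z ∈ m, z ∈ {z : F | z ^ q = 1}) ∧ Multiset.card m = Module.finrank F V ∧
      LinearMap.trace F V a ^ (q * Module.finrank F V) =
      LinearMap.det a ^ q * m.sum ^ (q * Module.finrank F V) := by
  classical
  obtain ⟨s0, hs0⟩ := IsAlgClosed.exists_pow_nat_eq s hq
  have hs00 : s0 ≠ 0 := by rintro rfl; rw [zero_pow hq.ne'] at hs0; exact hs hs0.symm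
  have hspl : a.charpoly.Splits := IsAlgClosed.splits _
  have hcard : Multiset.card a.charpoly.roots = Module.finrank F V := by
    rw [← hspl.natDegree_eq_card_roots, LinearMap.charpoly_natDegree]
  have hroot : ∀ l ∈ a.charpoly.roots, (l / s0) ^ q = 1 := by
    intro l hl
    have h1 : a.HasEigenvalue l := by
      rw [Module.End.hasEigenvalue_iff_isRoot_charpoly]
      exact Polynomial.isRoot_of_mem_roots hl
    obtain ⟨v, hv⟩ := h1.exists_hasEigenvector
    have h2 := hv.pow_apply q
    rw [ha] at h2
    have h3 : s = l ^ q := by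
      have : (s - l ^ q) • v = 0 := by rw [sub_smul, ← h2]; simp
      rcases smul_eq_zero.mp this with h | h
      · exact sub_eq_zero.mp h
      · exact absurd h hv.2
    rw [div_pow, ← h3, hs0, div_self hs]
  refine ⟨a.charpoly.roots.map (fun l => l / s0), ?_, by simpa using hcard, ?_⟩
  · intro z hz
    obtain ⟨l, hl, rfl⟩ := Multiset.mem_map.mp hz
    exact hroot l hl
  · rw [Module.End.trace_eq_sum_roots_charpoly_of_splits hspl,
      Module.End.det_eq_prod_roots_charpoly_of_splits hspl]
    have e1 : (a.charpoly.roots.map (fun l => l / s0)).sum = a.charpoly.roots.sum / s0 := by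
      rw [Multiset.sum_map_div]; simp
    have e2 : a.charpoly.roots.prod ^ q = s0 ^ (q * Module.finrank F V) := by
      have h4 : (a.charpoly.roots.map (fun l => l / s0)).prod = a.charpoly.roots.prod / s0 ^ Module.finrank F V := by
        rw [Multiset.prod_map_div]; simp [hcard]
      have h5 : (a.charpoly.roots.map (fun l => l / s0)).prod ^ q = 1 := by
        rw [← Multiset.prod_map_pow]
        apply Multiset.prod_eq_one
        intro x hx
        obtain ⟨l, hl, rfl⟩ := Multiset.mem_map.mp hx
        exact hroot l hl
      rw [h4, div_pow, ← pow_mul, mul_comm _ q] at h5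
      exact (div_eq_one_iff_eq (pow_ne_zero _ hs00)).mp h5
    rw [e1, e2, div_pow]
    field_simp

lemma det_mul_det_inv {ρ : G →* Module.End F V} (x : G) :
    LinearMap.det (ρ x) * LinearMap.det (ρ x⁻¹) = 1 := by
  rw [← map_mul, ← map_mul]; simp

lemma lemD {O : RegAlg F G} {ρ : G →* Module.End F V} (hreg : RegRep O ρ) (hirr : Irr ρ)
    (q : ℕ) (hq : 0 < q) (h : ∀ x, ∃ c : F, ρ x ^ q = c • 1) (x : G) : ∃ c : F, ρ x = c • 1 := by
  have := hirr.1
  set n := Module.finrank F V with hn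
  have hn0 : 0 < n := Module.finrank_pos
  haveI : Nonempty (Fin (Module.finrank F V)) := ⟨⟨0, Module.finrank_pos⟩⟩
  let Z : Set F := (fun m : Multiset F => m.sum ^ (q * n)) ''
    {m : Multiset F | (∀ a ∈ m, a ∈ {z : F | z ^ q = 1}) ∧ Multiset.card m = n}
  have hT : {z : F | z ^ q = 1}.Finite := by
    refine (Polynomial.nthRoots q (1 : F)).finite_toSet.subset ?_
    intro z hz
    exact (Polynomial.mem_nthRoots hq).mpr hz
  have hZ : Z.Finite := (finite_multisets _ hT n).image _
  let f : G → F := fun z => LinearMap.trace F V (ρ z) ^ (q * n) * LinearMap.det (ρ z⁻¹) ^ q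
  have hfO : f ∈ O.A := O.A.mul_mem (O.A.pow_mem hreg.fam.trace _) (O.A.pow_mem hreg.fam_inv.det _)
  have hdet := fun z : G => det_mul_det_inv (ρ := ρ) z
  have hfin : (Set.range f).Finite := by
    refine hZ.subset ?_
    rintro _ ⟨z, rfl⟩
    obtain ⟨c, hc⟩ := h z
    have hc0 : c ≠ 0 := by
      rintro rfl
      have h1 : LinearMap.det (ρ z ^ q) = 0 := by
        rw [hc, zero_smul]; exact LinearMap.det_zero'  (Module.finBasis F V)
      rw [map_pow, pow_eq_zero_iff hq.ne'] at h1
      have := hdet z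
      rw [h1, zero_mul] at this
      exact zero_ne_one this
    obtain ⟨m, hm1, hm2, hm3⟩ := trace_pow_of_pow_scalar (ρ z) q hq c hc0 hc
    refine ⟨m, ⟨hm1, hm2⟩, ?_⟩
    simp only [f]
    rw [hm3, mul_right_comm, ← mul_pow, hdet z, one_pow, one_mul]
  obtain ⟨c, hc⟩ := O.const_of_finite f hfO hfin
  have htr : ∀ z, LinearMap.trace F V (ρ z) ^ (q * n) = c * LinearMap.det (ρ z) ^ q := by
    intro z
    rw [← hc z]
    simp only [f]
    rw [mul_assoc, ← mul_pow, mul_comm (LinearMap.det (ρ z⁻¹)), hdet z, one_pow, mul_one]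
  obtain ⟨κ, hκ⟩ := O.prop_of_pow (fun y => LinearMap.trace F V (ρ x * ρ y))
    (fun y => LinearMap.trace F V (ρ y))
    ((RegFam.const (O := O) (ρ x)).mul hreg.fam).trace hreg.fam.trace (q * n) (by positivity)
    (LinearMap.det (ρ x) ^ q) (fun y => by
      simp only [← map_mul ρ]
      rw [htr, htr, map_mul, map_mul]; ring)
  refine ⟨κ, ?_⟩
  rw [← sub_eq_zero]
  apply scalar_of_trace hirr
  intro y
  rw [sub_mul, map_sub, hκ y]
  simp

lemma exists_cq_ne {O : RegAlg F G} {ρ : G →* Module.End F V} (hreg : RegRep O ρ) (hirr : Irr ρ)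
    (h2 : 2 ≤ Module.finrank F V) (q : ℕ) (hq : 0 < q) : ∃ x y, ρ (cq q x y) ≠ 1 := by
  by_contra hcon
  push Not at hcon
  apply hirr.not_scalar h2
  apply lemD hreg hirr q hq
  intro x
  rw [← map_pow]
  refine lemC hreg hirr {g | ∃ z, g = z ^ q} ?_ ?_ (x ^ q) ⟨x, rfl⟩
  · rintro _ ⟨z, rfl⟩ y
    exact ⟨y⁻¹ * z * y, by rw [show y⁻¹ * z * y = y⁻¹ * z * y⁻¹⁻¹ by simp, conj_pow]; simp⟩
  · rintro _ ⟨z, rfl⟩ _ ⟨y, rfl⟩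
    have h1 := hcon z y
    have h3 : z ^ q * y ^ q = cq q z y * (y ^ q * z ^ q) := by simp only [cq]; group
    rw [← map_mul, ← map_mul, h3, map_mul, h1, one_mul]

end

/-- The linear-algebra data used in the argument. -/
structure PreData (G : Type*) [Group G] (q : ℕ) (R : Type*) [CommRing R] (n w : ℕ) where
  ρ : G →* Matrix (Fin n) (Fin n) R
  B : Matrix (Fin w) (Fin n) R
  B' : Matrix (Fin n) (Fin w) R
  hB : B * B' = 1
  hinv : ∀ ν ∈ Nq G q, ρ ν * B' = B' * (B * ρ ν * B')
  hchar : ∀ ν ∈ Nq G q, ∀ y, (B * ρ (y * ν * y⁻¹) * B').charpoly = (B * ρ ν * B').charpoly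
  hkill : ∀ ν ∈ Nq G q, Polynomial.aeval (ρ ν) (B * ρ ν * B').charpoly = 0

namespace PreData
variable {G : Type*} [Group G] {q : ℕ} {R : Type*} [CommRing R] {n w : ℕ}

/-- compression to the invariant subspace -/
def β (D : PreData G q R n w) (g : G) : Matrix (Fin w) (Fin w) R := D.B * D.ρ g * D.B'

/-- trace function -/
def τ (D : PreData G q R n w) (g : G) : R := (D.β g).trace

/-- Gram matrix -/
def gram (D : PreData G q R n w) (ν : Fin w × Fin w → G) :
    Matrix (Fin w × Fin w) (Fin w × Fin w) R := Matrix.of fun i l => D.τ (ν i * ν l)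

/-- nondegeneracy conditions -/
def Good (D : PreData G q R n w) : Prop :=
  (∃ ν : Fin w × Fin w → G, (∀ i, ν i ∈ Nq G q) ∧ (D.gram ν).det ≠ 0) ∧
  (D.τ '' (Nq G q : Set G)).Infinite

end PreData
end UEG


namespace UEG
section
variable {F G : Type*} [Field F] [Group G] [IsAlgClosed F]
variable {V : Type*} [AddCommGroup V] [Module F V] [FiniteDimensional F V]

lemma hasEigenvector_of_root {W : Type*} [AddCommGroup W] [Module F W] [FiniteDimensional F W]
    (a : Module.End F W) (l : F) (hl : l ∈ a.charpoly.roots) : ∃ v : W, v ≠ 0 ∧ a v = l • v := by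
  have h1 : a.HasEigenvalue l := by
    rw [Module.End.hasEigenvalue_iff_isRoot_charpoly]
    exact Polynomial.isRoot_of_mem_roots hl
  obtain ⟨v, hv⟩ := h1.exists_hasEigenvector
  exact ⟨v, hv.2, hv.apply_eq_smul⟩

lemma charpoly_eq_of_roots {W : Type*} [AddCommGroup W] [Module F W] [FiniteDimensional F W]
    (a : Module.End F W) : a.charpoly = (a.charpoly.roots.map (fun l => Polynomial.X - Polynomial.C l)).prod :=
  (IsAlgClosed.splits a.charpoly).eq_prod_roots_of_monic (LinearMap.charpoly_monic a)

lemma charpoly_card {W : Type*} [AddCommGroup W] [Module F W] [FiniteDimensional F W]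
    (a : Module.End F W) : Multiset.card a.charpoly.roots = Module.finrank F W := by
  rw [← (IsAlgClosed.splits a.charpoly).natDegree_eq_card_roots, LinearMap.charpoly_natDegree]

lemma rho_inv_apply (ρ : G →* Module.End F V) (y : G) (v : V) : ρ y⁻¹ (ρ y v) = v := by
  rw [← Module.End.mul_apply, ← map_mul]; simp

lemma rho_mul_apply (ρ : G →* Module.End F V) (y z : G) (v : V) : ρ (y * z) v = ρ y (ρ z v) := by
  rw [map_mul]; rfl

lemma rho_ne (ρ : G →* Module.End F V) (y : G) (v : V) (hv : v ≠ 0) : ρ y v ≠ 0 := by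
  intro h; apply hv; rw [← rho_inv_apply ρ y v, h, map_zero]

theorem data_of_irr {O : RegAlg F G} {ρ : G →* Module.End F V} (hreg : RegRep O ρ) (hirr : Irr ρ)
    (h2 : 2 ≤ Module.finrank F V) (q : ℕ) (hq : 0 < q) :
    ∃ w ≤ Module.finrank F V, ∃ D : PreData G q F (Module.finrank F V) w, D.Good := by
  classical
  have := hirr.1
  obtain ⟨W, hW0, hWinv, hWmin⟩ := exists_min_inv
    (fun W : Submodule F V => ∀ ν ∈ Nq G q, ∀ v ∈ W, ρ ν v ∈ W) (fun _ _ _ _ => trivial)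
  obtain ⟨π, hπ⟩ := LinearMap.exists_leftInverse_of_injective W.subtype (by simp)
  have hπ' : ∀ v : W, π v = v := fun v => congrArg (fun t : W →ₗ[F] W => t v) hπ
  let βl : G → Module.End F W := fun g => π ∘ₗ ρ g ∘ₗ W.subtype
  have hβ : ∀ ν ∈ Nq G q, ∀ v : W, ((βl ν v : W) : V) = ρ ν v := by
    intro ν hν v
    have := hπ' ⟨ρ ν v, hWinv ν hν v v.2⟩
    exact congrArg Subtype.val this
  have hβmul : ∀ ν ∈ Nq G q, ∀ ν' ∈ Nq G q, βl (ν * ν') = βl ν * βl ν' := by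
    intro ν hν ν' hν'
    ext v
    rw [hβ _ (mul_mem hν hν'), Module.End.mul_apply, hβ ν hν, hβ ν' hν', rho_mul_apply]
  let βN : Nq G q →* Module.End F W :=
    { toFun := fun ν => βl ν
      map_one' := by ext v; rw [hβ _ (Subtype.mem _)]; simp
      map_mul' := fun a b => hβmul a a.2 b b.2 }
  have hnt : Nontrivial W := (Submodule.nontrivial_iff_ne_bot).mpr hW0
  have hirrN : Irr βN := by
    refine ⟨hnt, fun W' hW' => ?_⟩
    by_cases h0 : W' = ⊥
    · exact Or.inl h0
    right
    have h3 : W'.map W.subtype = W := by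
      apply hWmin
      · exact Submodule.map_subtype_le W W'
      · intro h; apply h0
        rw [Submodule.eq_bot_iff]
        intro u hu
        have h5 : W.subtype u ∈ W'.map W.subtype := ⟨u, hu, rfl⟩
        rw [h, Submodule.mem_bot] at h5
        exact Subtype.ext h5
      · rintro ν hν _ ⟨v, hv, rfl⟩
        exact ⟨βl ν v, hW' ⟨ν, hν⟩ v hv, hβ ν hν v⟩
    rw [eq_top_iff]
    rintro v -
    have : (v : V) ∈ W'.map W.subtype := by rw [h3]; exact v.2
    obtain ⟨v', hv', h4⟩ := this
    have : v' = v := Subtype.ext h4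
    exact this ▸ hv'
  -- regularity
  have hregβ : ∀ x y : G, RegFam O (fun z => βl (x * z * y)) := by
    intro x y
    have h3 : RegFam O (fun z => ρ x * ρ z * ρ y) :=
      ((RegFam.const (ρ x)).mul hreg.fam).mul (RegFam.const (ρ y))
    intro φ v
    have := h3 (φ ∘ₗ π) (v : V)
    simpa [βl] using this
  have hfamβ : ∀ {T : G → Module.End F V}, RegFam O T → RegFam O (fun z => π ∘ₗ T z ∘ₗ W.subtype) := by
    intro T h3 φ v
    exact h3 (φ ∘ₗ π) (v : V)
  have hcharl : ∀ ν ∈ Nq G q, ∀ y, (βl (y * ν * y⁻¹)).charpoly = (βl ν).charpoly := by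
    intro ν hν y
    ext m
    have h3 : (fun z => (βl (z * ν * z⁻¹)).charpoly.coeff m) ∈ O.A := by
      apply RegFam.charpoly_coeff (T := fun z => βl (z * ν * z⁻¹))
      have := hfamβ ((hreg.fam.mul (RegFam.const (ρ ν))).mul hreg.fam_inv)
      simpa [βl] using this
    obtain ⟨c, hc⟩ := O.const_of_finite _ h3 (by
      refine ((finite_multisets _ (finite_eigenvalues (ρ ν)) (Module.finrank F W)).image
        (fun s => ((s.map (fun l => Polynomial.X - Polynomial.C l)).prod).coeff m)).subset ?_
      rintro _ ⟨z, rfl⟩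
      refine ⟨(βl (z * ν * z⁻¹)).charpoly.roots, ⟨?_, charpoly_card _⟩, ?_⟩
      · intro l hl
        obtain ⟨v, hv, hv'⟩ := hasEigenvector_of_root _ l hl
        refine ⟨ρ z⁻¹ v, rho_ne _ _ _ (by simpa using hv), ?_⟩
        have h4 := hβ _ (Nq_conj q z ν hν) v
        rw [hv'] at h4
        rw [← map_smul, ← Submodule.coe_smul, h4, ← rho_mul_apply, ← rho_mul_apply]
        congr 2; group
      · simp only; rw [← charpoly_eq_of_roots])
    have h4 := hc y
    have h5 := hc 1
    simp only [one_mul, inv_one, mul_one] at h5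
    rw [h4, h5]
  have hkilll : ∀ ν ∈ Nq G q, Polynomial.aeval (ρ ν) (βl ν).charpoly = 0 := by
    intro ν hν
    obtain ⟨v, hvW, hv⟩ := (Submodule.ne_bot_iff W).mp hW0
    have h3 : LinearMap.ker (Polynomial.aeval (ρ ν) (βl ν).charpoly) = ⊤ := by
      apply hirr.top_of _ v hv
      intro y
      rw [LinearMap.mem_ker]
      have hν' := Nq_conj q y⁻¹ ν hν
      rw [← hcharl ν hν y⁻¹]
      set ν' := y⁻¹ * ν * y⁻¹⁻¹ with hν'def
      have e1 : ∀ p : Polynomial F, Polynomial.aeval (ρ ν) p (ρ y v) = ρ y (Polynomial.aeval (ρ ν') p v) := by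
        intro p
        induction p using Polynomial.induction_on with
        | C a => simp [Algebra.algebraMap_eq_smul_one]
        | add p r hp hr => simp [hp, hr]
        | monomial k a h =>
          have : ∀ k, ((ρ ν) ^ k) (ρ y v) = ρ y ((ρ ν' ^ k) v) := by
            intro k
            rw [← map_pow, ← map_pow, ← rho_mul_apply, ← rho_mul_apply, hν'def, conj_pow]
            congr 2; group
          simp [this]
      have e2 : ∀ p : Polynomial F, ∀ u : W, Polynomial.aeval (ρ ν') p u = ((Polynomial.aeval (βl ν') p u : W) : V) := by
        intro p u
        induction p using Polynomial.induction_on generalizing u with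
        | C a => simp [Algebra.algebraMap_eq_smul_one]
        | add p r hp hr => simp [hp, hr]
        | monomial k a h =>
          have : ∀ k, ((ρ ν') ^ k) u = ((((βl ν') ^ k) u : W) : V) := by
            intro k
            induction k with
            | zero => simp
            | succ k ih => 
              rw [pow_succ', pow_succ', Module.End.mul_apply, ih, Module.End.mul_apply, hβ ν' hν']
          simp [this]
      rw [e1, e2 _ ⟨v, hvW⟩, LinearMap.aeval_self_charpoly]
      simp
    exact LinearMap.ker_eq_top.mp h3
  have hspan := burnside βN hirrN
  have hsep : ∀ a : Module.End F W, (∀ ν ∈ Nq G q, LinearMap.trace F W (a * βl ν) = 0) → a = 0 := by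
    intro a ha
    apply trace_separating
    intro b
    have hb : b ∈ Submodule.span F (Set.range βN) := by rw [hspan]; trivial
    induction hb using Submodule.span_induction with
    | mem x hx =>
      obtain ⟨y, rfl⟩ := hx
      exact ha y y.2
    | zero => simp
    | add x y _ _ hx hy => rw [mul_add, map_add, hx, hy, add_zero]
    | smul c x _ hx => rw [mul_smul_comm, map_smul, hx, smul_zero]
  have hinfl : ((fun g => LinearMap.trace F W (βl g)) '' (Nq G q : Set G)).Infinite := by
    intro hfin
    obtain ⟨x, y, hxy⟩ := exists_cq_ne hreg hirr h2 q hq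
    apply hxy
    have hcq1 : ∀ x y : G, βl (cq q x y) = 1 := by
      intro x y
      rw [← sub_eq_zero]
      apply hsep
      intro ν hν
      have h3 : (fun z => LinearMap.trace F W (βl (cq q z y * ν))) ∈ O.A := by
        apply RegFam.trace (T := fun z => βl (cq q z y * ν))
        have := hfamβ (((((hreg.fam.pow q).mul (RegFam.const (ρ (y ^ q)))).mul (hreg.fam_inv.pow q)).mul
          (RegFam.const (ρ (y^q)⁻¹))).mul (RegFam.const (ρ ν)))
        convert this using 2 with z
        simp only [cq, βl, map_mul, ← map_pow, inv_pow]
      obtain ⟨c, hc⟩ := O.const_of_finite _ h3 (hfin.subset (by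
        rintro _ ⟨z, rfl⟩
        exact ⟨_, mul_mem (cq_mem q z y) hν, rfl⟩))
      have h4 := hc x
      have h5 := hc 1
      rw [show cq q 1 y * ν = ν by simp [cq]] at h5
      rw [sub_mul, map_sub, one_mul, ← hβmul _ (cq_mem q x y) _ hν, h4, h5, sub_self]
    obtain ⟨v, hvW, hv⟩ := (Submodule.ne_bot_iff W).mp hW0
    have h3 : LinearMap.ker (ρ (cq q x y) - 1) = ⊤ := by
      apply hirr.top_of _ v hv
      intro z
      have h4 := cq_conj q x y z⁻¹
      have h5 := hβ _ (cq_mem q (z⁻¹ * x * z⁻¹⁻¹) (z⁻¹ * y * z⁻¹⁻¹)) ⟨v, hvW⟩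
      rw [hcq1, ← h4] at h5
      have h6 : ρ z v = ρ z (ρ (z⁻¹ * cq q x y * z⁻¹⁻¹) v) := by rw [← h5]; simp
      simp only [LinearMap.mem_ker, LinearMap.sub_apply, Module.End.one_apply, sub_eq_zero]
      refine Eq.trans ?_ h6.symm
      rw [← rho_mul_apply, ← rho_mul_apply]
      congr 2; group
    exact sub_eq_zero.mp (LinearMap.ker_eq_top.mp h3)
  -- basis of trace-dual
  set w := Module.finrank F W with hw
  have hDl : ∃ ν : Fin w × Fin w → G, (∀ i, ν i ∈ Nq G q) ∧
      (Matrix.of fun i l => LinearMap.trace F W (βl (ν i * ν l))).det ≠ 0 := by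
    obtain ⟨f, hf1, hf2, hf3⟩ := Submodule.exists_fun_fin_finrank_span_eq F (Set.range βN)
    have hr : Module.finrank F (Submodule.span F (Set.range βN)) = w * w := by
      rw [hspan, finrank_top, Module.finrank_linearMap]
    have hf1' : ∀ i, ∃ ν : Nq G q, βN ν = f i := fun i => hf1 i
    choose ν0 hν0 using hf1'
    let e : Fin w × Fin w ≃ Fin (Module.finrank F (Submodule.span F (Set.range βN))) :=
      finProdFinEquiv.trans (finCongr hr.symm)
    refine ⟨fun i => ν0 (e i), fun i => (ν0 (e i)).2, ?_⟩
    intro hdet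
    obtain ⟨c, hc0, hc⟩ := Matrix.exists_vecMul_eq_zero_iff.mpr hdet
    apply hc0
    have h3 : ∑ i, c i • f (e i) = 0 := by
      apply trace_separating
      intro b
      have hb : b ∈ Submodule.span F (Set.range f) := by rw [hf2, hspan]; trivial
      induction hb using Submodule.span_induction with
      | mem x hx =>
        obtain ⟨y, rfl⟩ := hx
        obtain ⟨l, rfl⟩ := e.surjective y
        have h4 := congrFun hc l
        simp only [Matrix.vecMul, dotProduct, Matrix.of_apply, Pi.zero_apply] at h4
        rw [Finset.sum_mul, map_sum, ← h4]
        refine Finset.sum_congr rfl fun i _ => ?_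
        rw [smul_mul_assoc, map_smul, ← hν0, ← hν0, ← map_mul, smul_eq_mul]
        rfl
      | zero => simp
      | add x y _ _ hx hy => rw [mul_add, map_add, hx, hy, add_zero]
      | smul c x _ hx => rw [mul_smul_comm, map_smul, hx, smul_zero]
    have h5 := Fintype.linearIndependent_iff.mp (hf3.comp e e.injective) c h3
    funext i; exact h5 i
  -- now matrices
  let bV := Module.finBasis F V
  let bW := Module.finBasis F W
  let PB : Matrix (Fin w) (Fin (Module.finrank F V)) F := LinearMap.toMatrix bV bW π
  let PB' : Matrix (Fin (Module.finrank F V)) (Fin w) F := LinearMap.toMatrix bW bV W.subtype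
  have hmat : ∀ g, PB * LinearMap.toMatrix bV bV (ρ g) * PB'
      = LinearMap.toMatrix bW bW (βl g) := by
    intro g
    simp only [PB, PB']
    rw [← LinearMap.toMatrix_comp, ← LinearMap.toMatrix_comp]
    rfl
  refine ⟨w, Submodule.finrank_le W, ⟨(LinearMap.toMatrixAlgEquiv bV).toMonoidHom.comp ρ, PB,
    PB', ?_, ?_, ?_, ?_⟩, ?_, ?_⟩
  · simp only [PB, PB']
    rw [← LinearMap.toMatrix_comp, hπ, LinearMap.toMatrix_id]
  · intro ν hν
    change LinearMap.toMatrix bV bV (ρ ν) * PB' = PB' * (PB * LinearMap.toMatrix bV bV (ρ ν) * PB')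
    rw [hmat]
    simp only [PB']
    rw [← LinearMap.toMatrix_comp, ← LinearMap.toMatrix_comp]
    congr 1
    ext v
    exact (hβ ν hν v).symm
  · intro ν hν y
    change (PB * LinearMap.toMatrix bV bV (ρ (y * ν * y⁻¹)) * PB').charpoly =
      (PB * LinearMap.toMatrix bV bV (ρ ν) * PB').charpoly
    rw [hmat, hmat, LinearMap.charpoly_toMatrix, LinearMap.charpoly_toMatrix, hcharl ν hν]
  · intro ν hν
    change Polynomial.aeval (LinearMap.toMatrixAlgEquiv bV (ρ ν))
      (PB * LinearMap.toMatrix bV bV (ρ ν) * PB').charpoly = 0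
    rw [hmat, LinearMap.charpoly_toMatrix, Polynomial.aeval_algEquiv, AlgHom.comp_apply, hkilll ν hν, map_zero]
  · obtain ⟨ν, h3, h4⟩ := hDl
    refine ⟨ν, h3, ?_⟩
    convert h4 using 2
    ext i l
    change (PB * LinearMap.toMatrix bV bV (ρ (ν i * ν l)) * PB').trace = _
    rw [hmat, ← LinearMap.trace_eq_matrix_trace]; rfl
  · convert hinfl using 2 with g
    change (PB * LinearMap.toMatrix bV bV (ρ g) * PB').trace = _
    rw [hmat, ← LinearMap.trace_eq_matrix_trace]
end
end UEG


universe u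
namespace UEG
section
variable {F G : Type*} [Field F] [Group G] [IsAlgClosed F]

/-- The conclusion we want for a group. -/
def HasData (F G : Type*) [Field F] [Group G] (n : ℕ) : Prop :=
  ∀ q : ℕ, 0 < q → ∃ w ≤ n, ∃ D : PreData G q F n w, D.Good

lemma commutator_ker {V : Type*} [AddCommGroup V] [Module F V]
    (ρ : G →* Module.End F V) (H : Subgroup G) (h : ∀ g ∈ H, ∀ k ∈ H, ρ g * ρ k = ρ k * ρ g) :
    ⁅H, H⁆ ≤ ρ.ker := by
  rw [Subgroup.commutator_le]
  intro g hg k hk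
  rw [MonoidHom.mem_ker, commutatorElement_def, map_mul, map_mul, map_mul, h g hg k hk,
    ← map_mul, ← map_mul, ← map_mul]
  simp

theorem solv_or_data (O : RegAlg F G) : ∀ (N : ℕ) (V : Type u) [AddCommGroup V] [Module F V]
    [FiniteDimensional F V] (ρ : G →* Module.End F V), RegRep O ρ → Module.finrank F V ≤ N →
    (∃ k, derivedSeries G k ≤ ρ.ker) ∨ ∃ n ≤ Module.finrank F V, HasData F G n := by
  intro N
  induction N with
  | zero =>
    intro V _ _ _ ρ hreg hN
    left
    refine ⟨0, fun g _ => ?_⟩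
    have : Subsingleton V := (Module.finrank_zero_iff (R := F)).mp (by omega)
    rw [MonoidHom.mem_ker]
    ext v
    exact Subsingleton.elim _ _
  | succ N ih =>
    intro V _ _ _ ρ hreg hN
    by_cases hV : Nontrivial V
    swap
    · left
      refine ⟨0, fun g _ => ?_⟩
      have : Subsingleton V := not_nontrivial_iff_subsingleton.mp hV
      rw [MonoidHom.mem_ker]
      ext v
      exact Subsingleton.elim _ _
    by_cases hirr : Irr ρ
    · by_cases h2 : 2 ≤ Module.finrank F V
      · right
        exact ⟨_, le_rfl, fun q hq => data_of_irr hreg hirr h2 q hq⟩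
      · left
        refine ⟨1, ?_⟩
        rw [derivedSeries_succ]
        apply commutator_ker
        intro g _ k _
        have h1 : Module.finrank F V = 1 := by
          have := Module.finrank_pos (R := F) (M := V); omega
        obtain ⟨v, hv0, hv⟩ := finrank_eq_one_iff'.mp h1
        have h3 : ∀ a : Module.End F V, ∃ c : F, ∀ u, a u = c • u := by
          intro a
          obtain ⟨c, hc⟩ := hv (a v)
          refine ⟨c, fun u => ?_⟩
          obtain ⟨c', rfl⟩ := hv u
          rw [map_smul, ← hc, smul_comm]
        obtain ⟨c, hc⟩ := h3 (ρ g)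
        obtain ⟨c', hc'⟩ := h3 (ρ k)
        ext u
        simp only [Module.End.mul_apply, hc, hc']
        rw [smul_comm]
    · have : ∃ W : Submodule F V, (∀ g, ∀ v ∈ W, ρ g v ∈ W) ∧ W ≠ ⊥ ∧ W ≠ ⊤ := by
        by_contra hcon
        push Not at hcon
        apply hirr
        refine ⟨hV, fun W hW => ?_⟩
        by_cases h0 : W = ⊥
        · exact Or.inl h0
        · exact Or.inr (hcon W hW h0)
      obtain ⟨W, hWinv, hW0, hW1⟩ := this
      let ρ1 : G →* Module.End F W :=
        { toFun := fun g => (ρ g).restrict (hWinv g)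
          map_one' := by ext v; simp
          map_mul' := fun a b => by ext v; simp }
      let ρ2 : G →* Module.End F (V ⧸ W) :=
        { toFun := fun g => Submodule.mapQ W W (ρ g) (hWinv g)
          map_one' := by
            ext v; simp
          map_mul' := fun a b => by ext v; simp }
      have hr1 : RegRep O ρ1 := by
        obtain ⟨π, hπ⟩ := LinearMap.exists_leftInverse_of_injective W.subtype (by simp)
        have hπ' : ∀ v : W, π v = v := fun v => congrArg (fun t : W →ₗ[F] W => t v) hπ
        intro φ v
        have h1 := hreg (φ ∘ₗ π) v
        have h2 : ∀ x, (φ ∘ₗ π) (ρ x v) = φ (ρ1 x v) := by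
          intro x
          have := hπ' (ρ1 x v)
          rw [← this]; rfl
        simpa only [h2] using h1
      have hr2 : RegRep O ρ2 := by
        intro φ v
        obtain ⟨v, rfl⟩ := Submodule.mkQ_surjective W v
        exact hreg (φ ∘ₗ W.mkQ) v
      have hf1 := Submodule.finrank_lt hW1
      have hf2 : Module.finrank F (V ⧸ W) < Module.finrank F V := by
        have h3 := Submodule.finrank_quotient_add_finrank W
        have h4 : 0 < Module.finrank F W := by
          have : Nontrivial W := (Submodule.nontrivial_iff_ne_bot).mpr hW0
          exact Module.finrank_pos
        omega
      rcases ih W ρ1 hr1 (by omega) with ⟨k1, hk1⟩ | ⟨n, hn, hd⟩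
      swap
      · right; exact ⟨n, by omega, hd⟩
      rcases ih (V ⧸ W) ρ2 hr2 (by omega) with ⟨k2, hk2⟩ | ⟨n, hn, hd⟩
      swap
      · right; exact ⟨n, by omega, hd⟩
      left
      refine ⟨max k1 k2 + 1, ?_⟩
      rw [derivedSeries_succ]
      apply commutator_ker
      have ha : ∀ g ∈ derivedSeries G (max k1 k2), (∀ v ∈ W, ρ g v = v) ∧ ∀ v, ρ g v - v ∈ W := by
        intro g hg
        constructor
        · intro v hv
          have h3 := hk1 (derivedSeries_antitone G (le_max_left k1 k2) hg)
          rw [MonoidHom.mem_ker] at h3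
          exact congrArg Subtype.val (congrArg (fun t : Module.End F W => t ⟨v, hv⟩) h3)
        · intro v
          have h3 := hk2 (derivedSeries_antitone G (le_max_right k1 k2) hg)
          rw [MonoidHom.mem_ker] at h3
          have h4 : W.mkQ (ρ g v) = W.mkQ v := congrArg (fun t : Module.End F (V ⧸ W) => t (W.mkQ v)) h3
          exact (Submodule.Quotient.eq W).mp h4
      intro g hg k hk
      ext v
      have h1 := (ha g hg).1 _ ((ha k hk).2 v)
      have h2 := (ha k hk).1 _ ((ha g hg).2 v)
      rw [map_sub] at h1 h2
      simp only [Module.End.mul_apply]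
      have h3 : ρ g (ρ k v) = ρ k v - v + ρ g v := by rw [← h1]; abel
      have h4 : ρ k (ρ g v) = ρ g v - v + ρ k v := by rw [← h2]; abel
      rw [h3, h4]; abel

end

section coord
variable {F G : Type*} [Field F] [Group G] {d : ℕ} (ρ : G →* Matrix (Fin d) (Fin d) F)

/-- matrix coefficients -/
def coefs : Set (G → F) :=
  Set.range (fun p : Fin d × Fin d => fun x => ρ x p.1 p.2) ∪
  Set.range (fun p : Fin d × Fin d => fun x => ρ x⁻¹ p.1 p.2)

lemma coefs_finite : (coefs ρ).Finite := (Set.finite_range _).union (Set.finite_range _)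

/-- coordinate algebra -/
abbrev CA : Subalgebra F (G → F) := Algebra.adjoin F (coefs ρ)

instance : IsNoetherianRing (CA ρ) := by
  have : Algebra.FiniteType F (CA ρ) := by
    rw [← Subalgebra.fg_iff_finiteType]
    have h := Subalgebra.fg_adjoin_finset (R := F) (coefs_finite ρ).toFinset
    simpa using h
  exact Algebra.FiniteType.isNoetherianRing F _

/-- restriction along a map preserves... translation -/
def transl (h : G) : (G → F) →ₐ[F] (G → F) where
  toFun f := fun x => f (x * h)
  map_one' := rfl
  map_mul' _ _ := rfl
  map_zero' := rfl
  map_add' _ _ := rfl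
  commutes' _ := rfl

lemma transl_apply (h : G) (f : G → F) (x : G) : transl h f x = f (x * h) := rfl

lemma transl_mem (h : G) : CA ρ ≤ (CA ρ).comap (transl (F := F) h) := by
  apply Algebra.adjoin_le
  rintro f (⟨⟨i, j⟩, rfl⟩ | ⟨⟨i, j⟩, rfl⟩)
  · have : transl (F := F) h (fun x => ρ x i j) = ∑ k, ρ h k j • fun x => ρ x i k := by
      funext x
      simp [transl_apply, Matrix.mul_apply, mul_comm]
    change transl (F := F) h (fun x => ρ x i j) ∈ CA ρ
    rw [this]
    refine Subalgebra.sum_mem _ fun k _ => ?_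
    refine Subalgebra.smul_mem _ ?_ _
    exact Algebra.subset_adjoin (Or.inl ⟨(i, k), rfl⟩)
  · have : transl (F := F) h (fun x => ρ x⁻¹ i j) = ∑ k, ρ h⁻¹ i k • fun x => ρ x⁻¹ k j := by
      funext x
      simp [transl_apply, Matrix.mul_apply]
    change transl (F := F) h (fun x => ρ x⁻¹ i j) ∈ CA ρ
    rw [this]
    refine Subalgebra.sum_mem _ fun k _ => ?_
    refine Subalgebra.smul_mem _ ?_ _
    exact Algebra.subset_adjoin (Or.inr ⟨(k, j), rfl⟩)

/-- translation on the coordinate algebra -/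
def tr (h : G) : CA ρ →ₐ[F] CA ρ :=
  ((transl h).comp (CA ρ).val).codRestrict (CA ρ) (fun f => transl_mem ρ h f.2)

lemma tr_apply (h : G) (f : CA ρ) (x : G) : (tr ρ h f : G → F) x = (f : G → F) (x * h) := rfl

lemma tr_mul (h h' : G) (f : CA ρ) : tr ρ (h * h') f = tr ρ h (tr ρ h' f) := by
  apply Subtype.ext; funext x; simp [tr_apply, mul_assoc]

lemma tr_one (f : CA ρ) : tr ρ 1 f = f := by
  apply Subtype.ext; funext x; simp [tr_apply]

/-- vanishing ideal -/
def van (H : Subgroup G) : Ideal (CA ρ) where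
  carrier := {f | ∀ h ∈ H, (f : G → F) h = 0}
  add_mem' := fun ha hb h hh => by simp [ha h hh, hb h hh]
  zero_mem' := fun h _ => rfl
  smul_mem' := fun c f hf h hh => by simp [hf h hh]

lemma mem_van (H : Subgroup G) (f : CA ρ) : f ∈ van ρ H ↔ ∀ h ∈ H, (f : G → F) h = 0 := Iff.rfl

/-- evaluation at one -/
def ev1 : CA ρ →ₐ[F] F := (Pi.evalAlgHom F (fun _ : G => F) 1).comp (CA ρ).val

lemma ev1_apply (f : CA ρ) : ev1 ρ f = (f : G → F) 1 := rfl

lemma exists_prime_van : ∃ H : Subgroup G, H.FiniteIndex ∧ (van ρ H).IsPrime := by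
  obtain ⟨_, ⟨H, hH, rfl⟩, hmax⟩ := set_has_maximal_iff_noetherian.mpr
    (inferInstance : IsNoetherianRing (CA ρ)) {I | ∃ H : Subgroup G, H.FiniteIndex ∧ I = van ρ H}
    ⟨_, ⊤, inferInstance, rfl⟩
  refine ⟨H, hH, ?_⟩
  have hker : (RingHom.ker (ev1 ρ)).IsPrime := RingHom.ker_isPrime _
  obtain ⟨P, hP, hPle⟩ := Ideal.exists_minimalPrimes_le (I := van ρ H) (J := RingHom.ker (ev1 ρ)) (by
    intro f hf
    rw [RingHom.mem_ker, ev1_apply]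
    exact hf 1 H.one_mem)
  have hcomp : ∀ h h' : G, ∀ Q : Ideal (CA ρ), Q.comap (tr ρ (h * h')) = (Q.comap (tr ρ h)).comap (tr ρ h') := by
    intro h h' Q; ext f; simp only [Ideal.mem_comap, tr_mul]
  have hone : ∀ Q : Ideal (CA ρ), Q.comap (tr ρ 1) = Q := by
    intro Q; ext f; simp only [Ideal.mem_comap, tr_one]
  have hvan : ∀ h ∈ H, van ρ H ≤ (van ρ H).comap (tr ρ h) := by
    intro h hh f hf x hx
    rw [tr_apply]; exact hf _ (H.mul_mem hx hh)
  have hmin : ∀ h ∈ H, P.comap (tr ρ h) ∈ (van ρ H).minimalPrimes := by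
    intro h hh
    have := hP.1.1
    refine ⟨⟨Ideal.IsPrime.comap _, (hvan h hh).trans (Ideal.comap_mono hP.1.2)⟩, ?_⟩
    rintro Q ⟨hQ1, hQ2⟩ hQle
    have h3 : Q.comap (tr ρ h⁻¹) ≤ P := by
      have := Ideal.comap_mono (f := tr ρ h⁻¹) hQle
      rwa [← hcomp, mul_inv_cancel, hone] at this
    have h4 := hP.2 ⟨Ideal.IsPrime.comap (tr ρ h⁻¹),
      (hvan _ (H.inv_mem hh)).trans (Ideal.comap_mono hQ2)⟩ h3
    have := Ideal.comap_mono (f := tr ρ h) h4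
    rwa [← hcomp, inv_mul_cancel, hone] at this
  let S : Subgroup H :=
    { carrier := {h | P.comap (tr ρ (h : G)) = P}
      mul_mem' := by
        intro a b ha hb
        change P.comap (tr ρ ((a : G) * b)) = P
        rw [hcomp]
        have ha' : P.comap (tr ρ (a : G)) = P := ha
        rw [ha']; exact hb
      one_mem' := hone P
      inv_mem' := by
        intro a ha
        change P.comap (tr ρ (a : G)⁻¹) = P
        have ha' : P.comap (tr ρ (a : G)) = P := ha
        conv_lhs => rw [← ha', ← hcomp, mul_inv_cancel, hone] }
  have hmemS : ∀ h : H, h ∈ S ↔ P.comap (tr ρ (h : G)) = P := fun h => Iff.rfl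
  have hS : S.FiniteIndex := by
    rw [Subgroup.finiteIndex_iff_finite_quotient]
    have hfin := Ideal.finite_minimalPrimes_of_isNoetherianRing _ (van ρ H)
    have : Finite (van ρ H).minimalPrimes := hfin
    refine Finite.of_injective (fun x : H ⧸ S => (⟨P.comap (tr ρ ((x.out : H) : G)⁻¹), hmin _ (H.inv_mem x.out.2)⟩ :
      (van ρ H).minimalPrimes)) ?_
    intro x y hxy
    have h3 := congrArg Subtype.val hxy
    simp only at h3
    rw [← Quotient.out_eq x, ← Quotient.out_eq y]
    apply QuotientGroup.eq.mpr
    rw [hmemS]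
    rw [Subgroup.coe_mul, Subgroup.coe_inv, hcomp, h3, ← hcomp, inv_mul_cancel, hone]
  have hS' : (S.map H.subtype).FiniteIndex := by
    constructor
    rw [Subgroup.index_map_subtype]
    exact mul_ne_zero hS.index_ne_zero hH.index_ne_zero
  have hPv : P ≤ van ρ (S.map H.subtype) := by
    rintro f hf _ ⟨h, hh, rfl⟩
    have h3 : P.comap (tr ρ (h : G)) = P := hh
    rw [← h3] at hf
    have h4 := hPle hf
    rw [RingHom.mem_ker, ev1_apply, tr_apply, one_mul] at h4
    exact h4
  have hle : van ρ H ≤ van ρ (S.map H.subtype) := by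
    rintro f hf _ ⟨h, hh, rfl⟩
    exact hf h h.2
  have heq : van ρ H = van ρ (S.map H.subtype) := by
    by_contra hne
    exact hmax _ ⟨_, hS', rfl⟩ (lt_of_le_of_ne hle hne)
  have : van ρ H = P := le_antisymm hP.1.2 (heq ▸ hPv)
  rw [this]; exact hP.1.1

/-- restriction of functions -/
def resH (H : Subgroup G) : (G → F) →ₐ[F] (H → F) where
  toFun f := fun x => f x
  map_one' := rfl
  map_mul' _ _ := rfl
  map_zero' := rfl
  map_add' _ _ := rfl
  commutes' _ := rfl

theorem exists_data [IsAlgClosed F] (hinj : Function.Injective ρ)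
    (hns : ¬ ∃ H : Subgroup G, H.FiniteIndex ∧ IsSolvable ↥H) :
    ∃ H : Subgroup G, H.FiniteIndex ∧ ∃ n, HasData F H n := by
  obtain ⟨H, hH, hp⟩ := exists_prime_van ρ
  refine ⟨H, hH, ?_⟩
  let O : RegAlg F H :=
    { A := (CA ρ).map (resH H)
      dom := by
        rintro _ ⟨f, hf, rfl⟩ _ ⟨g, hg, rfl⟩ h
        have h1 : (⟨f, hf⟩ * ⟨g, hg⟩ : CA ρ) ∈ van ρ H := by
          intro x hx
          exact congrFun h ⟨x, hx⟩
        rcases hp.mem_or_mem h1 with h | h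
        · left; funext x; exact h x x.2
        · right; funext x; exact h x x.2 }
  let ρ' : H →* Module.End F (Fin d → F) :=
    ((Matrix.toLinAlgEquiv' (R := F) (n := Fin d)).toMonoidHom.comp ρ).comp H.subtype
  have hρ' : ∀ x : H, ∀ v, ρ' x v = ρ x *ᵥ v := fun x v => rfl
  have key : ∀ (y : G → G) (φ : Module.Dual F (Fin d → F)) (v : Fin d → F),
      (∀ i j, (fun x => ρ (y x) i j) ∈ CA ρ) → (fun x => φ (ρ (y x) *ᵥ v)) ∈ CA ρ := by
    intro y φ v h
    have : (fun x => φ (ρ (y x) *ᵥ v)) = ∑ i, ∑ j, (φ (Pi.single i 1) * v j) • fun x => ρ (y x) i j := by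
      funext x
      rw [LinearMap.pi_apply_eq_sum_univ φ]
      simp only [Finset.sum_apply, Pi.smul_apply, smul_eq_mul, Matrix.mulVec, dotProduct, Finset.sum_mul]
      refine Finset.sum_congr rfl fun i _ => Finset.sum_congr rfl fun j _ => ?_
      have : (fun j => if i = j then (1 : F) else 0) = Pi.single i 1 := by
        funext j; rw [Pi.single_apply]; simp [eq_comm]
      rw [this]; ring
    rw [this]
    exact Subalgebra.sum_mem _ fun i _ => Subalgebra.sum_mem _ fun j _ => Subalgebra.smul_mem _ (h i j) _
  have hreg : RegRep O ρ' := by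
    intro φ v
    exact ⟨⟨_, key (fun x => x) φ v fun i j => Algebra.subset_adjoin (Or.inl ⟨(i, j), rfl⟩), rfl⟩,
      ⟨_, key (fun x => x⁻¹) φ v fun i j => Algebra.subset_adjoin (Or.inr ⟨(i, j), rfl⟩), rfl⟩⟩
  rcases solv_or_data O _ _ ρ' hreg le_rfl with ⟨k, hk⟩ | ⟨n, _, hn⟩
  · exfalso
    apply hns
    refine ⟨H, hH, ?_⟩
    refine ⟨k, ?_⟩
    rw [eq_bot_iff]
    intro x hx
    have h3 := hk hx
    rw [MonoidHom.mem_ker] at h3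
    have h4 : ρ x = 1 := (Matrix.toLinAlgEquiv' (R := F) (n := Fin d)).injective (h3.trans (map_one _).symm)
    rw [← map_one ρ] at h4
    exact Subtype.ext (hinj h4)
  · exact ⟨n, hn⟩

end coord
end UEG


namespace UEG
section hankel
variable {F G : Type*} [Field F] [Group G] 

/-- a Hankel basis -/
lemma hankel_basis (Φ : G → F) {I : Type*} [Fintype I] (A B : I → G → F)
    (h : ∀ x y, Φ (x * y) = ∑ f, A f x * B f y) :
    (∀ (u : ℕ) (x γ : Fin u → G), (Matrix.of fun l m => Φ (x l * γ m)).det ≠ 0 → u ≤ Fintype.card I) ∧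
    ∃ (u : ℕ) (x γ : Fin u → G), (Matrix.of fun l m => Φ (x l * γ m)).det ≠ 0 ∧
      ∀ z y, Φ (z * y) = ∑ l, (∑ m, Φ (z * γ m) * (Matrix.of fun l m => Φ (x l * γ m))⁻¹ m l) * Φ (x l * y) := by
  classical
  have hb : ∀ (u : ℕ) (x γ : Fin u → G), (Matrix.of fun l m => Φ (x l * γ m)).det ≠ 0 → u ≤ Fintype.card I := by
    intro u x γ hd
    have h1 : (Matrix.of fun l m => Φ (x l * γ m)) =
        (Matrix.of fun l f => A f (x l)) * (Matrix.of fun f m => B f (γ m)) := by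
      ext l m; simp [Matrix.mul_apply, h]
    have h2 : (Matrix.of fun l m => Φ (x l * γ m)).rank = u := by
      rw [Matrix.rank_of_isUnit _ ((Matrix.isUnit_iff_isUnit_det _).mpr (isUnit_iff_ne_zero.mpr hd))]
      simp
    rw [← h2, h1]
    exact (Matrix.rank_mul_le_left _ _).trans (Matrix.rank_le_card_width _)
  refine ⟨hb, ?_⟩
  let p : ℕ → Prop := fun u => ∃ x γ : Fin u → G, (Matrix.of fun l m => Φ (x l * γ m)).det ≠ 0
  have hp0 : p 0 := ⟨Fin.elim0, Fin.elim0, by simp⟩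
  have hspec := Nat.findGreatest_spec (P := p) (Nat.zero_le (Fintype.card I)) hp0
  have hgr : ∀ k, Nat.findGreatest p (Fintype.card I) < k → ¬ p k := by
    intro k hk ⟨x, γ, hd⟩
    exact Nat.findGreatest_is_greatest hk (hb k x γ hd) ⟨x, γ, hd⟩
  generalize Nat.findGreatest p (Fintype.card I) = u at hspec hgr
  obtain ⟨x, γ, hd⟩ := hspec
  refine ⟨u, x, γ, hd, fun z y => ?_⟩
  set V := Matrix.of fun l m => Φ (x l * γ m) with hV
  have h3 : (Matrix.fromBlocks V (Matrix.of fun l (_ : Fin 1) => Φ (x l * y))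
      (Matrix.of fun (_ : Fin 1) m => Φ (z * γ m)) (Matrix.of fun (_ _ : Fin 1) => Φ (z * y))).det = 0 := by
    by_contra hne
    apply hgr (u + 1) (Nat.lt_succ_self u)
    refine ⟨(Sum.elim x (fun _ => z)) ∘ finSumFinEquiv.symm, (Sum.elim γ (fun _ => y)) ∘ finSumFinEquiv.symm, ?_⟩
    convert hne using 1
    rw [← Matrix.det_reindex_self (finSumFinEquiv (m := u) (n := 1))]
    congr 1
    ext i j
    simp only [Matrix.reindex_apply, Matrix.submatrix_apply, Matrix.of_apply, Function.comp]
    rcases finSumFinEquiv.symm i with i | i <;> rcases finSumFinEquiv.symm j with j | j <;> simp [hV]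
  haveI : Invertible V := Matrix.invertibleOfIsUnitDet V (isUnit_iff_ne_zero.mpr hd)
  rw [Matrix.det_fromBlocks₁₁] at h3
  rcases mul_eq_zero.mp h3 with h4 | h4
  · exact absurd h4 hd
  · rw [Matrix.det_unique, Matrix.sub_apply, sub_eq_zero] at h4
    simp only [Matrix.mul_apply, Matrix.of_apply, Matrix.invOf_eq_nonsing_inv] at h4
    exact h4

lemma det_expand {ι : Type*} [Fintype ι] [DecidableEq ι] (a b q : Matrix ι ι F) :
    (a * b + q).det = ∑ f : ι → Option ι, (∏ i, (f i).elim 1 (fun k => a i k)) *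
      Matrix.det (Matrix.of fun i => (f i).elim (q i) (fun k => b k)) := by
  classical
  have h1 : (a * b + q) = fun i => ∑ o : Option ι, (o.elim 1 (fun k => a i k)) • (o.elim (q i) (fun k => b k)) := by
    funext i j
    simp [Matrix.mul_apply, Fintype.sum_option, add_comm]
  have h2 : (a * b + q).det = Matrix.detRowAlternating (R := F) (fun i => ∑ o : Option ι, (o.elim 1 (fun k => a i k)) • (o.elim (q i) (fun k => b k))) := by
    rw [← h1]; rfl
  rw [h2]
  have h3 := MultilinearMap.map_sum (Matrix.detRowAlternating (R := F) (n := ι)).toMultilinearMap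
    (fun (i : ι) (o : Option ι) => (o.elim 1 (fun k => a i k)) • (o.elim (q i) (fun k => b k)))
  refine Eq.trans h3 (Finset.sum_congr rfl fun f _ => ?_)
  have h4 := MultilinearMap.map_smul_univ (Matrix.detRowAlternating (R := F) (n := ι)).toMultilinearMap
    (fun i => (f i).elim 1 (fun k => a i k)) (fun i => (f i).elim (q i) (fun k => b k))
  exact h4

/-- the `Φ`-lemma about existence of `h` -/
lemma exists_h (Φ : G → F) (U : ℕ) (hone : Φ 1 = 1)
    (hU : ∀ (u : ℕ) (x γ : Fin u → G), (Matrix.of fun l m => Φ (x l * γ m)).det ≠ 0 → u ≤ U)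
    (q : ℕ) (hq : ∀ m, 1 ≤ m → m ≤ U → m ∣ q) (g : G) (hg : g ∈ Nq G q) (hg1 : Φ g ≠ 1) :
    ∃ h, Φ h ≠ 0 ∧ ∃ x, Φ (x * h) ≠ Φ h * Φ x := by
  by_contra hcon
  push Not at hcon
  let K : Subgroup G :=
    { carrier := {h | Φ h ≠ 0}
      mul_mem' := by
        intro a b ha hb
        change Φ (a * b) ≠ 0
        rw [hcon b hb]; exact mul_ne_zero hb ha
      one_mem' := by change Φ 1 ≠ 0; rw [hone]; exact one_ne_zero
      inv_mem' := by
        intro a ha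
        have := hcon a ha a⁻¹
        rw [inv_mul_cancel, hone] at this
        exact right_ne_zero_of_mul (this ▸ one_ne_zero) }
  have hK : ∀ h, h ∈ K ↔ Φ h ≠ 0 := fun h => Iff.rfl
  have hmul : ∀ x, ∀ h ∈ K, Φ (x * h) = Φ x * Φ h := fun x h hh => by rw [hcon h hh, mul_comm]
  have hinv : ∀ h ∈ K, Φ h⁻¹ = (Φ h)⁻¹ := by
    intro h hh
    have := hmul h⁻¹ h hh
    rw [inv_mul_cancel, hone] at this
    exact eq_inv_of_mul_eq_one_left this.symm
  have hpow : ∀ x : G, x ^ q ∈ K := by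
    intro x
    have : ∃ m, 1 ≤ m ∧ m ≤ U ∧ x ^ m ∈ K := by
      by_contra hno
      push Not at hno
      have h1 : (Matrix.of fun (l m : Fin (U + 1)) => Φ ((x ^ (l : ℕ))⁻¹ * x ^ (m : ℕ))) = 1 := by
        ext l m
        rw [Matrix.of_apply, Matrix.one_apply]
        rcases lt_trichotomy l m with hlt | heq | hlt
        · rw [if_neg (ne_of_lt hlt)]
          have h2 : (x ^ (l : ℕ))⁻¹ * x ^ (m : ℕ) = x ^ ((m : ℕ) - l) := by
            rw [inv_mul_eq_iff_eq_mul, ← pow_add]; congr 1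
            have : (l : ℕ) < m := hlt
            omega
          rw [h2]
          have h3 := hno ((m : ℕ) - l) (by have : (l : ℕ) < m := hlt; omega) (by have := m.2; omega)
          rw [hK] at h3
          exact not_not.mp h3
        · subst heq; simp [hone]
        · rw [if_neg (ne_of_gt hlt)]
          have h2 : (x ^ (l : ℕ))⁻¹ * x ^ (m : ℕ) = (x ^ ((l : ℕ) - m))⁻¹ := by
            rw [inv_mul_eq_iff_eq_mul, eq_mul_inv_iff_mul_eq, ← pow_add]; congr 1
            have : (m : ℕ) < l := hlt
            omega
          rw [h2]
          have h3 := hno ((l : ℕ) - m) (by have : (m : ℕ) < l := hlt; omega) (by have := l.2; omega)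
          by_contra h4
          exact h3 (by simpa using K.inv_mem ((hK _).mpr h4))
      have := hU (U + 1) (fun l => (x ^ (l : ℕ))⁻¹) (fun m => x ^ (m : ℕ)) (by rw [h1]; simp)
      omega
    obtain ⟨m, h1, h2, h3⟩ := this
    obtain ⟨r, hr⟩ := hq m h1 h2
    rw [hr, pow_mul]
    exact K.pow_mem h3 r
  apply hg1
  have : g ∈ K ∧ Φ g = 1 := by
    clear hg1
    induction hg using Subgroup.closure_induction with
    | mem x hx =>
      obtain ⟨x, y, rfl⟩ := hx
      have hx := hpow x
      have hy := hpow y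
      refine ⟨K.mul_mem (K.mul_mem (K.mul_mem hx hy) (K.inv_mem hx)) (K.inv_mem hy), ?_⟩
      rw [cq, hmul _ _ (K.inv_mem hy), hmul _ _ (K.inv_mem hx), hmul _ _ hy, hinv _ hx, hinv _ hy]
      have := (hK _).mp hx
      have := (hK _).mp hy
      field_simp
    | one => exact ⟨K.one_mem, hone⟩
    | mul a b _ _ ha hb => exact ⟨K.mul_mem ha.1 hb.1, by rw [hmul _ _ hb.1, ha.2, hb.2, one_mul]⟩
    | inv a _ ha => exact ⟨K.inv_mem ha.1, by rw [hinv _ ha.1, ha.2, inv_one]⟩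
  exact this.2
end hankel

section growth
variable {F : Type*} [Field F] (A : AbsoluteValue F ℝ)
  {ι : Type*} [Fintype ι] [DecidableEq ι]

lemma growth_aux (M : Matrix ι ι F) (r0 r : ℝ) (h0 : 0 ≤ r0) (hr : r0 < r) (s : Multiset F) :
    ∀ Z : Matrix ι ι F, (∀ μ ∈ s, A μ ≤ r0) →
      Polynomial.aeval M (s.map fun μ => (Polynomial.X - Polynomial.C μ)).prod * Z = 0 →
      ∃ K, ∀ N i j, A ((M ^ N * Z) i j) ≤ K * r ^ N := by
  induction s using Multiset.induction_on with
  | empty =>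
    intro Z _ h
    have hZ : Z = 0 := by simpa using h
    exact ⟨0, fun N i j => by simp [hZ]⟩
  | cons μ s ih =>
    intro Z hs h
    have hμ : A μ ≤ r0 := hs μ (Multiset.mem_cons_self _ _)
    obtain ⟨K, hK⟩ := ih ((M - algebraMap F _ μ) * Z) (fun ν hν => hs ν (Multiset.mem_cons_of_mem hν)) (by
      rw [Multiset.map_cons, Multiset.prod_cons, mul_comm, map_mul] at h
      rw [← mul_assoc]
      simpa using h)
    have hrp : 0 < r := h0.trans_lt hr
    have hfin : ∃ K0, ∀ i j, A (Z i j) ≤ K0 := by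
      refine ⟨∑ i, ∑ j, A (Z i j), fun i j => ?_⟩
      exact (Finset.single_le_sum (f := fun j => A (Z i j)) (fun _ _ => A.nonneg _) (Finset.mem_univ j)).trans
        (Finset.single_le_sum (f := fun i => ∑ j, A (Z i j)) (fun _ _ => Finset.sum_nonneg fun _ _ => A.nonneg _) (Finset.mem_univ i))
    obtain ⟨K0, hK0⟩ := hfin
    refine ⟨max K0 (K / (r - r0)), fun N => ?_⟩
    induction N with
    | zero => intro i j; simpa using Or.inl (hK0 i j)
    | succ N ihN =>
      intro i j
      have h1 : (M ^ (N + 1) * Z) i j = (M ^ N * ((M - algebraMap F _ μ) * Z)) i j + μ * (M ^ N * Z) i j := by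
        have : M ^ (N + 1) * Z = M ^ N * ((M - algebraMap F _ μ) * Z) + μ • (M ^ N * Z) := by
          rw [sub_mul, mul_sub, pow_succ, mul_assoc, Algebra.algebraMap_eq_smul_one]
          simp
        rw [this]; simp
      rw [h1]
      refine (A.add_le _ _).trans ?_
      rw [A.map_mul]
      set K' := max K0 (K / (r - r0))
      have h2 : K ≤ K' * (r - r0) := (div_le_iff₀ (by linarith)).mp (le_max_right _ _)
      have h3 := hK N i j
      have h4 := ihN i j
      have h5 : A μ * A ((M ^ N * Z) i j) ≤ r0 * (K' * r ^ N) :=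
        mul_le_mul hμ h4 (A.nonneg _) h0
      have h6 : 0 < r ^ N := by positivity
      have : K * r ^ N ≤ K' * (r - r0) * r ^ N := by gcongr
      rw [pow_succ]
      nlinarith

lemma mat_bdd {κ κ' : Type*} [Fintype κ] [Fintype κ'] (Z : Matrix κ κ' F) : ∃ K, 1 ≤ K ∧ ∀ i j, A (Z i j) ≤ K := by
  refine ⟨1 + ∑ i, ∑ j, A (Z i j), ?_, fun i j => ?_⟩
  · have : 0 ≤ ∑ i, ∑ j, A (Z i j) := Finset.sum_nonneg fun _ _ => Finset.sum_nonneg fun _ _ => A.nonneg _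
    linarith
  · have := (Finset.single_le_sum (f := fun j => A (Z i j)) (fun _ _ => A.nonneg _) (Finset.mem_univ j)).trans
      (Finset.single_le_sum (f := fun i => ∑ j, A (Z i j)) (fun _ _ => Finset.sum_nonneg fun _ _ => A.nonneg _) (Finset.mem_univ i))
    linarith

lemma mul_bdd {κ κ' κ'' : Type*} [Fintype κ'] (X : Matrix κ κ' F) (Y : Matrix κ' κ'' F) (a b : ℝ)
    (ha : 0 ≤ a) (hX : ∀ i j, A (X i j) ≤ a) (hY : ∀ i j, A (Y i j) ≤ b) (i : κ) (j : κ'') :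
    A ((X * Y) i j) ≤ Fintype.card κ' * a * b := by
  rw [Matrix.mul_apply]
  refine (A.sum_le _ _).trans ?_
  calc _ ≤ ∑ _k : κ', a * b := Finset.sum_le_sum fun k _ => by
        rw [A.map_mul]; exact mul_le_mul (hX _ _) (hY _ _) (A.nonneg _) ha
    _ = _ := by simp; ring

lemma prod_pert (m e : ℝ) (hm : 1 ≤ m) (he0 : 0 ≤ e) (he : e ≤ m) (s : Finset ι) (y z : ι → F)
    (hy : ∀ i, A (y i) ≤ m) (hz : ∀ i, A (z i) ≤ e) :
    A (∏ i ∈ s, (y i + z i) - ∏ i ∈ s, y i) ≤ e * s.card * (2 * m) ^ s.card := by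
  induction s using Finset.induction_on with
  | empty => simp
  | insert i s hi ih =>
    rw [Finset.prod_insert hi, Finset.prod_insert hi, Finset.card_insert_of_notMem hi]
    have h1 : (y i + z i) * ∏ i ∈ s, (y i + z i) - y i * ∏ i ∈ s, y i =
      (y i + z i) * (∏ i ∈ s, (y i + z i) - ∏ i ∈ s, y i) + z i * ∏ i ∈ s, y i := by ring
    rw [h1]
    refine (A.add_le _ _).trans ?_
    rw [A.map_mul, A.map_mul, map_prod]
    have h2 : ∏ i ∈ s, A (y i) ≤ (2 * m) ^ s.card := by
      refine (Finset.prod_le_prod (fun _ _ => A.nonneg _) (fun i _ => hy i)).trans ?_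
      rw [Finset.prod_const]
      exact pow_le_pow_left₀ (by linarith) (by linarith) _
    have h3 : A (y i + z i) ≤ 2 * m := (A.add_le _ _).trans (by linarith [hy i, hz i])
    have h4 := mul_le_mul h3 ih (A.nonneg _) (by linarith)
    have h5 := mul_le_mul (hz i) h2 (Finset.prod_nonneg fun _ _ => A.nonneg _) he0
    have h6 : 0 ≤ e * (2 * m) ^ s.card := by positivity
    push_cast
    rw [pow_succ]
    nlinarith

lemma det_pert (m e : ℝ) (hm : 1 ≤ m) (he0 : 0 ≤ e) (he : e ≤ m) (Y Z : Matrix ι ι F)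
    (hy : ∀ i j, A (Y i j) ≤ m) (hz : ∀ i j, A (Z i j) ≤ e) :
    A ((Y + Z).det - Y.det) ≤ (Fintype.card ι).factorial * (e * Fintype.card ι * (2 * m) ^ Fintype.card ι) := by
  rw [Matrix.det_apply, Matrix.det_apply, ← Finset.sum_sub_distrib]
  refine (A.sum_le _ _).trans ?_
  calc _ ≤ ∑ _σ : Equiv.Perm ι, (e * Fintype.card ι * (2 * m) ^ Fintype.card ι) := by
        refine Finset.sum_le_sum fun σ _ => ?_
        rw [← smul_sub]
        have h := prod_pert A m e hm he0 he Finset.univ (fun i => Y (σ i) i) (fun i => Z (σ i) i)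
          (fun i => hy _ _) (fun i => hz _ _)
        rw [Finset.card_univ] at h
        refine le_trans (le_of_eq ?_) h
        rcases Int.units_eq_one_or (Equiv.Perm.sign σ) with h | h <;> rw [h]
        · simp
        · simp [A.map_sub]
    _ = _ := by rw [Finset.sum_const, Finset.card_univ, Fintype.card_perm, nsmul_eq_mul]

end growth
end UEG


namespace UEG
section spectral
open Polynomial
variable {F : Type*} [Field F] [IsAlgClosed F] (A : AbsoluteValue F ℝ)
  {ι : Type*} [Fintype ι] [DecidableEq ι]

lemma det_eq_prod_charpoly (M : Matrix ι ι F) : M.det = M.charpoly.roots.prod :=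
  Matrix.det_eq_prod_roots_charpoly M

lemma exists_eigenvec (M : Matrix ι ι F) {μ : F} (h : M.charpoly.IsRoot μ) :
    ∃ v : ι → F, v ≠ 0 ∧ M *ᵥ v = μ • v := by
  have h1 : (M - Matrix.scalar ι μ).det = 0 := by
    have h2 : (Matrix.scalar ι μ - M).det = 0 := by
      rw [← Matrix.eval_charpoly]; exact h
    rw [← neg_sub, Matrix.det_neg, h2, mul_zero]
  obtain ⟨v, hv, h2⟩ := Matrix.exists_mulVec_eq_zero_iff.mpr h1
  refine ⟨v, hv, ?_⟩
  rw [Matrix.sub_mulVec, sub_eq_zero] at h2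
  rw [h2]; simp [Matrix.scalar_apply, ← Matrix.smul_one_eq_diagonal, Matrix.smul_mulVec]

lemma isRoot_of_eigenvec (M : Matrix ι ι F) {μ : F} (v : ι → F) (hv : v ≠ 0) (h : M *ᵥ v = μ • v) :
    M.charpoly.IsRoot μ := by
  rw [Polynomial.IsRoot, Matrix.eval_charpoly]
  refine Matrix.exists_mulVec_eq_zero_iff.mp ⟨v, hv, ?_⟩
  rw [Matrix.sub_mulVec, h]
  simp [Matrix.scalar_apply, ← Matrix.smul_one_eq_diagonal, Matrix.smul_mulVec]

lemma aeval_mulVec (M : Matrix ι ι F) {μ : F} (v : ι → F) (h : M *ᵥ v = μ • v) (p : F[X]) :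
    (aeval M p) *ᵥ v = (p.eval μ) • v := by
  induction p using Polynomial.induction_on' with
  | add p q hp hq => rw [map_add, Matrix.add_mulVec, hp, hq, eval_add, add_smul]
  | monomial n c =>
    have hpow : ∀ n : ℕ, (M ^ n) *ᵥ v = μ ^ n • v := by
      intro n
      induction n with
      | zero => simp
      | succ n ih => rw [pow_succ, ← Matrix.mulVec_mulVec, h, Matrix.mulVec_smul, ih, smul_smul, pow_succ, mul_comm]
    rw [aeval_monomial, eval_monomial, Algebra.algebraMap_eq_smul_one, smul_mul_assoc, one_mul, Matrix.smul_mulVec, hpow, smul_smul]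

/-- spectral projection -/
lemma spectral (C : Matrix ι ι F) (a : F) (ha : C.charpoly.IsRoot a)
    (hmax : ∀ b, C.charpoly.IsRoot b → A b ≤ A a) (ha1 : 1 < A a) :
    ∃ P Q : Matrix ι ι F, P + Q = 1 ∧ P * Q = 0 ∧ Q * P = 0 ∧ Commute C P ∧ Commute C Q ∧
      A (a⁻¹ • C * P + Q).det = 1 ∧ 1 < A (C * P + Q).det ∧
      (∃ r < A a, 0 < r ∧ ∃ K, ∀ N i j, A ((C ^ N * Q) i j) ≤ K * r ^ N) ∧
      (∀ r > A a, ∃ K, ∀ N i j, A ((C ^ N * P) i j) ≤ K * r ^ N) := by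
  classical
  set R := C.charpoly.roots with hR
  set s1 := R.filter (fun μ => A μ = A a) with hs1
  set s2 := R.filter (fun μ => ¬ A μ = A a) with hs2
  set f1 : F[X] := (s1.map fun μ => (X - Polynomial.C μ)).prod with hf1
  set f2 : F[X] := (s2.map fun μ => (X - Polynomial.C μ)).prod with hf2
  have hmon : C.charpoly.Monic := C.charpoly_monic
  have hmem : ∀ μ, μ ∈ R ↔ C.charpoly.IsRoot μ := fun μ => mem_roots hmon.ne_zero
  have hf : f1 * f2 = C.charpoly := by
    rw [(IsAlgClosed.splits C.charpoly).eq_prod_roots_of_monic hmon, hf1, hf2, ← Multiset.prod_add, ← Multiset.map_add, hs1, hs2,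
      Multiset.filter_add_not]
  have hroot1 : ∀ μ, f1.IsRoot μ → A μ = A a := by
    intro μ h
    have : μ ∈ f1.roots := (mem_roots (by rw [hf1]; exact (monic_multiset_prod_of_monic _ _ fun μ _ => monic_X_sub_C μ).ne_zero)).mpr h
    rw [hf1, roots_multiset_prod_X_sub_C] at this
    exact (Multiset.mem_filter.mp this).2
  have hroot2 : ∀ μ, f2.IsRoot μ → A μ ≠ A a := by
    intro μ h
    have : μ ∈ f2.roots := (mem_roots (by rw [hf2]; exact (monic_multiset_prod_of_monic _ _ fun μ _ => monic_X_sub_C μ).ne_zero)).mpr h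
    rw [hf2, roots_multiset_prod_X_sub_C] at this
    exact (Multiset.mem_filter.mp this).2
  have hcop : IsCoprime f1 f2 := by
    rw [Polynomial.isCoprime_iff_aeval_ne_zero_of_isAlgClosed F F]
    intro μ
    by_contra hcon
    push Not at hcon
    exact hroot2 μ (by simpa using hcon.2) (hroot1 μ (by simpa using hcon.1))
  obtain ⟨u, v, huv⟩ := hcop
  have hch : aeval C (f1 * f2) = 0 := by rw [hf]; exact Matrix.aeval_self_charpoly C
  set P := aeval C (v * f2) with hP
  set Q := aeval C (u * f1) with hQ
  have hPQ1 : P + Q = 1 := by rw [hP, hQ, ← map_add, add_comm, huv, map_one]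
  have hPQ : P * Q = 0 := by
    rw [hP, hQ, ← map_mul, show v * f2 * (u * f1) = (u * v) * (f1 * f2) by ring, map_mul, hch, mul_zero]
  have hQP : Q * P = 0 := by
    rw [hP, hQ, ← map_mul, show (u * f1) * (v * f2) = (u * v) * (f1 * f2) by ring, map_mul, hch, mul_zero]
  have hf1P : aeval C f1 * P = 0 := by
    rw [hP, ← map_mul, show f1 * (v * f2) = v * (f1 * f2) by ring, map_mul, hch, mul_zero]
  have hf2Q : aeval C f2 * Q = 0 := by
    rw [hQ, ← map_mul, show f2 * (u * f1) = u * (f1 * f2) by ring, map_mul, hch, mul_zero]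
  have hPP : P * P = P := by
    have := congrArg (P * ·) hPQ1
    simpa [mul_add, hPQ] using this
  have hcP : Commute C P := by
    have h := (Commute.all X (v * f2)).map (aeval (R := F) C)
    rwa [aeval_X] at h
  have hcQ : Commute C Q := by
    have h := (Commute.all X (u * f1)).map (aeval (R := F) C)
    rwa [aeval_X] at h
  have heig : ∀ (s : F), ∀ μ, (s • C * P + Q).charpoly.IsRoot μ → A μ = 1 ∨ A μ = A s * A a := by
    intro s μ hμ
    obtain ⟨z, hz, h⟩ := exists_eigenvec _ hμ
    by_cases hPz : P *ᵥ z = 0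
    · left
      have h1 : Q *ᵥ z = z := by
        have := congrArg (· *ᵥ z) hPQ1
        simpa [Matrix.add_mulVec, hPz] using this
      rw [Matrix.add_mulVec, ← Matrix.mulVec_mulVec, hPz, Matrix.mulVec_zero, zero_add, h1] at h
      have : (1 - μ) • z = 0 := by rw [sub_smul, one_smul, ← h, sub_self]
      rcases smul_eq_zero.mp this with h2 | h2
      · rw [← sub_eq_zero.mp h2, A.map_one]
      · exact absurd h2 hz
    · right
      have h2 : (s • C) *ᵥ (P *ᵥ z) = μ • (P *ᵥ z) := by
        have h3 := congrArg (P *ᵥ ·) h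
        simp only [Matrix.mulVec_mulVec, Matrix.mulVec_smul, mul_add, hPQ, add_zero] at h3
        rw [← h3, Matrix.mulVec_mulVec]
        congr 1
        rw [smul_mul_assoc, mul_smul_comm, ← mul_assoc, ← hcP.eq, mul_assoc, hPP]
      by_cases hs : s = 0
      · subst hs
        rw [zero_smul, Matrix.zero_mulVec] at h2
        rcases smul_eq_zero.mp h2.symm with h3 | h3
        · rw [h3]; simp
        · exact absurd h3 hPz
      · have h3 : C *ᵥ (P *ᵥ z) = (s⁻¹ * μ) • (P *ᵥ z) := by
          rw [mul_smul, ← h2, Matrix.smul_mulVec, smul_smul, inv_mul_cancel₀ hs, one_smul]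
        have h4 := aeval_mulVec C _ h3 f1
        rw [Matrix.mulVec_mulVec, hf1P, Matrix.zero_mulVec] at h4
        rcases smul_eq_zero.mp h4.symm with h5 | h5
        · have := hroot1 _ h5
          rw [← this, ← A.map_mul, mul_inv_cancel_left₀ hs]
        · exact absurd h5 hPz
  have ha0 : a ≠ 0 := by rintro rfl; simp at ha1; linarith
  refine ⟨P, Q, hPQ1, hPQ, hQP, hcP, hcQ, ?_, ?_, ?_, ?_⟩
  · rw [det_eq_prod_charpoly, map_multiset_prod]
    apply Multiset.prod_eq_one
    intro x hx
    obtain ⟨μ, hμ, rfl⟩ := Multiset.mem_map.mp hx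
    rcases heig _ μ ((mem_roots (Matrix.charpoly_monic _).ne_zero).mp hμ) with h | h
    · exact h
    · rw [h, ← A.map_mul, inv_mul_cancel₀ ha0, A.map_one]
  · rw [det_eq_prod_charpoly, map_multiset_prod]
    have h1 : ∀ μ ∈ (C * P + Q).charpoly.roots, 1 ≤ A μ := by
      intro μ hμ
      have h2 := heig 1 μ (by rw [one_smul]; exact (mem_roots (Matrix.charpoly_monic _).ne_zero).mp hμ)
      rcases h2 with h | h
      · exact h.ge
      · rw [h, A.map_one, one_mul]; exact ha1.le
    obtain ⟨z, hz, h⟩ := exists_eigenvec _ ha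
    have hf1a : f1.eval a = 0 := by
      rw [hf1, eval_multiset_prod]
      refine Multiset.prod_eq_zero (Multiset.mem_map.mpr ⟨X - Polynomial.C a, Multiset.mem_map.mpr ⟨a, Multiset.mem_filter.mpr ⟨(hmem a).mpr ha, rfl⟩, rfl⟩, by simp⟩)
    have hQz : Q *ᵥ z = 0 := by
      rw [hQ, aeval_mulVec C z h, eval_mul, hf1a, mul_zero, zero_smul]
    have hPz : P *ᵥ z = z := by
      have := congrArg (· *ᵥ z) hPQ1
      simpa [Matrix.add_mulVec, hQz] using this
    have h2 : a ∈ (C * P + Q).charpoly.roots := by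
      refine (mem_roots (Matrix.charpoly_monic _).ne_zero).mpr (isRoot_of_eigenvec _ z hz ?_)
      rw [Matrix.add_mulVec, hQz, ← Matrix.mulVec_mulVec, hPz, h, add_zero]
    obtain ⟨s, hs⟩ := Multiset.exists_cons_of_mem h2
    rw [hs] at h1 ⊢
    rw [Multiset.map_cons, Multiset.prod_cons]
    have h3 : 1 ≤ (s.map A).prod := by
      have : ∀ s : Multiset F, (∀ μ ∈ s, 1 ≤ A μ) → 1 ≤ (s.map A).prod := by
        intro s
        induction s using Multiset.induction_on with
        | empty => simp
        | cons x s ih =>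
          intro h
          rw [Multiset.map_cons, Multiset.prod_cons]
          exact one_le_mul_of_one_le_of_one_le (h x (Multiset.mem_cons_self _ _)) (ih fun μ hμ => h μ (Multiset.mem_cons_of_mem hμ))
      exact this s fun μ hμ => h1 μ (Multiset.mem_cons_of_mem hμ)
    exact lt_of_lt_of_le ha1 (le_mul_of_one_le_right (by linarith) h3)
  · have : ∃ r0, 0 ≤ r0 ∧ r0 < A a ∧ ∀ μ ∈ s2, A μ ≤ r0 := by
      have h1 : ∀ μ ∈ s2, A μ < A a := by
        intro μ hμ
        obtain ⟨h1, h2⟩ := Multiset.mem_filter.mp hμ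
        exact lt_of_le_of_ne (hmax μ ((hmem μ).mp h1)) h2
      have : ∀ s : Multiset F, (∀ μ ∈ s, A μ < A a) → ∃ r0, 0 ≤ r0 ∧ r0 < A a ∧ ∀ μ ∈ s, A μ ≤ r0 := by
        intro s
        induction s using Multiset.induction_on with
        | empty => intro _; exact ⟨0, le_rfl, by linarith, by simp⟩
        | cons x s ih =>
          intro h
          obtain ⟨r0, h0, h1, h2⟩ := ih fun μ hμ => h μ (Multiset.mem_cons_of_mem hμ)
          refine ⟨max r0 (A x), le_max_of_le_left h0, max_lt h1 (h x (Multiset.mem_cons_self _ _)), fun μ hμ => ?_⟩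
          rcases Multiset.mem_cons.mp hμ with rfl | hμ
          · exact le_max_right _ _
          · exact le_max_of_le_left (h2 μ hμ)
      exact this s2 h1
    obtain ⟨r0, h0, h1, h2⟩ := this
    refine ⟨(r0 + A a) / 2, by linarith, by linarith, ?_⟩
    exact growth_aux A C r0 _ h0 (by linarith) s2 Q h2 hf2Q
  · intro r hr
    exact growth_aux A C (A a) r (A.nonneg _) hr s1 P (fun μ hμ => (Multiset.mem_filter.mp hμ).2.le) hf1P
end spectral

section lemB
variable {F G : Type*} [Field F] [IsAlgClosed F] [Group G] (A : AbsoluteValue F ℝ)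
  {ι : Type*} [Fintype ι] [DecidableEq ι]

lemma phi_limit (C X Y P Q : Matrix ι ι F) (a : F) (ha : a ≠ 0)
    (hPQ1 : P + Q = 1) (hPQ : P * Q = 0) (hQP : Q * P = 0) (hcP : Commute C P) (hcQ : Commute C Q)
    (hdet : A (a⁻¹ • C * P + Q).det = 1)
    (hQg : ∃ r < A a, 0 < r ∧ ∃ K, ∀ N i j, A ((C ^ N * Q) i j) ≤ K * r ^ N)
    (hPg : ∀ r > A a, ∃ K, ∀ N i j, A ((C ^ N * P) i j) ≤ K * r ^ N) (hΛ : (C * P + Q).det ≠ 0) :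
    Filter.Tendsto (fun N : ℕ => A ((P * (X * C ^ N * Y) * P + Q).det / (C * P + Q).det ^ N -
      (P * X * P + Q).det * (P * Y * P + Q).det)) Filter.atTop (nhds 0) := by
  have hPP : P * P = P := by
    have := congrArg (P * ·) hPQ1
    simpa [mul_add, hPQ] using this
  have hQQ : Q * Q = Q := by
    have := congrArg (Q * ·) hPQ1
    simpa [mul_add, hQP] using this
  have hcPN : ∀ N : ℕ, P * C ^ N = C ^ N * P := fun N => (hcP.pow_left N).eq.symm
  have hcQN : ∀ N : ℕ, Q * C ^ N = C ^ N * Q := fun N => (hcQ.pow_left N).eq.symm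
  obtain ⟨r, hra, hr0, K2, hK2⟩ := hQg
  have hApos : 0 < A a := A.pos ha
  set D := Fintype.card ι with hD
  -- choose s > 1
  obtain ⟨s, hs1, hs⟩ : ∃ s : ℝ, 1 < s ∧ s ^ D * (r / A a) < 1 := by
    have hcont : Filter.Tendsto (fun s : ℝ => s ^ D * (r / A a)) (nhdsWithin 1 (Set.Ioi 1)) (nhds (1 ^ D * (r / A a))) := by
      apply Filter.Tendsto.mono_left _ nhdsWithin_le_nhds
      exact ((continuous_id.pow D).mul continuous_const).tendsto 1
    have hlt : (1 : ℝ) ^ D * (r / A a) < 1 := by rw [one_pow, one_mul, div_lt_one hApos]; exact hra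
    have h1 := hcont.eventually (gt_mem_nhds hlt)
    obtain ⟨s, h2, h3⟩ := (h1.and self_mem_nhdsWithin).exists
    exact ⟨s, h3, h2⟩
  obtain ⟨K1, hK1⟩ := hPg (A a * s) (by nlinarith)
  obtain ⟨x1, hx1, hx1'⟩ := mat_bdd A (P * X)
  obtain ⟨y1, hy1, hy1'⟩ := mat_bdd A (Y * P)
  obtain ⟨q1, hq1, hq1'⟩ := mat_bdd A Q
  obtain ⟨y2, hy2, hy2'⟩ := mat_bdd A (P * Y * P)
  set k1 := max K1 1
  set k2 := max K2 1
  have hk1 : 1 ≤ k1 := le_max_right _ _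
  have hk2 : 1 ≤ k2 := le_max_right _ _
  set y3 := max y1 y2
  have hy3 : 1 ≤ y3 := hy1.trans (le_max_left _ _)
  set m : ℕ → ℝ := fun N => (D * (D * x1 * k1) * y3 + q1 + D * (D * x1 * k2) * y3) * s ^ N with hm
  set e : ℕ → ℝ := fun N => (D * (D * x1 * k2) * y3) * (r / A a) ^ N with he
  have hDn : (0 : ℝ) ≤ D := Nat.cast_nonneg _
  have hsN : ∀ N : ℕ, 1 ≤ s ^ N := fun N => one_le_pow₀ hs1.le
  have hra1 : r / A a < 1 := (div_lt_one hApos).mpr hra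
  have hrap : 0 < r / A a := by positivity
  have hrN : ∀ N : ℕ, (r / A a) ^ N ≤ 1 := fun N => pow_le_one₀ hrap.le hra1.le
  have hm1 : ∀ N, 1 ≤ m N := by
    intro N
    have h1 : (1:ℝ) ≤ D * (D * x1 * k1) * y3 + q1 + D * (D * x1 * k2) * y3 := by
      have : 0 ≤ D * (D * x1 * k1) * y3 := by positivity
      have : 0 ≤ D * (D * x1 * k2) * y3 := by positivity
      linarith
    exact one_le_mul_of_one_le_of_one_le h1 (hsN N)
  have he0 : ∀ N, 0 ≤ e N := by intro N; simp only [he]; positivity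
  have hem : ∀ N, e N ≤ m N := by
    intro N
    simp only [he, hm]
    have h1 : D * (D * x1 * k2) * y3 ≤ D * (D * x1 * k1) * y3 + q1 + D * (D * x1 * k2) * y3 := by
      have : 0 ≤ D * (D * x1 * k1) * y3 := by positivity
      linarith
    have h0 : (0:ℝ) ≤ D * (D * x1 * k2) * y3 := by positivity
    exact mul_le_mul h1 ((hrN N).trans (hsN N)) (by positivity) (h0.trans h1)
  set Y1 : ℕ → Matrix ι ι F := fun N => (a⁻¹) ^ N • (P * X * (C ^ N * P) * (P * Y * P)) + Q with hY1
  set Z1 : ℕ → Matrix ι ι F := fun N => (a⁻¹) ^ N • (P * X * (C ^ N * Q) * (Y * P)) with hZ1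
  have hAN : ∀ N : ℕ, A (a⁻¹ ^ N) = (A a ^ N)⁻¹ := by intro N; rw [map_pow, map_inv₀, inv_pow]
  have hyb : ∀ N i j, A (Y1 N i j) ≤ m N := by
    intro N i j
    simp only [hY1, Matrix.add_apply, Matrix.smul_apply, smul_eq_mul]
    refine (A.add_le _ _).trans ?_
    rw [A.map_mul, hAN]
    have h1 := mul_bdd A (P * X) (C ^ N * P) x1 (k1 * (A a * s) ^ N) (by linarith) hx1' (fun i j => (hK1 N i j).trans (by gcongr; exact le_max_left _ _))
    have h2 := mul_bdd A (P * X * (C ^ N * P)) (P * Y * P) _ y3 (by positivity) h1 (fun i j => (hy2' i j).trans (le_max_right _ _)) i j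
    have h3 := hq1' i j
    have h4 : (A a ^ N)⁻¹ * A ((P * X * (C ^ N * P) * (P * Y * P)) i j) ≤ (D * (D * x1 * k1) * y3) * s ^ N := by
      rw [inv_mul_le_iff₀ (by positivity)]
      refine h2.trans (le_of_eq ?_)
      rw [mul_pow, ← hD]; ring
    have h5 : q1 ≤ q1 * s ^ N := le_mul_of_one_le_right (by linarith) (hsN N)
    have h6 : 0 ≤ D * (D * x1 * k2) * y3 * s ^ N := by positivity
    simp only [hm]
    linarith
  have hzb : ∀ N i j, A (Z1 N i j) ≤ e N := by
    intro N i j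
    simp only [hZ1, Matrix.smul_apply, smul_eq_mul]
    rw [A.map_mul, hAN]
    have h1 := mul_bdd A (P * X) (C ^ N * Q) x1 (k2 * r ^ N) (by linarith) hx1' (fun i j => (hK2 N i j).trans (by gcongr; exact le_max_left _ _))
    have h2 := mul_bdd A (P * X * (C ^ N * Q)) (Y * P) _ y3 (by positivity) h1 (fun i j => (hy1' i j).trans (le_max_left _ _)) i j
    rw [inv_mul_le_iff₀ (by positivity)]
    refine h2.trans (le_of_eq ?_)
    simp only [he]
    rw [div_pow, ← hD]; field_simp
  have hpert := fun N => det_pert A (m N) (e N) (hm1 N) (he0 N) (hem N) (Y1 N) (Z1 N) (hyb N) (hzb N)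
  set KN : ℕ → Matrix ι ι F := fun N => a⁻¹ ^ N • P + Q with hKN
  have hDN : ∀ N : ℕ, (C * P + Q) ^ N = C ^ N * P + Q := by
    intro N
    induction N with
    | zero => simpa using hPQ1.symm
    | succ N ih =>
      rw [pow_succ, ih]
      have h1 : (C ^ N * P) * (C * P) = C ^ (N + 1) * P := by
        rw [mul_assoc, ← mul_assoc P, ← hcP.eq, mul_assoc, hPP, ← mul_assoc, pow_succ]
      have h2 : Q * (C * P) = 0 := by rw [← mul_assoc, ← hcQ.eq, mul_assoc, hQP, mul_zero]
      have h3 : C ^ N * P * Q = 0 := by rw [mul_assoc, hPQ, mul_zero]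
      rw [add_mul, mul_add, mul_add, h1, h2, h3, hQQ]
      simp
  have hDaN : ∀ N : ℕ, (a⁻¹ • C * P + Q) ^ N = a⁻¹ ^ N • C ^ N * P + Q := by
    intro N
    induction N with
    | zero => simpa using hPQ1.symm
    | succ N ih =>
      rw [pow_succ, ih]
      have h1 : (a⁻¹ ^ N • C ^ N * P) * (a⁻¹ • C * P) = a⁻¹ ^ (N + 1) • C ^ (N + 1) * P := by
        simp only [smul_mul_assoc, mul_smul_comm, smul_smul]
        rw [mul_assoc, ← mul_assoc P, ← hcP.eq, mul_assoc, hPP, ← mul_assoc, pow_succ, pow_succ, mul_comm]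
      have h2 : Q * (a⁻¹ • C * P) = 0 := by
        simp only [smul_mul_assoc, mul_smul_comm]
        rw [← mul_assoc, ← hcQ.eq, mul_assoc, hQP, mul_zero, smul_zero]
      have h3 : a⁻¹ ^ N • C ^ N * P * Q = 0 := by rw [mul_assoc, hPQ, mul_zero]
      rw [add_mul, mul_add, mul_add, h1, h2, h3, hQQ]
      simp
  set Λ := (C * P + Q).det with hΛd
  have hKΛ : ∀ N, A ((KN N).det * Λ ^ N) = 1 := by
    intro N
    rw [hΛd, ← Matrix.det_pow, ← Matrix.det_mul, hDN]
    have : KN N * (C ^ N * P + Q) = (a⁻¹ • C * P + Q) ^ N := by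
      rw [hDaN, hKN]
      have h1 : P * (C ^ N * P) = C ^ N * P := by rw [← mul_assoc, hcPN, mul_assoc, hPP]
      have h2 : Q * (C ^ N * P) = 0 := by rw [← mul_assoc, hcQN, mul_assoc, hQP, mul_zero]
      simp only [add_mul, mul_add, smul_mul_assoc, h1, h2, hPQ, hQQ]
      simp
    rw [this, Matrix.det_pow, map_pow, hdet, one_pow]
  have hY1det : ∀ N, (Y1 N).det = (KN N).det * ((P * X * P + Q).det * Λ ^ N * (P * Y * P + Q).det) := by
    intro N
    rw [hΛd, ← Matrix.det_pow, ← Matrix.det_mul, ← Matrix.det_mul, ← Matrix.det_mul, hDN]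
    congr 1
    have e1 : (P * X * P + Q) * (C ^ N * P + Q) = P * X * (C ^ N * P) + Q := by
      have h1 : P * X * P * (C ^ N * P) = P * X * (C ^ N * P) := by
        rw [mul_assoc (P * X), ← mul_assoc P (C ^ N), hcPN, mul_assoc (C ^ N), hPP]
      have h2 : Q * (C ^ N * P) = 0 := by rw [← mul_assoc, hcQN, mul_assoc, hQP, mul_zero]
      have h3 : P * X * P * Q = 0 := by rw [mul_assoc, hPQ, mul_zero]
      rw [add_mul, mul_add, mul_add, h1, h2, h3, hQQ]; simp
    have e2 : (P * X * (C ^ N * P) + Q) * (P * Y * P + Q) = P * X * (C ^ N * P) * (P * Y * P) + Q := by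
      have h2 : Q * (P * Y * P) = 0 := by rw [mul_assoc P, ← mul_assoc, hQP, zero_mul]
      have h3 : P * X * (C ^ N * P) * Q = 0 := by rw [mul_assoc (P * X), mul_assoc (C ^ N), hPQ, mul_zero, mul_zero]
      rw [add_mul, mul_add, mul_add, h2, h3, hQQ]; simp
    have e3 : KN N * (P * X * (C ^ N * P) * (P * Y * P) + Q) = Y1 N := by
      have h1 : P * (P * X * (C ^ N * P) * (P * Y * P)) = P * X * (C ^ N * P) * (P * Y * P) := by
        simp only [← mul_assoc, hPP]
      have h2 : Q * (P * X * (C ^ N * P) * (P * Y * P)) = 0 := by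
        simp only [← mul_assoc, hQP, zero_mul]
      rw [hKN, hY1]
      simp only [add_mul, mul_add, smul_mul_assoc, h1, h2, hPQ, hQQ]; simp
    rw [e1, e2, e3]
  have hYZdet : ∀ N, (Y1 N + Z1 N).det = (KN N).det * (P * (X * C ^ N * Y) * P + Q).det := by
    intro N
    rw [← Matrix.det_mul]
    congr 1
    have h1 : P * (X * C ^ N * Y) * P = P * X * (C ^ N * P) * (P * Y * P) + P * X * (C ^ N * Q) * (Y * P) := by
      have h2 : P * X * (C ^ N * P) * (P * Y * P) = P * X * (C ^ N * P) * (Y * P) := by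
        rw [mul_assoc (P * X) (C ^ N * P) (P * Y * P), mul_assoc (C ^ N) P (P * Y * P), mul_assoc P Y P, ← mul_assoc P P (Y * P), hPP]
        simp only [mul_assoc]
      rw [h2, ← add_mul, ← mul_add, ← mul_add, hPQ1, mul_one]
      simp only [mul_assoc]
    rw [h1, hKN, hY1, hZ1]
    have h1 : P * (P * X * (C ^ N * P) * (P * Y * P)) = P * X * (C ^ N * P) * (P * Y * P) := by
        simp only [← mul_assoc, hPP]
    have h2 : Q * (P * X * (C ^ N * P) * (P * Y * P)) = 0 := by
        simp only [← mul_assoc, hQP, zero_mul]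
    have h3 : P * (P * X * (C ^ N * Q) * (Y * P)) = P * X * (C ^ N * Q) * (Y * P) := by
        simp only [← mul_assoc, hPP]
    have h4 : Q * (P * X * (C ^ N * Q) * (Y * P)) = 0 := by
        simp only [← mul_assoc, hQP, zero_mul]
    simp only [add_mul, mul_add, smul_mul_assoc, h1, h2, h3, h4, hPQ, hQQ]
    simp
    abel
  have hKN0 : ∀ N, (KN N).det ≠ 0 := by
    intro N h
    have := hKΛ N
    rw [h, zero_mul, A.map_zero] at this
    exact zero_ne_one this
  have hkey : ∀ N, A ((P * (X * C ^ N * Y) * P + Q).det / Λ ^ N - (P * X * P + Q).det * (P * Y * P + Q).det)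
      = A ((Y1 N + Z1 N).det - (Y1 N).det) := by
    intro N
    have : (P * (X * C ^ N * Y) * P + Q).det / Λ ^ N - (P * X * P + Q).det * (P * Y * P + Q).det
      = ((Y1 N + Z1 N).det - (Y1 N).det) / ((KN N).det * Λ ^ N) := by
      rw [hYZdet, hY1det]
      have := hKN0 N
      have : Λ ^ N ≠ 0 := pow_ne_zero _ hΛ
      field_simp
    rw [this, map_div₀, hKΛ, div_one]
  have hlim : Filter.Tendsto (fun N => (D.factorial : ℝ) * (e N * D * (2 * m N) ^ D)) Filter.atTop (nhds 0) := by
    have h1 : (fun N => (D.factorial : ℝ) * (e N * D * (2 * m N) ^ D)) = fun N =>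
        (D.factorial * (D * (D * x1 * k2) * y3) * D * (2 * (D * (D * x1 * k1) * y3 + q1 + D * (D * x1 * k2) * y3)) ^ D) *
          (s ^ D * (r / A a)) ^ N := by
      funext N
      simp only [he, hm]
      generalize (D * (D * x1 * k1) * y3 + q1 + D * (D * x1 * k2) * y3) = zz
      rw [← mul_assoc 2 zz, mul_pow (2 * zz), mul_pow (s ^ D), ← pow_mul, ← pow_mul, mul_comm N D]
      ring
    rw [h1]
    have h2 := (tendsto_pow_atTop_nhds_zero_of_lt_one (r := s ^ D * (r / A a)) (by positivity) hs)
    simpa using h2.const_mul _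
  refine squeeze_zero (fun N => A.nonneg _) (fun N => ?_) hlim
  rw [hkey]
  exact hpert N

theorem lemB (c : G →* Matrix ι ι F) (q : ℕ)
    (hq : ∀ m, 1 ≤ m → m ≤ (Fintype.card ι + 1) ^ Fintype.card ι → m ∣ q) (g : G) (hg : g ∈ Nq G q)
    (a0 : F) (ha0 : (c g).charpoly.IsRoot a0) (ha01 : 1 < A a0) :
    ∃ (P Q : Matrix ι ι F) (Λ : F) (Φ : G → F), (∀ x, Φ x = (P * c x * P + Q).det) ∧ Λ ≠ 0 ∧ Φ 1 = 1 ∧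
      (∀ x y, Filter.Tendsto (fun N : ℕ => A (Φ (x * g ^ N * y) / Λ ^ N - Φ x * Φ y)) Filter.atTop (nhds 0)) ∧
      (∃ h, Φ h ≠ 0 ∧ ∃ x, Φ (x * h) ≠ Φ h * Φ x) ∧
      ∃ (u : ℕ) (x γ : Fin u → G), (Matrix.of fun l m => Φ (x l * γ m)).det ≠ 0 ∧
      ∀ z y, Φ (z * y) = ∑ l, (∑ m, Φ (z * γ m) * (Matrix.of fun l m => Φ (x l * γ m))⁻¹ m l) * Φ (x l * y) := by
  classical
  obtain ⟨a, ha, hmax⟩ : ∃ a, (c g).charpoly.IsRoot a ∧ ∀ b, (c g).charpoly.IsRoot b → A b ≤ A a := by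
    have hne : (c g).charpoly ≠ 0 := (Matrix.charpoly_monic _).ne_zero
    obtain ⟨a, h1, h2⟩ := Finset.exists_max_image (c g).charpoly.roots.toFinset A ⟨a0, by simpa [hne] using ha0⟩
    exact ⟨a, by simpa [hne] using h1, fun b hb => h2 b (by simpa [hne] using hb)⟩
  have ha1 : 1 < A a := ha01.trans_le (hmax _ ha0)
  obtain ⟨P, Q, hPQ1, hPQ, hQP, hcP, hcQ, hdet, hΛ1, hQg, hPg⟩ := spectral A (c g) a ha hmax ha1
  have hane : a ≠ 0 := by rintro rfl; simp at ha1; linarith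
  have hΛ0 : (c g * P + Q).det ≠ 0 := by
    intro h; rw [h, A.map_zero] at hΛ1; linarith
  have hPP : P * P = P := by
    have := congrArg (P * ·) hPQ1
    simpa [mul_add, hPQ] using this
  set Φ : G → F := fun x => (P * c x * P + Q).det with hΦ
  have hexp : ∀ x y, Φ (x * y) = ∑ f : ι → Option ι, (∏ i, (f i).elim 1 (fun k => (P * c x) i k)) *
      Matrix.det (Matrix.of fun i => (f i).elim (Q i) (fun k => (c y * P) k)) := by
    intro x y
    rw [← det_expand]
    simp only [hΦ, map_mul, mul_assoc]
  obtain ⟨hU, hbasis⟩ := hankel_basis Φ _ _ hexp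
  have hone : Φ 1 = 1 := by simp [hΦ, hPP, hPQ1]
  have hcard : Fintype.card (ι → Option ι) = (Fintype.card ι + 1) ^ Fintype.card ι := by
    rw [Fintype.card_fun, Fintype.card_option]
  rw [hcard] at hU
  have hΦg : Φ g = (c g * P + Q).det := by
    simp only [hΦ]; rw [← hcP.eq, mul_assoc, hPP]
  refine ⟨P, Q, (c g * P + Q).det, Φ, fun _ => rfl, hΛ0, hone, fun x y => ?_, ?_, hbasis⟩
  · have := phi_limit A (c g) (c x) (c y) P Q a hane hPQ1 hPQ hQP hcP hcQ hdet hQg hPg hΛ0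
    simpa only [hΦ, map_mul, map_pow] using this
  · refine exists_h Φ _ hone hU q hq g hg ?_
    rw [hΦg]
    intro h
    rw [h, A.map_one] at hΛ1
    exact lt_irrefl _ hΛ1
end lemB
end UEG


namespace UEG
section pingpong
variable {G : Type*} [Group G]

/-- ping-pong configuration of size `m` -/
def Cfg (S : Finset G) (m : ℕ) : Prop :=
  ∃ a ∈ (S : Set G) ^ m, ∃ b ∈ (S : Set G) ^ m, ∃ C : Finset G, (C : Set G) ⊆ (S : Set G) ^ m ∧ C.card ≤ m ∧
    ∃ B : Set G, (∀ y, ∃ c ∈ C, c * y ∈ B) ∧ (∀ y ∈ B, a * y ∈ B) ∧ (∀ y ∈ B, b * y ∈ B) ∧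
      ∀ y ∈ B, ∀ z ∈ B, a * y ≠ b * z

lemma Cfg.mono {S : Finset G} (h1 : (1 : G) ∈ S) {m n : ℕ} (hmn : m ≤ n) (h : Cfg S m) : Cfg S n := by
  obtain ⟨a, ha, b, hb, C, hC, hc, B, h⟩ := h
  have hsub : (S : Set G) ^ m ⊆ (S : Set G) ^ n := Set.pow_subset_pow_right (by simpa using h1) hmn
  exact ⟨a, hsub ha, b, hsub hb, C, hC.trans hsub, hc.trans hmn, B, h⟩

/-- good generating sets -/
def GS (S : Finset G) : Prop := (1 : G) ∈ S ∧ (∀ s ∈ S, s⁻¹ ∈ S) ∧ Subgroup.closure (S : Set G) = ⊤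

lemma Dbl.of_cfg (m : ℕ) (h : ∀ S : Finset G, GS S → Cfg S m) : Dbl G := by
  classical
  refine ⟨m * (m + 1) + m, fun S hS1 hS2 hS3 X => ?_⟩
  obtain ⟨a, ha, b, hb, C, hC, hc, B, hcov, haB, hbB, hdis⟩ := h S ⟨hS1, hS2, hS3⟩
  choose f hf hfB using hcov
  rcases X.eq_empty_or_nonempty with rfl | hX
  · simp
  have hpig : ∃ c ∈ C, X.card ≤ m * (X.filter (fun y => f y = c)).card := by
    by_contra hcon
    push Not at hcon
    have hCne : C.Nonempty := ⟨f hX.choose, hf _⟩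
    have h1 := Finset.card_eq_sum_card_fiberwise (s := X) (t := C) (f := f) (fun y _ => hf y)
    have h2 := Finset.sum_lt_sum_of_nonempty hCne hcon
    rw [← Finset.mul_sum, ← h1, Finset.sum_const, smul_eq_mul] at h2
    exact absurd h2 (not_lt.mpr (Nat.mul_le_mul_right _ hc))
  obtain ⟨c, hcC, hcard⟩ := hpig
  have hZ : ∀ n : ℕ, ∃ Z : Finset G, (Z : Set G) ⊆ B ∧ (Z : Set G) ⊆ (S : Set G) ^ (m * n + m) * (X : Set G) ∧
      X.card * 2 ^ n ≤ m * Z.card := by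
    intro n
    induction n with
    | zero =>
      refine ⟨(X.filter (fun y => f y = c)).image (c * ·), ?_, ?_, ?_⟩
      · intro z hz
        simp only [Finset.coe_image, Set.mem_image, Finset.mem_coe, Finset.mem_filter] at hz
        obtain ⟨y, ⟨_, rfl⟩, rfl⟩ := hz
        exact hfB y
      · intro z hz
        simp only [Finset.coe_image, Set.mem_image, Finset.mem_coe, Finset.mem_filter] at hz
        obtain ⟨y, ⟨hy, _⟩, rfl⟩ := hz
        rw [mul_zero, zero_add]
        exact Set.mul_mem_mul (hC hcC) hy
      · rw [Finset.card_image_of_injective _ (mul_right_injective c)]; simpa using hcard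
    | succ n ih =>
      obtain ⟨Z, h1, h2, h3⟩ := ih
      refine ⟨Z.image (a * ·) ∪ Z.image (b * ·), ?_, ?_, ?_⟩
      · intro z hz
        simp only [Finset.coe_union, Finset.coe_image, Set.mem_union, Set.mem_image, Finset.mem_coe] at hz
        rcases hz with ⟨y, hy, rfl⟩ | ⟨y, hy, rfl⟩
        · exact haB y (h1 hy)
        · exact hbB y (h1 hy)
      · have e : m * (n + 1) + m = m + (m * n + m) := by ring
        intro z hz
        simp only [Finset.coe_union, Finset.coe_image, Set.mem_union, Set.mem_image, Finset.mem_coe] at hz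
        rw [e, pow_add, mul_assoc]
        rcases hz with ⟨y, hy, rfl⟩ | ⟨y, hy, rfl⟩
        · exact Set.mul_mem_mul ha (h2 hy)
        · exact Set.mul_mem_mul hb (h2 hy)
      · rw [Finset.card_union_of_disjoint, Finset.card_image_of_injective _ (mul_right_injective a),
          Finset.card_image_of_injective _ (mul_right_injective b)]
        · rw [pow_succ]; nlinarith
        · rw [Finset.disjoint_left]
          intro z hz hz'
          simp only [Finset.mem_image] at hz hz'
          obtain ⟨y, hy, rfl⟩ := hz
          obtain ⟨y', hy', h⟩ := hz'
          exact hdis y (h1 hy) y' (h1 hy') h.symm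
  obtain ⟨Z, -, h2, h3⟩ := hZ (m + 1)
  have hfin : ((S : Set G) ^ (m * (m + 1) + m) * (X : Set G)).Finite :=
    Set.Finite.mul (by rw [← Finset.coe_pow]; exact Finset.finite_toSet _) X.finite_toSet
  have h4 : Z.card ≤ ((S : Set G) ^ (m * (m + 1) + m) * (X : Set G)).ncard := by
    rw [← Set.ncard_coe_finset]; exact Set.ncard_le_ncard h2 hfin
  refine le_trans ?_ h4
  have h5 : m < 2 ^ m := Nat.lt_two_pow_self
  have hXp : 0 < X.card := hX.card_pos
  have hm : 0 < m := by
    rcases Nat.eq_zero_or_pos m with h | h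
    · subst h; simp at hcard; omega
    · exact h
  by_contra hlt
  push Not at hlt
  have h6 : m * Z.card < m * (2 * X.card) := Nat.mul_lt_mul_of_pos_left hlt hm
  have h7 : m * (2 * X.card) ≤ X.card * 2 ^ (m + 1) := by rw [pow_succ]; nlinarith
  omega

lemma exists_bad (h : ¬ Dbl G) : ∃ S : ℕ → Finset G, ∀ k, GS (S k) ∧ ¬ Cfg (S k) k := by
  have : ∀ k, ∃ S : Finset G, GS S ∧ ¬ Cfg S k := by
    intro k
    by_contra hcon
    push Not at hcon
    exact h (Dbl.of_cfg k hcon)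
  choose S hS using this
  exact ⟨S, hS⟩

lemma dot_bd {Ω : Type*} [Field Ω] (A : AbsoluteValue Ω ℝ) {u : ℕ} (β η : Fin u → Ω) (K e : ℝ) (hK : 0 ≤ K)
    (h1 : ∀ l, A (β l) ≤ K) (h2 : ∀ l, A (η l) ≤ e) : A (∑ l, β l * η l) ≤ u * K * e := by
  refine (A.sum_le _ _).trans ?_
  calc _ ≤ ∑ _l : Fin u, K * e := Finset.sum_le_sum fun l _ => by
        rw [A.map_mul]; exact mul_le_mul (h1 l) (h2 l) (A.nonneg _) hK
    _ = _ := by simp; ring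

/-- normalised image vectors: `w = s(e+η)` -/
lemma pp_image {Ω : Type*} [Field Ω] (A : AbsoluteValue Ω ℝ) {u : ℕ} (M : Matrix (Fin u) (Fin u) Ω)
    (e β w : Fin u → Ω) (s : Ω) (hs : s ≠ 0) (n ε ε1 : ℝ) (hε0 : 0 ≤ ε)
    (hM : ∀ l l', A (M l l' - e l * β l') ≤ ε) (hw : ∀ l, A (w l) ≤ n) (hβ : s = ∑ l, β l * w l)
    (hn : u * ε * n ≤ ε1 * A s) :
    ∃ η : Fin u → Ω, (∀ l, A (η l) ≤ ε1) ∧ ∀ l, ∑ l', M l l' * w l' = s * (e l + η l) := by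
  refine ⟨fun l => s⁻¹ * ∑ l', (M l l' - e l * β l') * w l', fun l => ?_, fun l => ?_⟩
  · rw [A.map_mul, map_inv₀, inv_mul_le_iff₀ (A.pos hs), mul_comm (A s)]
    exact (dot_bd A _ w ε n hε0 (hM l) hw).trans hn
  · rw [mul_add, mul_inv_cancel_left₀ hs]
    simp only [sub_mul, Finset.sum_sub_distrib, mul_assoc]
    rw [← Finset.mul_sum, ← hβ]; ring

set_option maxHeartbeats 1000000 in
theorem pingpong {Ω : Type*} [Field Ω] (A : AbsoluteValue Ω ℝ) {u : ℕ} (S : Finset G) (m : ℕ) (hum : u ≤ m)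
    (v : G → Fin u → Ω) (hv : ∀ y, v y ≠ 0) (e e' β : Fin u → Ω) (φ : Ω) (K : ℝ) (hK : 1 ≤ K)
    (he : ∀ l, A (e l) ≤ K) (he' : ∀ l, A (e' l) ≤ K) (hβ : ∀ l, A (β l) ≤ K) (hφ : A φ ≤ K) (hφ' : 1 ≤ K * A φ)
    (hβe : ∑ l, β l * e l = 1) (hβe' : ∑ l, β l * e' l = φ) (hl : ∃ l, 1 ≤ K * A (e' l - φ * e l))
    (ε : ℝ) (hε : 0 ≤ ε) (hε1 : 48 * u ^ 2 * K ^ 5 * ε ≤ 1)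
    (a b : G) (c : Fin u → G) (ha : a ∈ (S : Set G) ^ m) (hb : b ∈ (S : Set G) ^ m) (hc : ∀ i, c i ∈ (S : Set G) ^ m)
    (L : Ω) (hL : L ≠ 0) (Ma Mb : Matrix (Fin u) (Fin u) Ω) (Mc : Fin u → Matrix (Fin u) (Fin u) Ω)
    (hMa : ∀ l l', A (Ma l l' - e l * β l') ≤ ε) (hMb : ∀ l l', A (Mb l l' - e' l * β l') ≤ ε)
    (hMc : ∀ i l l', A (Mc i l l' - e l * (if i = l' then 1 else 0)) ≤ ε)
    (hva : ∀ y l, v (a * y) l = L * ∑ l', Ma l l' * v y l') (hvb : ∀ y l, v (b * y) l = L * ∑ l', Mb l l' * v y l')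
    (hvc : ∀ i y l, v (c i * y) l = L * ∑ l', Mc i l l' * v y l') : Cfg S m := by
  classical
  have hu : 1 ≤ u := by
    rcases Nat.eq_zero_or_pos u with h | h
    · subst h; exact absurd (Subsingleton.elim _ _) (hv 1)
    · exact h
  have huR : (1 : ℝ) ≤ u := by exact_mod_cast hu
  set δ : ℝ := 1 / (4 * K ^ 2) with hδ
  have hK0 : 0 < K := by linarith
  have hδ0 : 0 < δ := by positivity
  set ε1 : ℝ := 1 / (12 * u * K ^ 3) with hepsd
  have hε10 : 0 < ε1 := by positivity
  have hK2 : 1 ≤ K ^ 2 := one_le_pow₀ hK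
  have hK3 : 1 ≤ K ^ 3 := one_le_pow₀ hK
  have hεδ : u * ε ≤ ε1 * δ := by
    rw [hepsd, hδ, div_mul_div_comm, le_div_iff₀ (by positivity)]
    nlinarith
  have hεε1 : u * ε ≤ ε1 := by
    refine hεδ.trans (mul_le_of_le_one_right hε10.le ?_)
    rw [hδ, div_le_one (by positivity)]; linarith
  have huK : u * K * ε1 * (12 * K ^ 2) = 1 := by rw [hepsd]; field_simp
  have hκ : u * K * ε1 ≤ 1 / (2 * K) := by
    rw [le_div_iff₀ (by positivity)]
    have : 0 ≤ u * K * ε1 := by positivity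
    nlinarith
  have hκ2 : u * K * ε1 ≤ 1 / 2 := hκ.trans (by apply one_div_le_one_div_of_le <;> linarith)
  have hepsK : ε1 ≤ K := by
    have : u * K * ε1 ≥ ε1 := by
      have : 1 ≤ u * K := one_le_mul_of_one_le_of_one_le huR hK
      nlinarith
    linarith
  set s : G → Ω := fun y => ∑ l, β l * v y l with hs
  set B : Set G := {y | ∀ l, δ * A (v y l) ≤ A (s y)} with hB
  -- general criterion for being in B
  have hcrit : ∀ (y y' : G) (t : Ω) (f : Fin u → Ω) (η : Fin u → Ω), (∀ l, A (f l) ≤ K) → (∀ l, A (η l) ≤ ε1) →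
      1 / K ≤ A (∑ l, β l * f l) → (∀ l, v y' l = L * (t * (f l + η l))) → y' ∈ B := by
    intro y y' t f η hf hη hbf hy'
    have h1 : s y' = L * (t * ((∑ l, β l * f l) + ∑ l, β l * η l)) := by
      simp only [hs, hy', ← Finset.sum_add_distrib, Finset.mul_sum]
      exact Finset.sum_congr rfl fun l _ => by ring
    intro l
    rw [h1, hy', A.map_mul, A.map_mul, A.map_mul, A.map_mul]
    have h2 := dot_bd A β η K ε1 hK0.le hβ hη
    have h3 : 1 / (2 * K) ≤ A ((∑ l, β l * f l) + ∑ l, β l * η l) := by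
      have h4 := A.le_sub (∑ l, β l * f l) (-∑ l, β l * η l)
      rw [A.map_neg, sub_neg_eq_add] at h4
      have : 1 / K = 1 / (2 * K) + 1 / (2 * K) := by field_simp; norm_num
      linarith
    have h5 : A (f l + η l) ≤ 2 * K := (A.add_le _ _).trans (by linarith [hf l, hη l])
    have h6 : δ * A (f l + η l) ≤ A ((∑ l, β l * f l) + ∑ l, β l * η l) := by
      refine le_trans ?_ h3
      refine (mul_le_mul_of_nonneg_left h5 hδ0.le).trans (le_of_eq ?_)
      rw [hδ]; field_simp; norm_num
    have h7 := mul_le_mul_of_nonneg_left h6 (mul_nonneg (A.nonneg L) (A.nonneg t))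
    linarith
  have hs0 : ∀ y ∈ B, s y ≠ 0 := by
    intro y hy h
    apply hv y
    funext l
    have := hy l
    rw [h, A.map_zero] at this
    have h1 : A (v y l) ≤ 0 := by
      by_contra h2
      push Not at h2
      have := mul_pos hδ0 h2
      linarith
    exact A.eq_zero.mp (le_antisymm h1 (A.nonneg _))
  have hn : ∀ y ∈ B, ∀ l, A (v y l) ≤ A (s y) / δ := by
    intro y hy l
    rw [le_div_iff₀ hδ0, mul_comm]; exact hy l
  have hn' : ∀ y, u * ε * (A (s y) / δ) ≤ ε1 * A (s y) := by
    intro y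
    rw [mul_div_assoc', div_le_iff₀ hδ0]
    nlinarith [A.nonneg (s y)]
  have hia : ∀ y ∈ B, ∃ η : Fin u → Ω, (∀ l, A (η l) ≤ ε1) ∧ ∀ l, v (a * y) l = L * (s y * (e l + η l)) := by
    intro y hy
    obtain ⟨η, h1, h2⟩ := pp_image A Ma e β (v y) (s y) (hs0 y hy) _ ε ε1 hε hMa (hn y hy) rfl (hn' y)
    exact ⟨η, h1, fun l => by rw [hva, h2]⟩
  have hib : ∀ y ∈ B, ∃ η : Fin u → Ω, (∀ l, A (η l) ≤ ε1) ∧ ∀ l, v (b * y) l = L * (s y * (e' l + η l)) := by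
    intro y hy
    obtain ⟨η, h1, h2⟩ := pp_image A Mb e' β (v y) (s y) (hs0 y hy) _ ε ε1 hε hMb (hn y hy) rfl (hn' y)
    exact ⟨η, h1, fun l => by rw [hvb, h2]⟩
  have hb1 : 1 / K ≤ A (∑ l, β l * e l) := by rw [hβe, A.map_one, div_le_one hK0]; exact hK
  have hb2 : 1 / K ≤ A (∑ l, β l * e' l) := by rw [hβe', div_le_iff₀ hK0, mul_comm]; exact hφ'
  refine ⟨a, ha, b, hb, Finset.univ.image c, ?_, ?_, B, ?_, ?_, ?_, ?_⟩
  · intro x hx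
    simp only [Finset.coe_image, Finset.coe_univ, Set.image_univ, Set.mem_range] at hx
    obtain ⟨i, rfl⟩ := hx
    exact hc i
  · exact Finset.card_image_le.trans (by simpa using hum)
  · intro y
    obtain ⟨i, -, hi⟩ := Finset.exists_max_image Finset.univ (fun l => A (v y l)) ⟨⟨0, hu⟩, Finset.mem_univ _⟩
    refine ⟨c i, Finset.mem_image_of_mem _ (Finset.mem_univ i), ?_⟩
    have hvi : v y i ≠ 0 := by
      intro h
      apply hv y
      funext l
      have := hi l (Finset.mem_univ l)
      simp only [h, A.map_zero] at this
      exact A.eq_zero.mp (le_antisymm this (A.nonneg _))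
    obtain ⟨η, h1, h2⟩ := pp_image A (Mc i) e (fun l' => if i = l' then 1 else 0) (v y) (v y i) hvi (A (v y i)) ε ε1 hε (hMc i)
      (fun l => hi l (Finset.mem_univ l)) (by simp) (mul_le_mul_of_nonneg_right hεε1 (A.nonneg _))
    exact hcrit y _ (v y i) e η he h1 hb1 (fun l => by rw [hvc, h2])
  · intro y hy
    obtain ⟨η, h1, h2⟩ := hia y hy
    exact hcrit y _ (s y) e η he h1 hb1 h2
  · intro y hy
    obtain ⟨η, h1, h2⟩ := hib y hy
    exact hcrit y _ (s y) e' η he' h1 hb2 h2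
  · intro y hy z hz heq
    obtain ⟨η, h1, h2⟩ := hia y hy
    obtain ⟨η', h1', h2'⟩ := hib z hz
    rw [heq] at h2
    have h3 : ∀ l, s y * (e l + η l) = s z * (e' l + η' l) := fun l => by
      have := (h2 l).symm.trans (h2' l)
      exact mul_left_cancel₀ hL this
    have h4 : s y * (1 + ∑ l, β l * η l) = s z * (φ + ∑ l, β l * η' l) := by
      rw [← hβe, ← hβe', ← Finset.sum_add_distrib, ← Finset.sum_add_distrib, Finset.mul_sum, Finset.mul_sum]
      refine Finset.sum_congr rfl fun l _ => ?_
      linear_combination β l * h3 l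
    set p := ∑ l, β l * η l
    set p' := ∑ l, β l * η' l
    have hp : A p ≤ u * K * ε1 := dot_bd A β η K ε1 hK0.le hβ h1
    have hp' : A p' ≤ u * K * ε1 := dot_bd A β η' K ε1 hK0.le hβ h1'
    obtain ⟨l, hl⟩ := hl
    have h5 : (e l + η l) * (φ + p') = (e' l + η' l) * (1 + p) := by
      have hne : s y * s z ≠ 0 := mul_ne_zero (hs0 y hy) (hs0 z hz)
      apply mul_left_cancel₀ hne
      linear_combination (s z * (φ + p')) * h3 l - s z * (e' l + η' l) * h4
    have h6 : e' l - φ * e l = (e l * p' + η l * φ + η l * p') + - (e' l * p + η' l + η' l * p) := by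
      linear_combination -h5
    rw [h6] at hl
    set κ := u * K * ε1
    have hκ0 : 0 ≤ κ := by positivity
    have b1 : A (e l * p') ≤ K * κ := by rw [A.map_mul]; exact mul_le_mul (he l) hp' (A.nonneg _) hK0.le
    have b2 : A (η l * φ) ≤ ε1 * K := by rw [A.map_mul]; exact mul_le_mul (h1 l) hφ (A.nonneg _) hε10.le
    have b3 : A (η l * p') ≤ ε1 * κ := by rw [A.map_mul]; exact mul_le_mul (h1 l) hp' (A.nonneg _) hε10.le
    have b4 : A (e' l * p) ≤ K * κ := by rw [A.map_mul]; exact mul_le_mul (he' l) hp (A.nonneg _) hK0.le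
    have b5 : A (η' l * p) ≤ ε1 * κ := by rw [A.map_mul]; exact mul_le_mul (h1' l) hp (A.nonneg _) hε10.le
    have b6 : A ((e l * p' + η l * φ + η l * p') + - (e' l * p + η' l + η' l * p)) ≤
        K * κ + ε1 * K + ε1 * κ + (K * κ + ε1 + ε1 * κ) := by
      refine (A.add_le _ _).trans ?_
      rw [A.map_neg]
      have i1 := A.add_le (e l * p' + η l * φ) (η l * p')
      have i2 := A.add_le (e l * p') (η l * φ)
      have i3 := A.add_le (e' l * p + η' l) (η' l * p)
      have i4 := A.add_le (e' l * p) (η' l)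
      have i5 := h1' l
      linarith
    have hε1κ : ε1 * K ≤ κ := by
      have : ε1 * K * 1 ≤ ε1 * K * u := mul_le_mul_of_nonneg_left huR (by positivity)
      calc ε1 * K ≤ ε1 * K * u := by linarith
        _ = κ := by simp only [κ]; ring
    have j1 : K * ε1 * κ ≤ κ * (1 / 2) := by
      have := mul_le_mul hε1κ hκ2 hκ0 hκ0
      linarith
    have j2 : K * (K * κ + ε1 * K + ε1 * κ + (K * κ + ε1 + ε1 * κ)) ≤ 6 * K ^ 2 * κ := by
      have : K * (ε1 * K) ≤ K * κ := mul_le_mul_of_nonneg_left hε1κ hK0.le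
      have i1 : K * κ ≤ K ^ 2 * κ := by
        have := mul_le_mul_of_nonneg_right (show K ≤ K ^ 2 by nlinarith only [hK]) hκ0
        exact this
      have i2 : κ ≤ K ^ 2 * κ := le_mul_of_one_le_left hκ0 hK2
      have i3 : K * (K * κ + ε1 * K + ε1 * κ + (K * κ + ε1 + ε1 * κ)) = 2 * (K ^ 2 * κ) + K * (ε1 * K) + 2 * (K * ε1 * κ) + ε1 * K := by ring
      rw [i3]
      linarith
    have j3 : 6 * K ^ 2 * κ = 1 / 2 := by linarith
    have j4 := mul_le_mul_of_nonneg_left b6 hK0.le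
    linarith
end pingpong
end UEG


namespace UEG
section escape
variable {F G : Type*} [Field F] [Group G] {n : ℕ} (ρ : G →* Matrix (Fin n) (Fin n) F)

/-- generating functions of degree one -/
def gen1 : Option (Bool × Fin n × Fin n) → G → F
  | none => 1
  | some (true, a, b) => fun x => ρ x a b
  | some (false, a, b) => fun x => ρ x⁻¹ a b

def L1 : Submodule F (G → F) := Submodule.span F (Set.range (gen1 ρ))

lemma gen1_mem (o) : gen1 ρ o ∈ L1 ρ := Submodule.subset_span ⟨o, rfl⟩

lemma one_mem_L1 : (1 : G → F) ∈ L1 ρ := gen1_mem ρ none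

lemma rho_mem_L1 (a b : Fin n) : (fun x => ρ x a b) ∈ L1 ρ := gen1_mem ρ (some (true, a, b))

lemma rhoinv_mem_L1 (a b : Fin n) : (fun x => ρ x⁻¹ a b) ∈ L1 ρ := gen1_mem ρ (some (false, a, b))

lemma L1_fg : (L1 ρ).FG := Submodule.fg_span (Set.finite_range _)

lemma L1pow_fg (m : ℕ) : ((L1 ρ) ^ m).FG := (L1_fg ρ).pow m

lemma one_le_L1 : 1 ≤ L1 ρ := by
  rw [Submodule.one_le]; exact one_mem_L1 ρ

lemma L1_mono {m m' : ℕ} (h : m ≤ m') : (L1 ρ) ^ m ≤ (L1 ρ) ^ m' := pow_le_pow_right₀ (one_le_L1 ρ) h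

/-- left translation as an algebra hom -/
def ltr (s : G) : (G → F) →ₐ[F] (G → F) where
  toFun f := fun x => f (s * x)
  map_one' := rfl
  map_mul' _ _ := rfl
  map_zero' := rfl
  map_add' _ _ := rfl
  commutes' _ := rfl

def rtr (s : G) : (G → F) →ₐ[F] (G → F) where
  toFun f := fun x => f (x * s)
  map_one' := rfl
  map_mul' _ _ := rfl
  map_zero' := rfl
  map_add' _ _ := rfl
  commutes' _ := rfl

lemma ltr_apply (s : G) (f : G → F) (x : G) : ltr s f x = f (s * x) := rfl
lemma rtr_apply (s : G) (f : G → F) (x : G) : rtr s f x = f (x * s) := rfl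

lemma ltr_L1 (s : G) : (L1 ρ).map (ltr (F := F) s).toLinearMap ≤ L1 ρ := by
  rw [L1, Submodule.map_span, Submodule.span_le]
  rintro _ ⟨_, ⟨o, rfl⟩, rfl⟩
  rcases o with _ | ⟨_ | _, a, b⟩
  · exact one_mem_L1 ρ
  · have : (ltr (F := F) s).toLinearMap (gen1 ρ (some (false, a, b))) = ∑ c, ρ s⁻¹ c b • gen1 ρ (some (false, a, c)) := by
      funext x
      rw [AlgHom.toLinearMap_apply, ltr_apply]
      simp [gen1, Matrix.mul_apply, mul_comm]
    rw [this]
    exact Submodule.sum_mem _ fun c _ => Submodule.smul_mem _ _ (gen1_mem ρ _)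
  · have : (ltr (F := F) s).toLinearMap (gen1 ρ (some (true, a, b))) = ∑ c, ρ s a c • gen1 ρ (some (true, c, b)) := by
      funext x
      rw [AlgHom.toLinearMap_apply, ltr_apply]
      simp [gen1, Matrix.mul_apply]
    rw [this]
    exact Submodule.sum_mem _ fun c _ => Submodule.smul_mem _ _ (gen1_mem ρ _)

lemma rtr_L1 (s : G) : (L1 ρ).map (rtr (F := F) s).toLinearMap ≤ L1 ρ := by
  rw [L1, Submodule.map_span, Submodule.span_le]
  rintro _ ⟨_, ⟨o, rfl⟩, rfl⟩
  rcases o with _ | ⟨_ | _, a, b⟩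
  · exact one_mem_L1 ρ
  · have : (rtr (F := F) s).toLinearMap (gen1 ρ (some (false, a, b))) = ∑ c, ρ s⁻¹ a c • gen1 ρ (some (false, c, b)) := by
      funext x
      rw [AlgHom.toLinearMap_apply, rtr_apply]
      simp [gen1, Matrix.mul_apply]
    rw [this]
    exact Submodule.sum_mem _ fun c _ => Submodule.smul_mem _ _ (gen1_mem ρ _)
  · have : (rtr (F := F) s).toLinearMap (gen1 ρ (some (true, a, b))) = ∑ c, ρ s c b • gen1 ρ (some (true, a, c)) := by
      funext x
      rw [AlgHom.toLinearMap_apply, rtr_apply]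
      simp [gen1, Matrix.mul_apply, mul_comm]
    rw [this]
    exact Submodule.sum_mem _ fun c _ => Submodule.smul_mem _ _ (gen1_mem ρ _)

lemma ltr_mem {m : ℕ} {f : G → F} (hf : f ∈ L1 ρ ^ m) (s : G) : (fun x => f (s * x)) ∈ L1 ρ ^ m := by
  have h : ltr s f ∈ (L1 ρ ^ m).map (ltr (F := F) s).toLinearMap := Submodule.mem_map_of_mem hf
  rw [Submodule.map_pow] at h
  exact pow_le_pow_left' (ltr_L1 ρ s) m h

lemma rtr_mem {m : ℕ} {f : G → F} (hf : f ∈ L1 ρ ^ m) (s : G) : (fun x => f (x * s)) ∈ L1 ρ ^ m := by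
  have h : rtr s f ∈ (L1 ρ ^ m).map (rtr (F := F) s).toLinearMap := Submodule.mem_map_of_mem hf
  rw [Submodule.map_pow] at h
  exact pow_le_pow_left' (rtr_L1 ρ s) m h

lemma L1_mul {m m' : ℕ} {f f' : G → F} (hf : f ∈ L1 ρ ^ m) (hf' : f' ∈ L1 ρ ^ m') : (fun x => f x * f' x) ∈ L1 ρ ^ (m + m') := by
  rw [pow_add]; exact Submodule.mul_mem_mul hf hf'

lemma L1_const (c : F) (m : ℕ) : (fun _ : G => c) ∈ L1 ρ ^ m := by
  apply L1_mono ρ (Nat.zero_le m)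
  rw [pow_zero, Submodule.mem_one]
  exact ⟨c, rfl⟩

lemma L1_add {m : ℕ} {f f' : G → F} (hf : f ∈ L1 ρ ^ m) (hf' : f' ∈ L1 ρ ^ m) : (fun x => f x + f' x) ∈ L1 ρ ^ m :=
  Submodule.add_mem _ hf hf'

lemma L1_sub {m : ℕ} {f f' : G → F} (hf : f ∈ L1 ρ ^ m) (hf' : f' ∈ L1 ρ ^ m) : (fun x => f x - f' x) ∈ L1 ρ ^ m :=
  Submodule.sub_mem _ hf hf'

lemma L1_cmul {m : ℕ} {f : G → F} (c : F) (hf : f ∈ L1 ρ ^ m) : (fun x => c * f x) ∈ L1 ρ ^ m :=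
  Submodule.smul_mem _ c hf

lemma L1_mulc {m : ℕ} {f : G → F} (c : F) (hf : f ∈ L1 ρ ^ m) : (fun x => f x * c) ∈ L1 ρ ^ m := by
  simpa only [mul_comm] using L1_cmul ρ c hf

lemma L1_sum {m : ℕ} {J : Type*} (s : Finset J) {f : J → G → F} (hf : ∀ j ∈ s, f j ∈ L1 ρ ^ m) :
    (fun x => ∑ j ∈ s, f j x) ∈ L1 ρ ^ m := by
  have := Submodule.sum_mem (L1 ρ ^ m) hf
  convert this using 1
  funext x; simp

lemma L1_prod {m : ℕ} {J : Type*} (s : Finset J) {f : J → G → F} (hf : ∀ j ∈ s, f j ∈ L1 ρ ^ m) :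
    (fun x => ∏ j ∈ s, f j x) ∈ L1 ρ ^ (m * s.card) := by
  classical
  induction s using Finset.induction_on with
  | empty => simpa using L1_const ρ 1 0
  | insert j s hj ih =>
    simp only [Finset.prod_insert hj, Finset.card_insert_of_notMem hj]
    rw [mul_add, mul_one, add_comm]
    exact L1_mul ρ (hf j (Finset.mem_insert_self _ _)) (ih fun i hi => hf i (Finset.mem_insert_of_mem hi))

lemma L1_det {m : ℕ} {J : Type*} [Fintype J] [DecidableEq J] {f : G → Matrix J J F} (hf : ∀ i j, (fun x => f x i j) ∈ L1 ρ ^ m) :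
    (fun x => (f x).det) ∈ L1 ρ ^ (m * Fintype.card J) := by
  simp only [Matrix.det_apply']
  refine L1_sum ρ _ fun σ _ => L1_cmul ρ _ ?_
  have := L1_prod ρ (Finset.univ) (f := fun i x => f x (σ i) i) (fun i _ => hf _ _)
  simpa using this

/-- uniform escape from a space of functions -/
lemma escape (m : ℕ) : ∃ L : ℕ, ∀ S : Finset G, GS S → ∀ f ∈ L1 ρ ^ m, (∀ x ∈ (S : Set G) ^ L, f x = 0) → f = 0 := by
  haveI hfd : FiniteDimensional F ↥(L1 ρ ^ m) := Module.Finite.iff_fg.mpr (L1pow_fg ρ m)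
  refine ⟨Module.finrank F ↥(L1 ρ ^ m), fun S hS => ?_⟩
  let W : ℕ → Submodule F (G → F) := fun i =>
    (L1 ρ ^ m) ⊓ { carrier := {f | ∀ x ∈ (S : Set G) ^ i, f x = 0}
                   add_mem' := fun {f g} hf hg x hx => by simp [hf x hx, hg x hx]
                   zero_mem' := fun x _ => rfl
                   smul_mem' := fun c f hf x hx => by simp [hf x hx] }
  have hW : ∀ i f, f ∈ W i ↔ f ∈ L1 ρ ^ m ∧ ∀ x ∈ (S : Set G) ^ i, f x = 0 := fun i f => Iff.rfl
  have hWle : ∀ i, W i ≤ L1 ρ ^ m := fun i => inf_le_left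
  haveI : ∀ i, FiniteDimensional F (W i) := fun i => Submodule.finiteDimensional_of_le (hWle i)
  have h1S : (1 : G) ∈ (S : Set G) := by simpa using hS.1
  have hanti : ∀ i, W (i + 1) ≤ W i := fun i f hf =>
    ⟨hf.1, fun x hx => hf.2 x (Set.pow_subset_pow_right h1S (Nat.le_succ i) hx)⟩
  have hstab : ∀ i, W (i + 1) = W i → W i = ⊥ := by
    intro i hi
    have hinv : ∀ s ∈ S, ∀ f ∈ W i, (fun x => f (s * x)) ∈ W i := by
      intro s hs f hf
      rw [← hi] at hf
      refine ⟨ltr_mem ρ hf.1 s, fun x hx => hf.2 (s * x) ?_⟩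
      rw [pow_succ']
      exact Set.mul_mem_mul hs hx
    have hall : ∀ w : G, ∀ f ∈ W i, (fun x => f (w * x)) ∈ W i := by
      intro w
      have hw : w ∈ Subgroup.closure (S : Set G) := by rw [hS.2.2]; trivial
      induction hw using Subgroup.closure_induction'' with
      | one => intro f hf; simpa using hf
      | mem s hs => exact hinv s hs
      | inv_mem s hs => exact hinv _ (hS.2.1 s hs)
      | mul a b _ _ ha hb =>
        intro f hf
        have := hb _ (ha f hf)
        simpa only [mul_assoc] using this
    rw [eq_bot_iff]
    intro f hf
    rw [Submodule.mem_bot]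
    funext w
    have := (hall w f hf).2 1 (Set.one_mem_pow h1S)
    simpa using this
  have hdim : ∀ i, W i = ⊥ ∨ Module.finrank F (W i) + i ≤ Module.finrank F ↥(L1 ρ ^ m) := by
    intro i
    induction i with
    | zero => right; exact Submodule.finrank_mono (hWle 0)
    | succ i ih =>
      by_cases heq : W (i + 1) = W i
      · left; rw [heq]; exact hstab i heq
      · have hlt : W (i + 1) < W i := lt_of_le_of_ne (hanti i) heq
        have h2 := Submodule.finrank_lt_finrank_of_lt hlt
        rcases ih with ih | ih
        · left; rw [eq_bot_iff, ← ih]; exact hanti i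
        · right; omega
  intro f hf hf0
  have hmem : f ∈ W (Module.finrank F ↥(L1 ρ ^ m)) := ⟨hf, hf0⟩
  rcases hdim (Module.finrank F ↥(L1 ρ ^ m)) with h | h
  · rw [h] at hmem; exact hmem
  · have h0 : Module.finrank F (W (Module.finrank F ↥(L1 ρ ^ m))) = 0 := by omega
    rw [Submodule.finrank_eq_zero] at h0
    rw [h0] at hmem; exact hmem

/-- multi-variable escape -/
lemma escape_multi (m : ℕ) : ∃ L : ℕ, ∀ S : Finset G, GS S → ∀ (I : Type) [Fintype I] [DecidableEq I] (f : (I → G) → F),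
    (∀ i p, (fun x => f (Function.update p i x)) ∈ L1 ρ ^ m) → (∃ p, f p ≠ 0) →
      ∃ p, (∀ i, p i ∈ (S : Set G) ^ L) ∧ f p ≠ 0 := by
  obtain ⟨L, hL⟩ := escape ρ m
  refine ⟨L, fun S hS I _ _ f hf hne => ?_⟩
  have key : ∀ s : Finset I, ∃ p, (∀ i ∈ s, p i ∈ (S : Set G) ^ L) ∧ f p ≠ 0 := by
    intro s
    induction s using Finset.induction_on with
    | empty => obtain ⟨p, hp⟩ := hne; exact ⟨p, by simp, hp⟩
    | insert i s hi ih =>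
      obtain ⟨p, hp1, hp2⟩ := ih
      have : ∃ x ∈ (S : Set G) ^ L, f (Function.update p i x) ≠ 0 := by
        by_contra hcon
        push Not at hcon
        have := congrFun (hL S hS _ (hf i p) hcon) (p i)
        simp at this
        exact hp2 this
      obtain ⟨x, hx, hfx⟩ := this
      refine ⟨Function.update p i x, fun j hj => ?_, hfx⟩
      by_cases hji : j = i
      · subst hji; simpa using hx
      · rw [Function.update_of_ne hji]; exact hp1 j ((Finset.mem_insert.mp hj).resolve_left hji)
  obtain ⟨p, hp1, hp2⟩ := key Finset.univ
  exact ⟨p, fun i => hp1 i (Finset.mem_univ i), hp2⟩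

/-- word maps are polynomial in each coordinate -/
lemma word_mem {I : Type} [DecidableEq I] (w : FreeGroup I) : ∃ m : ℕ, ∀ i p a b,
    (fun x => ρ (FreeGroup.lift (Function.update p i x) w) a b) ∈ L1 ρ ^ m := by
  induction w using FreeGroup.induction_on with
  | C1 => exact ⟨0, fun i p a b => by simpa using L1_const ρ _ 0⟩
  | of j =>
    refine ⟨1, fun i p a b => ?_⟩
    by_cases hji : j = i
    · subst hji; simpa using rho_mem_L1 ρ a b
    · simpa [Function.update_of_ne hji] using L1_const ρ _ 1
  | inv_of j _ =>
    refine ⟨1, fun i p a b => ?_⟩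
    by_cases hji : j = i
    · subst hji; simpa using rhoinv_mem_L1 ρ a b
    · simpa [Function.update_of_ne hji] using L1_const ρ _ 1
  | mul x y hx hy =>
    obtain ⟨m, hm⟩ := hx
    obtain ⟨m', hm'⟩ := hy
    refine ⟨m + m', fun i p a b => ?_⟩
    simp only [map_mul, Matrix.mul_apply]
    exact L1_sum ρ _ fun c _ => L1_mul ρ (hm i p a c) (hm' i p c b)

lemma Nq_map {H : Type*} [Group H] (φ : G →* H) (q : ℕ) {x : G} (hx : x ∈ Nq G q) : φ x ∈ Nq H q := by
  induction hx using Subgroup.closure_induction with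
  | mem x hx =>
    obtain ⟨x, y, rfl⟩ := hx
    have : φ (cq q x y) = cq q (φ x) (φ y) := by simp [cq]
    rw [this]; exact cq_mem q _ _
  | one => rw [map_one]; exact Subgroup.one_mem _
  | mul a b _ _ ha hb => rw [map_mul]; exact Subgroup.mul_mem _ ha hb
  | inv a _ ha => rw [map_inv]; exact Subgroup.inv_mem _ ha

/-- elements of `Nq` are values of verbal words -/
lemma Nq_word {q : ℕ} {ν : G} (hν : ν ∈ Nq G q) : ∃ (I : Type) (_ : Fintype I) (w : FreeGroup I) (p : I → G),
    w ∈ Nq (FreeGroup I) q ∧ FreeGroup.lift p w = ν := by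
  induction hν using Subgroup.closure_induction with
  | mem x hx =>
    obtain ⟨x, y, rfl⟩ := hx
    refine ⟨Bool, inferInstance, cq q (FreeGroup.of true) (FreeGroup.of false), fun b => if b then x else y, cq_mem _ _ _, ?_⟩
    simp [cq]
  | one => exact ⟨Empty, inferInstance, 1, Empty.elim, Subgroup.one_mem _, map_one _⟩
  | mul a b _ _ ha hb =>
    obtain ⟨I, _, w, p, h1, h2⟩ := ha
    obtain ⟨I', _, w', p', h1', h2'⟩ := hb
    refine ⟨I ⊕ I', inferInstance, FreeGroup.map Sum.inl w * FreeGroup.map Sum.inr w', Sum.elim p p',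
      Subgroup.mul_mem _ (Nq_map _ q h1) (Nq_map _ q h1'), ?_⟩
    have e1 : FreeGroup.lift (Sum.elim p p') (FreeGroup.map Sum.inl w) = FreeGroup.lift p w := by
      rw [← MonoidHom.comp_apply]; congr 1; ext; simp
    have e2 : FreeGroup.lift (Sum.elim p p') (FreeGroup.map Sum.inr w') = FreeGroup.lift p' w' := by
      rw [← MonoidHom.comp_apply]; congr 1; ext; simp
    rw [map_mul, e1, e2, h2, h2']
  | inv a _ ha =>
    obtain ⟨I, _, w, p, h1, h2⟩ := ha
    exact ⟨I, inferInstance, w⁻¹, p, Subgroup.inv_mem _ h1, by rw [map_inv, h2]⟩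

lemma Nq_word_family {q : ℕ} {J : Type} [Fintype J] {ν : J → G} (hν : ∀ j, ν j ∈ Nq G q) :
    ∃ (I : Type) (_ : Fintype I) (w : J → FreeGroup I) (p : I → G),
    (∀ j, w j ∈ Nq (FreeGroup I) q) ∧ ∀ j, FreeGroup.lift p (w j) = ν j := by
  choose I hI w p h1 h2 using fun j => Nq_word (hν j)
  refine ⟨Σ j, I j, inferInstance, fun j => FreeGroup.map (Sigma.mk j) (w j), fun i => p i.1 i.2, fun j => Nq_map _ q (h1 j), fun j => ?_⟩
  rw [← h2 j, ← MonoidHom.comp_apply]; congr 1; ext; simp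
end escape
end UEG


namespace UEG
namespace PreData
variable {G : Type*} [Group G] {q : ℕ} {n w : ℕ}

section ring
variable {R : Type*} [CommRing R] (D : PreData G q R n w)

/-- translated Gram matrix -/
def T (ν : Fin w × Fin w → G) (γ : G) : Matrix (Fin w × Fin w) (Fin w × Fin w) R :=
  Matrix.of fun i l => D.τ (γ * ν i * γ⁻¹ * ν l)

lemma T_one (ν : Fin w × Fin w → G) : D.T ν 1 = D.gram ν := by
  ext i l; simp [T, gram]

lemma β_mul (x : G) {y : G} (hy : y ∈ Nq G q) : D.β (x * y) = D.β x * D.β y := by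
  have := D.hinv y hy
  simp only [β]
  rw [map_mul, ← Matrix.mul_assoc D.B, Matrix.mul_assoc (D.B * D.ρ x), this]
  simp only [Matrix.mul_assoc]

lemma β_one : D.β 1 = 1 := by simp [β, D.hB]

lemma β_conj {ν : G} (hν : ν ∈ Nq G q) (y : G) : (D.β (y * ν * y⁻¹)).charpoly = (D.β ν).charpoly := D.hchar ν hν y

lemma τ_conj {ν : G} (hν : ν ∈ Nq G q) (y : G) : D.τ (y * ν * y⁻¹) = D.τ ν := by
  rcases Nat.eq_zero_or_pos w with h | h
  · subst h; simp [τ]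
  · haveI : Nonempty (Fin w) := ⟨⟨0, h⟩⟩
    simp only [τ]
    nontriviality R
    rw [Matrix.trace_eq_neg_charpoly_coeff, Matrix.trace_eq_neg_charpoly_coeff, D.β_conj hν]

/-- base change -/
def map {R' : Type*} [CommRing R'] (D : PreData G q R n w) (f : R →+* R') : PreData G q R' n w where
  ρ := (RingHom.mapMatrix f).toMonoidHom.comp D.ρ
  B := D.B.map f
  B' := D.B'.map f
  hB := by
    rw [← Matrix.map_mul, D.hB, Matrix.map_one f (map_zero f) (map_one f)]
  hinv := fun ν hν => by
    have := congrArg (fun M => M.map f) (D.hinv ν hν)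
    simpa [Matrix.map_mul] using this
  hchar := fun ν hν y => by
    have := congrArg (fun M => M.map f) (D.hchar ν hν y)
    simp only [← Matrix.charpoly_map] at this
    simpa [Matrix.map_mul] using this
  hkill := fun ν hν => by
    have h := congrArg (RingHom.mapMatrix f) (D.hkill ν hν)
    rw [map_zero] at h
    have h2 : (D.B.map f * ((RingHom.mapMatrix f).toMonoidHom.comp D.ρ) ν * D.B'.map f).charpoly
        = (D.B * D.ρ ν * D.B').charpoly.map f := by
      rw [← Matrix.charpoly_map]; simp [Matrix.map_mul]
    rw [h2, ← h, Polynomial.aeval_def, Polynomial.eval₂_map, Polynomial.aeval_def, Polynomial.hom_eval₂]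
    congr 1
    ext x i j
    simp [Matrix.algebraMap_matrix_apply]
    split_ifs <;> simp

lemma map_β {R' : Type*} [CommRing R'] (f : R →+* R') (g : G) : (D.map f).β g = (D.β g).map f := by
  simp [β, map, Matrix.map_mul]

lemma map_τ {R' : Type*} [CommRing R'] (f : R →+* R') (g : G) : (D.map f).τ g = f (D.τ g) := by
  rw [τ, map_β, τ, Matrix.trace, Matrix.trace, map_sum]; rfl

lemma map_gram {R' : Type*} [CommRing R'] (f : R →+* R') (ν) : (D.map f).gram ν = (D.gram ν).map f := by
  ext i l; simp [gram, map_τ]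

lemma map_T {R' : Type*} [CommRing R'] (f : R →+* R') (ν) (γ : G) : (D.map f).T ν γ = (D.T ν γ).map f := by
  ext i l; simp [T, map_τ]

lemma map_gram_det {R' : Type*} [CommRing R'] (f : R →+* R') (ν) : ((D.map f).gram ν).det = f (D.gram ν).det := by
  rw [map_gram, RingHom.map_det]; rfl

lemma det_rho_eq_one {ν : G} (hν : ν ∈ Nq G q) : (D.ρ ν).det = 1 := by
  let φ : G →* Rˣ := (Units.map (Matrix.detMonoidHom (R := R) (n := Fin n))).comp (D.ρ.toHomUnits)
  have hφ : ∀ x, ((φ x : Rˣ) : R) = (D.ρ x).det := fun x => rfl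
  rw [← hφ]
  have : φ ν = 1 := by
    induction hν using Subgroup.closure_induction with
    | mem x hx =>
      obtain ⟨x, y, rfl⟩ := hx
      simp only [cq, map_mul, map_inv, map_pow]
      rw [mul_comm (φ x ^ q), mul_inv_cancel_right, mul_inv_cancel]
    | one => exact map_one _
    | mul a b _ _ ha hb => rw [map_mul, ha, hb, one_mul]
    | inv a _ ha => rw [map_inv, ha, inv_one]
  rw [this]; rfl
end ring

section field
variable {F : Type*} [Field F] (D : PreData G q F n w) (ν : Fin w × Fin w → G)

lemma expand (hdet : (D.gram ν).det ≠ 0) (hν : ∀ i, ν i ∈ Nq G q) (X : Matrix (Fin w) (Fin w) F) :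
    X = ∑ m', (∑ m, (X * D.β (ν m)).trace * (D.gram ν)⁻¹ m m') • D.β (ν m') := by
  classical
  have hT : ∀ i l, D.gram ν i l = (D.β (ν i) * D.β (ν l)).trace := by
    intro i l
    rw [gram, Matrix.of_apply, τ, D.β_mul _ (hν l)]
  have hu : IsUnit (D.gram ν).det := isUnit_iff_ne_zero.mpr hdet
  have hli : LinearIndependent F (fun i => D.β (ν i)) := by
    rw [Fintype.linearIndependent_iff]
    intro g hg
    have h1 : g ᵥ* (D.gram ν) = 0 := by
      funext l
      have h2 := congrArg (fun X => (X * D.β (ν l)).trace) hg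
      simp only [Finset.sum_mul, Matrix.trace_sum, zero_mul, Matrix.trace_zero, Matrix.smul_mul, Matrix.trace_smul] at h2
      rw [Matrix.vecMul, dotProduct, Pi.zero_apply, ← h2]
      exact Finset.sum_congr rfl fun i _ => by rw [hT, smul_eq_mul]
    have h2 : g = 0 := Matrix.eq_zero_of_vecMul_eq_zero hdet h1
    intro i; rw [h2]; rfl
  have hspan : X ∈ Submodule.span F (Set.range fun i => D.β (ν i)) := by
    rw [hli.span_eq_top_of_card_eq_finrank' (by rw [Module.finrank_matrix]; simp)]; trivial
  obtain ⟨y, hy⟩ := (Submodule.mem_span_range_iff_exists_fun F).mp hspan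
  have h1 : (fun m => (X * D.β (ν m)).trace) = y ᵥ* (D.gram ν) := by
    funext m
    rw [← hy]
    simp only [Finset.sum_mul, Matrix.trace_sum, Matrix.smul_mul, Matrix.trace_smul, Matrix.vecMul, dotProduct]
    exact Finset.sum_congr rfl fun i _ => by rw [hT, smul_eq_mul]
  have h2 : ∀ m', (∑ m, (X * D.β (ν m)).trace * (D.gram ν)⁻¹ m m') = y m' := by
    intro m'
    have : (∑ m, (X * D.β (ν m)).trace * (D.gram ν)⁻¹ m m') = ((fun m => (X * D.β (ν m)).trace) ᵥ* (D.gram ν)⁻¹) m' := rfl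
    rw [this, h1, Matrix.vecMul_vecMul, Matrix.mul_nonsing_inv _ hu, Matrix.vecMul_one]
  simp only [h2]
  exact hy.symm

lemma T_mul (hdet : (D.gram ν).det ≠ 0) (hν : ∀ i, ν i ∈ Nq G q) (γ γ' : G) :
    D.T ν (γ * γ') = D.T ν γ' * (D.gram ν)⁻¹ * D.T ν γ := by
  ext i l
  have hl : γ⁻¹ * ν l * γ ∈ Nq G q := by simpa using Nq_conj q γ⁻¹ (ν l) (hν l)
  have hi : γ' * ν i * γ'⁻¹ ∈ Nq G q := Nq_conj q γ' (ν i) (hν i)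
  have h1 : D.T ν (γ * γ') i l = (D.β (γ' * ν i * γ'⁻¹) * D.β (γ⁻¹ * ν l * γ)).trace := by
    rw [← D.β_mul _ hl]
    have := D.τ_conj (Subgroup.mul_mem _ hi hl) γ
    rw [τ, τ] at this
    rw [T, Matrix.of_apply, τ, ← this]
    congr 2
    group
  rw [h1, D.expand ν hdet hν (D.β (γ' * ν i * γ'⁻¹)), Finset.sum_mul, Matrix.trace_sum, Matrix.mul_apply]
  refine Finset.sum_congr rfl fun m' _ => ?_
  rw [Matrix.smul_mul, Matrix.trace_smul, smul_eq_mul, ← D.β_mul _ hl, Matrix.mul_apply]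
  congr 1
  · refine Finset.sum_congr rfl fun m _ => ?_
    rw [← D.β_mul _ (hν m)]; rfl
  · have := D.τ_conj (Subgroup.mul_mem _ (hν m') hl) γ
    rw [τ, τ] at this
    rw [T, Matrix.of_apply, τ, ← this]
    congr 2
    group

/-- adjoint-type representation -/
noncomputable def cmat (γ : G) : Matrix (Fin w × Fin w) (Fin w × Fin w) F := (D.T ν γ * (D.gram ν)⁻¹)ᵀ

lemma cmat_one (hdet : (D.gram ν).det ≠ 0) : D.cmat ν 1 = 1 := by
  rw [cmat, T_one, Matrix.mul_nonsing_inv _ (isUnit_iff_ne_zero.mpr hdet), Matrix.transpose_one]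

lemma cmat_mul (hdet : (D.gram ν).det ≠ 0) (hν : ∀ i, ν i ∈ Nq G q) (γ γ' : G) :
    D.cmat ν (γ * γ') = D.cmat ν γ * D.cmat ν γ' := by
  rw [cmat, cmat, cmat, D.T_mul ν hdet hν, ← Matrix.transpose_mul]
  simp only [Matrix.mul_assoc]

lemma cmat_root (hdet : (D.gram ν).det ≠ 0) (hν : ∀ i, ν i ∈ Nq G q) {g : G} (hg : g ∈ Nq G q) (lam μ : F)
    (hlam : (D.β g).charpoly.IsRoot lam) (hμ : (D.β g).charpoly.IsRoot μ) :
    (D.cmat ν g).charpoly.IsRoot (lam / μ) := by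
  classical
  have hgi : D.β g * D.β g⁻¹ = 1 := by
    rw [← D.β_mul _ (Subgroup.inv_mem _ hg), mul_inv_cancel, D.β_one]
  have hig : D.β g⁻¹ * D.β g = 1 := by
    rw [← D.β_mul _ hg, inv_mul_cancel, D.β_one]
  have ev : ∀ (M : Matrix (Fin w) (Fin w) F) (μ : F), M.charpoly.IsRoot μ → ∃ v : Fin w → F, v ≠ 0 ∧ M *ᵥ v = μ • v := by
    intro M μ h
    have h1 : (M - Matrix.scalar (Fin w) μ).det = 0 := by
      have h2 : (Matrix.scalar (Fin w) μ - M).det = 0 := by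
        rw [← Matrix.eval_charpoly]; exact h
      rw [← neg_sub, Matrix.det_neg, h2, mul_zero]
    obtain ⟨v, hv, h2⟩ := Matrix.exists_mulVec_eq_zero_iff.mpr h1
    refine ⟨v, hv, ?_⟩
    rw [Matrix.sub_mulVec, sub_eq_zero] at h2
    rw [h2]; simp [Matrix.scalar_apply, ← Matrix.smul_one_eq_diagonal, Matrix.smul_mulVec]
  obtain ⟨v, hv, hvμ⟩ := ev _ _ hμ
  obtain ⟨f, hf, hfl⟩ := ev (D.β g)ᵀ lam (by rw [Matrix.charpoly_transpose]; exact hlam)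
  rw [Matrix.mulVec_transpose] at hfl
  have hμ0 : μ ≠ 0 := by
    rintro rfl
    rw [zero_smul] at hvμ
    apply hv
    have := congrArg (D.β g⁻¹ *ᵥ ·) hvμ
    simpa [Matrix.mulVec_mulVec, hig] using this
  have hvμ' : D.β g⁻¹ *ᵥ v = μ⁻¹ • v := by
    have := congrArg (D.β g⁻¹ *ᵥ ·) hvμ
    simp only [Matrix.mulVec_mulVec, hig, Matrix.one_mulVec, Matrix.mulVec_smul] at this
    conv_rhs => rw [this]
    rw [smul_smul, inv_mul_cancel₀ hμ0, one_smul]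
  set z : Fin w × Fin w → F := fun i => f ⬝ᵥ (D.β (ν i) *ᵥ v) with hz
  have hexp : ∀ X : Matrix (Fin w) (Fin w) F, f ⬝ᵥ (X *ᵥ v) = ∑ m', (∑ m, (X * D.β (ν m)).trace * (D.gram ν)⁻¹ m m') * z m' := by
    intro X
    conv_lhs => rw [D.expand ν hdet hν X]
    simp only [Matrix.sum_mulVec, Matrix.smul_mulVec, dotProduct_sum, dotProduct_smul, smul_eq_mul, hz]
  have hz0 : z ≠ 0 := by
    intro h0
    have h1 : ∀ X : Matrix (Fin w) (Fin w) F, f ⬝ᵥ (X *ᵥ v) = 0 := by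
      intro X; rw [hexp, h0]; simp
    obtain ⟨i, hi⟩ := Function.ne_iff.mp hf
    obtain ⟨j, hj⟩ := Function.ne_iff.mp hv
    have h2 := h1 (Matrix.single i j 1)
    rw [Matrix.single_mulVec] at h2
    have h3 : f ⬝ᵥ Function.update 0 i (v j) = f i * v j := by
      rw [show (Function.update (0 : Fin w → F) i (v j)) = Pi.single i (v j) from rfl, dotProduct_single]
    rw [one_mul, h3, mul_eq_zero] at h2
    rcases h2 with h2 | h2
    · exact hi h2
    · exact hj h2
  have hTz : (D.T ν g * (D.gram ν)⁻¹) *ᵥ z = (lam / μ) • z := by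
    funext i
    have hgig : D.β (g * ν i * g⁻¹) = D.β g * D.β (ν i) * D.β g⁻¹ := by
      rw [D.β_mul _ (Subgroup.inv_mem _ hg), D.β_mul _ (hν i)]
    have h1 := hexp (D.β (g * ν i * g⁻¹))
    have h2 : f ⬝ᵥ (D.β (g * ν i * g⁻¹) *ᵥ v) = lam / μ * z i := by
      rw [hgig, ← Matrix.mulVec_mulVec, hvμ', Matrix.mulVec_smul, ← Matrix.mulVec_mulVec, dotProduct_smul,
        Matrix.dotProduct_mulVec, hfl, smul_dotProduct, smul_eq_mul, smul_eq_mul]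
      ring
    rw [Pi.smul_apply, smul_eq_mul, ← h2, h1, Matrix.mulVec, dotProduct]
    refine Finset.sum_congr rfl fun m' _ => ?_
    congr 1
    rw [Matrix.mul_apply]
    refine Finset.sum_congr rfl fun m _ => ?_
    rw [← D.β_mul _ (hν m)]; rfl
  rw [cmat, Matrix.charpoly_transpose, Polynomial.IsRoot, Matrix.eval_charpoly]
  refine Matrix.exists_mulVec_eq_zero_iff.mp ⟨z, hz0, ?_⟩
  rw [Matrix.sub_mulVec, hTz]
  simp [Matrix.scalar_apply, ← Matrix.smul_one_eq_diagonal, Matrix.smul_mulVec]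
end field
end PreData
end UEG

namespace UEG

section ultra
open Filter

/-- The power of an absolute value with exponent in `(0,1]`. -/
noncomputable def absPow {Ω : Type*} [Field Ω] (A : AbsoluteValue Ω ℝ) (t : ℝ) (h0 : 0 < t)
    (h1 : t ≤ 1) : AbsoluteValue Ω ℝ where
  toFun x := A x ^ t
  map_mul' x y := by
    rw [map_mul, Real.mul_rpow (A.nonneg _) (A.nonneg _)]
  nonneg' x := Real.rpow_nonneg (A.nonneg _) _
  eq_zero' x := by
    rw [Real.rpow_eq_zero (A.nonneg _) h0.ne', A.eq_zero]
  add_le' x y := by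
    refine (Real.rpow_le_rpow (A.nonneg _) (A.add_le x y) h0.le).trans ?_
    exact Real.rpow_add_le_add_rpow (A.nonneg _) (A.nonneg _) h0.le h1

theorem absPow_apply {Ω : Type*} [Field Ω] (A : AbsoluteValue Ω ℝ) (t : ℝ) (h0 : 0 < t)
    (h1 : t ≤ 1) (x : Ω) : absPow A t h0 h1 x = A x ^ t := rfl

variable {Ω : Type*} [Field Ω]

theorem germ_algClosed [IsAlgClosed Ω] (𝒰 : Ultrafilter ℕ) :
    IsAlgClosed (Germ (𝒰 : Filter ℕ) Ω) := by
  refine IsAlgClosed.of_exists_root _ fun p hp hirr => ?_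
  have hsurj : Function.Surjective (Germ.coeRingHom (R := Ω) (𝒰 : Filter ℕ)) := by
    intro z
    induction z using Germ.inductionOn with
    | _ f => exact ⟨f, rfl⟩
  have hl : p ∈ Polynomial.lifts (Germ.coeRingHom (R := Ω) (𝒰 : Filter ℕ)) := by
    rw [Polynomial.lifts_iff_coeff_lifts]
    intro n
    exact hsurj _
  obtain ⟨q, hq, hqd, hqm⟩ := Polynomial.lifts_and_natDegree_eq_and_monic hl hp
  have hroot : ∀ k : ℕ, ∃ x : Ω, (q.map (Pi.evalRingHom (fun _ : ℕ => Ω) k)).IsRoot x := by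
    intro k
    refine IsAlgClosed.exists_root _ ?_
    have h1 : (q.map (Pi.evalRingHom (fun _ : ℕ => Ω) k)).natDegree = p.natDegree := by
      rw [hqm.natDegree_map, hqd]
    intro h2
    have h3 := hirr.natDegree_pos
    rw [← h1, Polynomial.natDegree_eq_of_degree_eq_some (n := 0) h2] at h3
    exact lt_irrefl _ h3
  choose x hx using hroot
  refine ⟨(Germ.coeRingHom (𝒰 : Filter ℕ) x), ?_⟩
  rw [← hq, Polynomial.eval_map, Polynomial.eval₂_hom]
  have : q.eval x = 0 := by
    funext k
    have := hx k
    rw [Polynomial.IsRoot.def, Polynomial.eval_map] at this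
    have h2 := Polynomial.hom_eval₂ q (RingHom.id _) (Pi.evalRingHom (fun _ : ℕ => Ω) k) x
    rw [RingHom.comp_id] at h2
    exact h2.trans this
  rw [this, map_zero]

/-- Boundedness of germs. -/
def GBdd (A : ℕ → AbsoluteValue Ω ℝ) (𝒰 : Ultrafilter ℕ) (z : Germ (𝒰 : Filter ℕ) Ω) : Prop :=
  ∃ C : ℝ, ∃ x : ℕ → Ω, (x : Germ (𝒰 : Filter ℕ) Ω) = z ∧ ∀ᶠ k in (𝒰 : Filter ℕ), A k (x k) ≤ C

variable (A : ℕ → AbsoluteValue Ω ℝ) (𝒰 : Ultrafilter ℕ)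

theorem gbdd_coe (x : ℕ → Ω) : GBdd A 𝒰 (x : Germ (𝒰 : Filter ℕ) Ω) ↔
    ∃ C : ℝ, ∀ᶠ k in (𝒰 : Filter ℕ), A k (x k) ≤ C := by
  constructor
  · rintro ⟨C, y, hy, hC⟩
    refine ⟨C, ?_⟩
    filter_upwards [hC, Germ.coe_eq.1 hy] with k h1 h2
    rwa [← h2]
  · rintro ⟨C, hC⟩
    exact ⟨C, x, rfl, hC⟩

/-- The valuation ring of bounded germs. -/
def bddRing : ValuationSubring (Germ (𝒰 : Filter ℕ) Ω) where
  carrier := {z | GBdd A 𝒰 z}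
  mul_mem' := by
    rintro _ _ ⟨C, x, rfl, hC⟩ ⟨D, y, rfl, hD⟩
    refine ⟨C * D, x * y, rfl, ?_⟩
    filter_upwards [hC, hD] with k h1 h2
    rw [Pi.mul_apply, map_mul]
    exact mul_le_mul h1 h2 ((A k).nonneg _) (((A k).nonneg _).trans h1)
  one_mem' := ⟨1, 1, rfl, by simp⟩
  add_mem' := by
    rintro _ _ ⟨C, x, rfl, hC⟩ ⟨D, y, rfl, hD⟩
    refine ⟨C + D, x + y, rfl, ?_⟩
    filter_upwards [hC, hD] with k h1 h2
    exact ((A k).add_le _ _).trans (add_le_add h1 h2)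
  zero_mem' := ⟨0, 0, rfl, by simp⟩
  neg_mem' := by
    rintro _ ⟨C, x, rfl, hC⟩
    refine ⟨C, -x, rfl, ?_⟩
    filter_upwards [hC] with k h1
    simpa using h1
  mem_or_inv_mem' := by
    intro z
    induction z using Germ.inductionOn with
    | _ x =>
      rcases 𝒰.em (fun k => A k (x k) ≤ 1) with h | h
      · exact Or.inl ⟨1, x, rfl, h⟩
      · refine Or.inr ⟨1, x⁻¹, rfl, ?_⟩
        filter_upwards [h] with k hk
        push Not at hk
        rw [Pi.inv_apply, map_inv₀]
        exact inv_le_one_of_one_le₀ hk.le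

theorem algClosed_aux {E : Type*} [Field E] [IsAlgClosed E] (F0 : Subfield E) :
    IsAlgClosed (algebraicClosure F0 E) := by
  have h := algebraicClosure.isAlgClosure F0 E
  exact h.isAlgClosed

theorem ultra_field [IsAlgClosed Ω] (Rs : Subring (ℕ → Ω))
    (hb : ∀ y ∈ Rs, ∃ C : ℝ, ∀ᶠ k in (𝒰 : Filter ℕ), A k (y k) ≤ C)
    (hl : ∀ y ∈ Rs, (∀ᶠ k in (𝒰 : Filter ℕ), y k ≠ 0) →
      ∃ C : ℝ, ∀ᶠ k in (𝒰 : Filter ℕ), 1 ≤ C * A k (y k)) :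
    ∃ F : Subfield (Germ (𝒰 : Filter ℕ) Ω), IsAlgClosed F ∧
      (∀ y ∈ Rs, (y : Germ (𝒰 : Filter ℕ) Ω) ∈ F) ∧
      (∀ p : Polynomial F, p ≠ 0 → ∀ z, (p.map F.subtype).IsRoot z → z ∈ F) ∧
      ∃ B : AbsoluteValue F ℝ, ∀ (x : ℕ → Ω) (h : (x : Germ (𝒰 : Filter ℕ) Ω) ∈ F),
        Tendsto (fun k => A k (x k)) (𝒰 : Filter ℕ) (nhds (B ⟨x, h⟩)) := by
  haveI := germ_algClosed (Ω := Ω) 𝒰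
  set R0 : Subring (Germ (𝒰 : Filter ℕ) Ω) := Rs.map (Germ.coeRingHom (𝒰 : Filter ℕ)) with hR0
  set F0 : Subfield (Germ (𝒰 : Filter ℕ) Ω) := Subfield.closure R0 with hF0
  have h0 : ∀ z ∈ F0, z ∈ bddRing A 𝒰 := by
    intro z hz
    rw [hF0, Subfield.mem_closure_iff] at hz
    obtain ⟨y, hy, w, hw, rfl⟩ := hz
    rw [Subring.closure_eq] at hy hw
    obtain ⟨y, hy, rfl⟩ := hy
    obtain ⟨w, hw, rfl⟩ := hw
    rw [div_eq_mul_inv]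
    refine ValuationSubring.mul_mem _ _ _ ?_ ?_
    · exact (gbdd_coe A 𝒰 y).2 (hb y hy)
    · rcases 𝒰.em (fun k => w k = 0) with h | h
      · have : Germ.coeRingHom (𝒰 : Filter ℕ) w = 0 := Germ.coe_eq.2 h
        rw [this, _root_.inv_zero]
        exact ValuationSubring.zero_mem _
      · obtain ⟨C, hC⟩ := hl w hw h
        refine ⟨C, w⁻¹, rfl, ?_⟩
        filter_upwards [hC, h] with k h1 h2
        rw [Pi.inv_apply, map_inv₀]
        have : 0 < A k (w k) := (A k).pos h2
        rw [inv_le_iff_one_le_mul₀ this]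
        exact h1
  set F : Subfield (Germ (𝒰 : Filter ℕ) Ω) := (algebraicClosure F0 (Germ (𝒰 : Filter ℕ) Ω)).toSubfield with hF
  have halg : IsAlgClosed F := by
    exact algClosed_aux F0
  have h1 : ∀ z ∈ F, z ∈ bddRing A 𝒰 := by
    intro z hz
    have hz' : IsIntegral F0 z := hz
    have : IsIntegral (bddRing A 𝒰) z := by
      obtain ⟨p, hp, hpz⟩ := hz'
      let i : F0 →+* bddRing A 𝒰 := F0.subtype.codRestrict (bddRing A 𝒰) (fun x => h0 _ x.2)
      refine ⟨p.map i, hp.map _, ?_⟩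
      rw [Polynomial.eval₂_map]
      exact hpz
    obtain ⟨y, hy⟩ := (IsIntegrallyClosed.isIntegral_iff (R := bddRing A 𝒰)).1 this
    rw [← hy]
    exact y.2
  refine ⟨F, halg, ?_, ?_, ?_⟩
  · intro y hy
    have : (y : Germ (𝒰 : Filter ℕ) Ω) ∈ F0 := Subfield.subset_closure ⟨y, hy, rfl⟩
    exact (algebraicClosure F0 (Germ (𝒰 : Filter ℕ) Ω)).algebraMap_mem ⟨_, this⟩
  · intro p hp z hz
    have hs := IsAlgClosed.splits p
    have h2 : z ∈ (p.map F.subtype).roots :=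
      (Polynomial.mem_roots (by simpa using hp)).2 hz
    rw [hs.roots_map] at h2
    obtain ⟨a, -, rfl⟩ := Multiset.mem_map.1 h2
    exact a.2
  · have hlim : ∀ z : F, ∃ b : ℝ, ∀ x : ℕ → Ω, (x : Germ (𝒰 : Filter ℕ) Ω) = z →
        Tendsto (fun k => A k (x k)) (𝒰 : Filter ℕ) (nhds b) := by
      rintro ⟨z, hz⟩
      obtain ⟨C, x, rfl, hC⟩ := h1 z hz
      have h2 : ((𝒰.map (fun k => A k (x k)) : Ultrafilter ℝ) : Filter ℝ) ≤ Filter.principal (Set.Icc 0 C) := by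
        rw [Filter.le_principal_iff]
        change ∀ᶠ k in (𝒰 : Filter ℕ), A k (x k) ∈ Set.Icc 0 C
        filter_upwards [hC] with k hk
        exact ⟨(A k).nonneg _, hk⟩
      obtain ⟨b, -, hb⟩ := isCompact_Icc.ultrafilter_le_nhds _ h2
      refine ⟨b, fun y hy => ?_⟩
      have h3 : Tendsto (fun k => A k (x k)) (𝒰 : Filter ℕ) (nhds b) := hb
      refine h3.congr' ?_
      filter_upwards [Germ.coe_eq.1 hy] with k hk
      rw [hk]
    choose b hb using hlim
    have hrep : ∀ z : F, ∃ x : ℕ → Ω, (x : Germ (𝒰 : Filter ℕ) Ω) = z := by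
      rintro ⟨z, hz⟩
      induction z using Germ.inductionOn with
      | _ x => exact ⟨x, rfl⟩
    have hmul : ∀ z w, b (z * w) = b z * b w := by
      intro z w
      obtain ⟨x, hx⟩ := hrep z
      obtain ⟨y, hy⟩ := hrep w
      have h3 : ((x * y : ℕ → Ω) : Germ (𝒰 : Filter ℕ) Ω) = (z * w : F) := by
        rw [Germ.coe_mul, hx, hy]; rfl
      refine tendsto_nhds_unique (hb _ _ h3) ?_
      simpa using (hb _ _ hx).mul (hb _ _ hy)
    have h01 : b 1 = 1 :=
      tendsto_nhds_unique (hb 1 1 rfl) (by simp)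
    have h00 : b 0 = 0 :=
      tendsto_nhds_unique (hb 0 0 rfl) (by simp)
    let B : AbsoluteValue F ℝ :=
      { toFun := b
        map_mul' := hmul
        nonneg' := fun z => by
          obtain ⟨x, hx⟩ := hrep z
          exact ge_of_tendsto' (hb _ _ hx) (fun k => (A k).nonneg _)
        eq_zero' := fun z => by
          constructor
          · intro h
            by_contra hz
            have := hmul z z⁻¹
            rw [mul_inv_cancel₀ hz, h, zero_mul, h01] at this
            exact one_ne_zero this
          · rintro rfl
            exact h00
        add_le' := fun z w => by
          obtain ⟨x, hx⟩ := hrep z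
          obtain ⟨y, hy⟩ := hrep w
          have h3 : ((x + y : ℕ → Ω) : Germ (𝒰 : Filter ℕ) Ω) = (z + w : F) := by
            rw [Germ.coe_add, hx, hy]; rfl
          exact le_of_tendsto_of_tendsto' (hb _ _ h3) ((hb _ _ hx).add (hb _ _ hy))
            (fun k => (A k).add_le _ _) }
    exact ⟨B, fun x h => hb _ _ rfl⟩

end ultra
end UEG

namespace UEG

section rep
open Filter

/-- The group of sequences with uniformly bounded word length. -/
def star {G : Type*} [Group G] (S : ℕ → Finset G) (hS : ∀ k, GS (S k)) : Subgroup (ℕ → G) where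
  carrier := {γ | ∃ m, ∀ k, γ k ∈ (S k : Set G) ^ m}
  mul_mem' := by
    rintro a b ⟨m, hm⟩ ⟨m', hm'⟩
    refine ⟨m + m', fun k => ?_⟩
    rw [pow_add]
    exact Set.mul_mem_mul (hm k) (hm' k)
  one_mem' := ⟨0, fun k => by simp⟩
  inv_mem' := by
    rintro a ⟨m, hm⟩
    refine ⟨m, fun k => ?_⟩
    have h1 : (S k : Set G)⁻¹ = (S k : Set G) := by
      ext y
      rw [Set.mem_inv]
      constructor
      · intro h
        have := (hS k).2.1 _ h
        rwa [inv_inv] at this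
      · intro h
        exact (hS k).2.1 _ h
    rw [← h1, inv_pow]
    exact Set.inv_mem_inv.2 (hm k)

theorem mem_star {G : Type*} [Group G] {S : ℕ → Finset G} {hS : ∀ k, GS (S k)} {γ : ℕ → G} :
    γ ∈ star S hS ↔ ∃ m, ∀ k, γ k ∈ (S k : Set G) ^ m := Iff.rfl

variable {Ω : Type*} [Field Ω] {𝒰 : Ultrafilter ℕ} {F : Subfield (Germ (𝒰 : Filter ℕ) Ω)}

/-- A sequence representing an element of a subfield of the ultrapower. -/
def Rep (F : Subfield (Germ (𝒰 : Filter ℕ) Ω)) (x : ℕ → Ω) (z : F) : Prop :=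
  (x : Germ (𝒰 : Filter ℕ) Ω) = z

theorem Rep.exists (z : F) : ∃ x, Rep F x z := by
  obtain ⟨z, hz⟩ := z
  induction z using Germ.inductionOn with
  | _ x => exact ⟨x, rfl⟩

theorem Rep.add {x y : ℕ → Ω} {z w : F} (h : Rep F x z) (h' : Rep F y w) :
    Rep F (fun k => x k + y k) (z + w) := by
  change ((x + y : ℕ → Ω) : Germ (𝒰 : Filter ℕ) Ω) = _
  rw [Germ.coe_add, h, h']; rfl
theorem Rep.mul {x y : ℕ → Ω} {z w : F} (h : Rep F x z) (h' : Rep F y w) :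
    Rep F (fun k => x k * y k) (z * w) := by
  change ((x * y : ℕ → Ω) : Germ (𝒰 : Filter ℕ) Ω) = _
  rw [Germ.coe_mul, h, h']; rfl
theorem Rep.sub {x y : ℕ → Ω} {z w : F} (h : Rep F x z) (h' : Rep F y w) :
    Rep F (fun k => x k - y k) (z - w) := by
  change ((x - y : ℕ → Ω) : Germ (𝒰 : Filter ℕ) Ω) = _
  rw [Germ.coe_sub, h, h']; rfl
theorem Rep.inv {x : ℕ → Ω} {z : F} (h : Rep F x z) :
    Rep F (fun k => (x k)⁻¹) (z⁻¹) := by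
  change ((x⁻¹ : ℕ → Ω) : Germ (𝒰 : Filter ℕ) Ω) = _
  rw [Germ.coe_inv, h]; rfl
theorem Rep.div {x y : ℕ → Ω} {z w : F} (h : Rep F x z) (h' : Rep F y w) :
    Rep F (fun k => x k / y k) (z / w) := by
  simp only [div_eq_mul_inv]
  exact h.mul h'.inv
theorem Rep.one : Rep F (fun _ => 1) 1 := rfl
theorem Rep.zero : Rep F (fun _ => 0) 0 := rfl
theorem Rep.pow {x : ℕ → Ω} {z : F} (h : Rep F x z) (N : ℕ) :
    Rep F (fun k => x k ^ N) (z ^ N) := by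
  induction N with
  | zero => simpa using Rep.one
  | succ N ih => simpa only [pow_succ] using ih.mul h
theorem Rep.sum {ι : Type*} (s : Finset ι) {x : ι → ℕ → Ω} {z : ι → F} (h : ∀ i, Rep F (x i) (z i)) :
    Rep F (fun k => ∑ i ∈ s, x i k) (∑ i ∈ s, z i) := by
  classical
  induction s using Finset.induction_on with
  | empty => simpa using Rep.zero
  | insert a s ha ih => simpa only [Finset.sum_insert ha] using (h a).add ih
theorem Rep.eq_iff {x y : ℕ → Ω} {z w : F} (h : Rep F x z) (h' : Rep F y w) :
    z = w ↔ ∀ᶠ k in (𝒰 : Filter ℕ), x k = y k := by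
  rw [Subtype.ext_iff, ← h, ← h']
  exact Germ.coe_eq
theorem Rep.ne_iff {x y : ℕ → Ω} {z w : F} (h : Rep F x z) (h' : Rep F y w) :
    z ≠ w ↔ ∀ᶠ k in (𝒰 : Filter ℕ), x k ≠ y k := by
  rw [ne_eq, h.eq_iff h', ← Ultrafilter.eventually_not]

variable {ι : Type*} [Fintype ι] [DecidableEq ι]

theorem Rep.mat_aux {M : ℕ → Matrix ι ι Ω} {Z : Matrix ι ι F}
    (h : ∀ i j, Rep F (fun k => M k i j) (Z i j)) :
    (Matrix.of fun i j => (fun k => M k i j) : Matrix ι ι (ℕ → Ω)).map (Germ.coeRingHom (𝒰 : Filter ℕ))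
      = Z.map F.subtype := by
  ext i j
  exact h i j

theorem Rep.det {M : ℕ → Matrix ι ι Ω} {Z : Matrix ι ι F}
    (h : ∀ i j, Rep F (fun k => M k i j) (Z i j)) : Rep F (fun k => (M k).det) Z.det := by
  set N : Matrix ι ι (ℕ → Ω) := Matrix.of fun i j => (fun k => M k i j) with hN
  have h1 : (fun k => (M k).det) = N.det := by
    funext k
    have := (Pi.evalRingHom (fun _ : ℕ => Ω) k).map_det N
    exact this.symm
  have h2 := (Germ.coeRingHom (R := Ω) (𝒰 : Filter ℕ)).map_det N
  have h3 := F.subtype.map_det Z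
  have h4 : (Germ.coeRingHom (R := Ω) (𝒰 : Filter ℕ)).mapMatrix N = F.subtype.mapMatrix Z :=
    Rep.mat_aux h
  rw [h4, ← h3] at h2
  rw [h1]
  exact h2

theorem Rep.adj {M : ℕ → Matrix ι ι Ω} {Z : Matrix ι ι F}
    (h : ∀ i j, Rep F (fun k => M k i j) (Z i j)) (i j : ι) :
    Rep F (fun k => (M k).adjugate i j) (Z.adjugate i j) := by
  simp only [Matrix.adjugate_apply]
  refine Rep.det (M := fun k => (M k).updateRow j (Pi.single i 1)) fun a b => ?_
  simp only [Matrix.updateRow_apply]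
  split_ifs with hab
  · by_cases hb : b = i
    · subst hb; simpa using Rep.one
    · simpa [Pi.single_apply, hb] using Rep.zero
  · exact h a b

theorem Rep.matinv {M : ℕ → Matrix ι ι Ω} {Z : Matrix ι ι F}
    (h : ∀ i j, Rep F (fun k => M k i j) (Z i j)) (i j : ι) :
    Rep F (fun k => (M k)⁻¹ i j) (Z⁻¹ i j) := by
  simp only [Matrix.inv_def, Matrix.smul_apply, Ring.inverse_eq_inv', smul_eq_mul]
  exact (Rep.det h).inv.mul (Rep.adj h i j)

theorem Rep.matmul {M M' : ℕ → Matrix ι ι Ω} {Z Z' : Matrix ι ι F}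
    (h : ∀ i j, Rep F (fun k => M k i j) (Z i j)) (h' : ∀ i j, Rep F (fun k => M' k i j) (Z' i j))
    (i j : ι) :
    Rep F (fun k => (M k * M' k) i j) ((Z * Z') i j) := by
  simp only [Matrix.mul_apply]
  exact Rep.sum _ fun l => (h i l).mul (h' l j)

end rep
end UEG

namespace UEG

section p6b
open Filter

theorem star_pow_mem {G : Type*} [Group G] {S : ℕ → Finset G} {hS : ∀ k, GS (S k)}
    (γ : star S hS) : ∃ m, ∀ m', m ≤ m' → ∀ k, γ.1 k ∈ (S k : Set G) ^ m' := by
  obtain ⟨m, hm⟩ := mem_star.1 γ.2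
  refine ⟨m, fun m' h k => ?_⟩
  exact Set.pow_subset_pow_right (Finset.mem_coe.2 (hS k).1) h (hm k)

theorem lim_aux {F G : Type*} [Field F] [Group G] (Bv : AbsoluteValue F ℝ) (Φ : G → F) (g : G)
    (Λ : F)
    (hlim : ∀ x y, Tendsto (fun N : ℕ => Bv (Φ (x * g ^ N * y) / Λ ^ N - Φ x * Φ y)) atTop (nhds 0))
    {u : ℕ} (X : G) (Y : Fin u → G) (W : Fin u → F) :
    Tendsto (fun N : ℕ => Bv ((∑ m, Φ (X * g ^ N * Y m) * W m) / Λ ^ N - Φ X * ∑ m, Φ (Y m) * W m))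
      atTop (nhds 0) := by
  have h1 : Tendsto (fun N : ℕ => ∑ m, Bv (Φ (X * g ^ N * Y m) / Λ ^ N - Φ X * Φ (Y m)) * Bv (W m))
      atTop (nhds 0) := by
    have := tendsto_finsetSum (Finset.univ : Finset (Fin u))
      (fun m _ => (hlim X (Y m)).mul_const (Bv (W m)))
    simpa using this
  refine squeeze_zero (fun N => Bv.nonneg _) (fun N => ?_) h1
  have h2 : (∑ m, Φ (X * g ^ N * Y m) * W m) / Λ ^ N - Φ X * ∑ m, Φ (Y m) * W m
      = ∑ m, (Φ (X * g ^ N * Y m) / Λ ^ N - Φ X * Φ (Y m)) * W m := by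
    rw [Finset.sum_div, Finset.mul_sum, ← Finset.sum_sub_distrib]
    refine Finset.sum_congr rfl fun m _ => ?_
    ring
  rw [h2]
  refine (Bv.sum_le _ _).trans (Finset.sum_le_sum fun m _ => ?_)
  rw [map_mul]

theorem p6b {G : Type*} [Group G] (S : ℕ → Finset G) (hS : ∀ k, GS (S k)) (𝒰 : Ultrafilter ℕ)
    {Ω : Type*} [Field Ω] (A : ℕ → AbsoluteValue Ω ℝ) (F : Subfield (Germ (𝒰 : Filter ℕ) Ω))
    (Bv : AbsoluteValue F ℝ)
    (hB : ∀ x z, Rep F x z → Tendsto (fun k => A k (x k)) (𝒰 : Filter ℕ) (nhds (Bv z)))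
    {n : ℕ} (ρ : G →* Matrix (Fin n) (Fin n) Ω) (m1 : ℕ) (Φk : ℕ → G → Ω)
    (hΦk : ∀ k, Φk k ∈ L1 ρ ^ m1) (Φ : star S hS → F)
    (hΦ : ∀ γ, Rep F (fun k => Φk k (γ.1 k)) (Φ γ)) (g : star S hS) (Λ : F) (hΛ : Λ ≠ 0)
    (hΦ1 : Φ 1 = 1)
    (hlim : ∀ x y, Tendsto (fun N : ℕ => Bv (Φ (x * g ^ N * y) / Λ ^ N - Φ x * Φ y)) atTop (nhds 0))
    (h : star S hS) (hh : Φ h ≠ 0) (x0 : star S hS) (hx0 : Φ (x0 * h) ≠ Φ h * Φ x0)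
    (u : ℕ) (x γ : Fin u → star S hS)
    (hdet : (Matrix.of fun l m => Φ (x l * γ m)).det ≠ 0)
    (hrelF : ∀ z y, Φ (z * y) =
      ∑ l, (∑ m, Φ (z * γ m) * (Matrix.of fun l m => Φ (x l * γ m))⁻¹ m l) * Φ (x l * y)) :
    ∃ m, ∀ᶠ k in (𝒰 : Filter ℕ), Cfg (S k) m := by
  classical
  obtain ⟨lam, hlam⟩ := Rep.exists Λ
  set V : Matrix (Fin u) (Fin u) F := Matrix.of fun l m => Φ (x l * γ m) with hV
  set Vk : ℕ → Matrix (Fin u) (Fin u) Ω :=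
    fun k => Matrix.of fun l m => Φk k ((x l).1 k * (γ m).1 k) with hVk
  have hVrep : ∀ l m, Rep F (fun k => Vk k l m) (V l m) := fun l m => hΦ (x l * γ m)
  have hW : ∀ m l, Rep F (fun k => (Vk k)⁻¹ m l) (V⁻¹ m l) := Rep.matinv hVrep
  set bk : ℕ → G → Fin u → Ω := fun k z l => ∑ m, Φk k (z * (γ m).1 k) * (Vk k)⁻¹ m l with hbk
  set b : star S hS → Fin u → F := fun z l => ∑ m, Φ (z * γ m) * V⁻¹ m l with hb
  have hbrep : ∀ z l, Rep F (fun k => bk k (z.1 k) l) (b z l) := fun z l =>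
    Rep.sum _ fun m => (hΦ (z * γ m)).mul (hW m l)
  have hrel : ∀ᶠ k in (𝒰 : Filter ℕ), ∀ z y, Φk k (z * y) = ∑ l, bk k z l * Φk k ((x l).1 k * y) := by
    by_contra hcon
    rw [← Ultrafilter.eventually_not] at hcon
    obtain ⟨L, hL⟩ := escape ρ m1
    have hex : ∀ k, ∃ z y : G, z ∈ (S k : Set G) ^ L ∧ y ∈ (S k : Set G) ^ L ∧
        ((¬ ∀ z y, Φk k (z * y) = ∑ l, bk k z l * Φk k ((x l).1 k * y)) →
          Φk k (z * y) ≠ ∑ l, bk k z l * Φk k ((x l).1 k * y)) := by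
      intro k
      by_cases hk : ∀ z y, Φk k (z * y) = ∑ l, bk k z l * Φk k ((x l).1 k * y)
      · have h1 : (1 : G) ∈ (S k : Set G) ^ L := Set.one_mem_pow (Finset.mem_coe.2 (hS k).1)
        exact ⟨1, 1, h1, h1, fun h => absurd hk h⟩
      · push Not at hk
        obtain ⟨z, y, hzy⟩ := hk
        have hf1 : (fun y => Φk k (z * y) - ∑ l, bk k z l * Φk k ((x l).1 k * y)) ∈ L1 ρ ^ m1 := by
          refine L1_sub ρ (ltr_mem ρ (hΦk k) z) (L1_sum ρ _ fun l _ => L1_cmul ρ _ ?_)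
          exact ltr_mem ρ (hΦk k) _
        have : ∃ y' ∈ (S k : Set G) ^ L, Φk k (z * y') - ∑ l, bk k z l * Φk k ((x l).1 k * y') ≠ 0 := by
          by_contra hno
          push Not at hno
          have := congrFun (hL (S k) (hS k) _ hf1 hno) y
          exact hzy (sub_eq_zero.1 this)
        obtain ⟨y', hy', hne⟩ := this
        have hf2 : (fun z => Φk k (z * y') - ∑ l, bk k z l * Φk k ((x l).1 k * y')) ∈ L1 ρ ^ m1 := by
          refine L1_sub ρ (rtr_mem ρ (hΦk k) y') (L1_sum ρ _ fun l _ => L1_mulc ρ _ ?_)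
          refine L1_sum ρ _ fun m _ => L1_mulc ρ _ ?_
          exact rtr_mem ρ (hΦk k) _
        have : ∃ z' ∈ (S k : Set G) ^ L, Φk k (z' * y') - ∑ l, bk k z' l * Φk k ((x l).1 k * y') ≠ 0 := by
          by_contra hno
          push Not at hno
          exact hne (congrFun (hL (S k) (hS k) _ hf2 hno) z)
        obtain ⟨z', hz', hne'⟩ := this
        exact ⟨z', y', hz', hy', fun _ => sub_ne_zero.1 hne'⟩
    choose z y hz hy hzy using hex
    let zs : star S hS := ⟨z, L, hz⟩
    let ys : star S hS := ⟨y, L, hy⟩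
    have h1 := hrelF zs ys
    have h2 : Rep F (fun k => ∑ l, bk k (z k) l * Φk k ((x l).1 k * y k)) (∑ l, b zs l * Φ (x l * ys)) :=
      Rep.sum _ fun l => (hbrep zs l).mul (hΦ (x l * ys))
    have h3 := ((hΦ (zs * ys)).eq_iff h2).1 h1
    obtain ⟨k, hk1, hk2⟩ := (h3.and hcon).exists
    exact hzy k hk2 hk1
  -- constants in `F`
  set e : Fin u → F := fun l => Φ (x l) with he
  set e' : Fin u → F := fun l => Φ (x l * h) with he'
  have hl0 : ∃ l, e' l - Φ h * e l ≠ 0 := by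
    by_contra hno
    push Not at hno
    apply hx0
    have h1 := hrelF x0 h
    have h2 := hrelF x0 1
    simp only [mul_one] at h2
    rw [h1, h2, Finset.mul_sum]
    refine Finset.sum_congr rfl fun l _ => ?_
    have : Φ (x l * h) = Φ h * Φ (x l) := sub_eq_zero.1 (hno l)
    rw [this]; ring
  obtain ⟨l0, hl0⟩ := hl0
  have hp1 : 0 < Bv (Φ h) := Bv.pos hh
  have hp2 : 0 < Bv (e' l0 - Φ h * e l0) := Bv.pos hl0
  have hs1 : ∀ f : Fin u → F, 0 ≤ ∑ l, Bv (f l) := fun f => Finset.sum_nonneg fun l _ => Bv.nonneg _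
  have hs2 : ∀ (f : Fin u → F) l, Bv (f l) ≤ ∑ l, Bv (f l) := fun f l =>
    Finset.single_le_sum (f := fun l => Bv (f l)) (fun l _ => Bv.nonneg _) (Finset.mem_univ l)
  obtain ⟨K, hK⟩ : ∃ K : ℝ, K = 2 + ∑ l, Bv (e l) + ∑ l, Bv (e' l) + ∑ l, Bv (b 1 l) + Bv (Φ h) +
    2 / Bv (Φ h) + 2 / Bv (e' l0 - Φ h * e l0) := ⟨_, rfl⟩
  have hq1 : 0 < 2 / Bv (Φ h) := by positivity
  have hq2 : 0 < 2 / Bv (e' l0 - Φ h * e l0) := by positivity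
  have hK1 : 1 ≤ K := by linarith [hs1 e, hs1 e', hs1 (b 1)]
  have hKe : ∀ l, Bv (e l) < K := fun l => by linarith [hs1 e, hs1 e', hs1 (b 1), hs2 e l]
  have hKe' : ∀ l, Bv (e' l) < K := fun l => by linarith [hs1 e, hs1 e', hs1 (b 1), hs2 e' l]
  have hKb : ∀ l, Bv (b 1 l) < K := fun l => by linarith [hs1 e, hs1 e', hs1 (b 1), hs2 (b 1) l]
  have hKφ : Bv (Φ h) < K := by linarith [hs1 e, hs1 e', hs1 (b 1)]
  have hKφ' : 1 < K * Bv (Φ h) := by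
    have : 2 / Bv (Φ h) < K := by linarith [hs1 e, hs1 e', hs1 (b 1)]
    rw [div_lt_iff₀ hp1] at this
    linarith
  have hKl : 1 < K * Bv (e' l0 - Φ h * e l0) := by
    have : 2 / Bv (e' l0 - Φ h * e l0) < K := by linarith [hs1 e, hs1 e', hs1 (b 1)]
    rw [div_lt_iff₀ hp2] at this
    linarith
  obtain ⟨ε, hε⟩ : ∃ ε : ℝ, ε = 1 / (48 * (u : ℝ) ^ 2 * K ^ 5 + 1) := ⟨_, rfl⟩
  have hden : 0 ≤ 48 * (u : ℝ) ^ 2 * K ^ 5 := by positivity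
  have hε0 : 0 < ε := by rw [hε]; positivity
  have hε1 : 48 * (u : ℝ) ^ 2 * K ^ 5 * ε ≤ 1 := by
    rw [hε, mul_one_div, div_le_one (by positivity)]
    linarith
  -- choose N
  have hNa : ∀ᶠ N : ℕ in atTop, ∀ l l', Bv (b (x l * g ^ N) l' / Λ ^ N - e l * b 1 l') < ε := by
    rw [eventually_all]; intro l
    rw [eventually_all]; intro l'
    have := lim_aux Bv Φ g Λ hlim (x l) γ (fun m => V⁻¹ m l')
    simpa [hb, he] using this.eventually_lt_const hε0
  have hNb : ∀ᶠ N : ℕ in atTop, ∀ l l', Bv (b (x l * (h * g ^ N)) l' / Λ ^ N - e' l * b 1 l') < ε := by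
    rw [eventually_all]; intro l
    rw [eventually_all]; intro l'
    have := lim_aux Bv Φ g Λ hlim (x l * h) γ (fun m => V⁻¹ m l')
    simpa [hb, he', mul_assoc] using this.eventually_lt_const hε0
  have hNc : ∀ᶠ N : ℕ in atTop, ∀ i l l', Bv (b (x l * (g ^ N * x i)) l' / Λ ^ N -
      e l * (if i = l' then 1 else 0)) < ε := by
    rw [eventually_all]; intro i
    rw [eventually_all]; intro l
    rw [eventually_all]; intro l'
    have := lim_aux Bv Φ g Λ hlim (x l) (fun m => x i * γ m) (fun m => V⁻¹ m l')
    have h2 : ∑ m, Φ (x i * γ m) * V⁻¹ m l' = if i = l' then 1 else 0 := by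
      have h3 : V * V⁻¹ = 1 := Matrix.mul_nonsing_inv _ (isUnit_iff_ne_zero.2 hdet)
      have h4 := congrFun (congrFun h3 i) l'
      rw [Matrix.mul_apply, Matrix.one_apply] at h4
      exact h4
    rw [h2] at this
    simpa [hb, he, mul_assoc] using this.eventually_lt_const hε0
  obtain ⟨N, hNa, hNb, hNc⟩ := (hNa.and (hNb.and hNc)).exists
  -- choose m
  obtain ⟨ma, hma⟩ := star_pow_mem (g ^ N)
  obtain ⟨mb, hmb⟩ := star_pow_mem (h * g ^ N)
  choose mc hmc using fun i => star_pow_mem (g ^ N * x i)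
  obtain ⟨m, hm⟩ : ∃ m, m = u + ma + mb + ∑ i, mc i := ⟨_, rfl⟩
  have hmcm : ∀ i, mc i ≤ m := fun i => by
    have := Finset.single_le_sum (f := mc) (fun l _ => Nat.zero_le _) (Finset.mem_univ i)
    omega
  refine ⟨m, ?_⟩
  -- eventual facts
  have hev : ∀ (y : ℕ → Ω) (z : F), Rep F y z → ∀ C, Bv z < C → ∀ᶠ k in (𝒰 : Filter ℕ), A k (y k) < C :=
    fun y z hyz C hC => (hB y z hyz).eventually_lt_const hC
  have hev' : ∀ (y : ℕ → Ω) (z : F), Rep F y z → 1 < K * Bv z → ∀ᶠ k in (𝒰 : Filter ℕ), 1 < K * A k (y k) :=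
    fun y z hyz hC => ((hB y z hyz).const_mul K).eventually_const_lt hC
  have hre : ∀ l, Rep F (fun k => Φk k ((x l).1 k)) (e l) := fun l => hΦ (x l)
  have hre' : ∀ l, Rep F (fun k => Φk k ((x l).1 k * h.1 k)) (e' l) := fun l => hΦ (x l * h)
  have hrb : ∀ l, Rep F (fun k => bk k 1 l) (b 1 l) := fun l => hbrep 1 l
  have hite : ∀ i l' : Fin u, Rep F (fun _ => if i = l' then 1 else 0) (if i = l' then 1 else 0) := by
    intro i l'
    split_ifs
    · exact Rep.one
    · exact Rep.zero
  have E1 := eventually_all.2 fun l => hev _ _ (hre l) K (hKe l)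
  have E2 := eventually_all.2 fun l => hev _ _ (hre' l) K (hKe' l)
  have E3 := eventually_all.2 fun l => hev _ _ (hrb l) K (hKb l)
  have E4 := hev _ _ (hΦ h) K hKφ
  have E5 := hev' _ _ (hΦ h) hKφ'
  have E6 := hev' _ _ ((hre' l0).sub ((hΦ h).mul (hre l0))) hKl
  have E7 := eventually_all.2 fun l => eventually_all.2 fun l' =>
    hev _ _ (((hbrep (x l * g ^ N) l').div (hlam.pow N)).sub ((hre l).mul (hrb l'))) ε (hNa l l')
  have E8 := eventually_all.2 fun l => eventually_all.2 fun l' =>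
    hev _ _ (((hbrep (x l * (h * g ^ N)) l').div (hlam.pow N)).sub ((hre' l).mul (hrb l'))) ε (hNb l l')
  have E9 := eventually_all.2 fun i => eventually_all.2 fun l => eventually_all.2 fun l' =>
    hev _ _ (((hbrep (x l * (g ^ N * x i)) l').div (hlam.pow N)).sub ((hre l).mul (hite i l'))) ε (hNc i l l')
  have E10 := (hΦ 1).eq_iff Rep.one |>.1 hΦ1
  have E11 := (hlam.ne_iff Rep.zero).1 hΛ
  filter_upwards [hrel, E1, E2, E3, E4, E5, E6, E7, E8, E9, E10, E11] with k hrel E1 E2 E3 E4 E5 E6 E7 E8 E9 E10 E11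
  have E10' : Φk k 1 = 1 := E10
  have hlN : lam k ^ N ≠ 0 := pow_ne_zero _ E11
  have hact : ∀ (a y : G) (l : Fin u), Φk k ((x l).1 k * (a * y)) =
      lam k ^ N * ∑ l', bk k ((x l).1 k * a) l' / lam k ^ N * Φk k ((x l').1 k * y) := by
    intro a y l
    rw [← mul_assoc, hrel, Finset.mul_sum]
    refine Finset.sum_congr rfl fun l' _ => ?_
    field_simp
  refine pingpong (A k) (S k) m (by omega) (fun y l => Φk k ((x l).1 k * y)) ?_
    (fun l => Φk k ((x l).1 k)) (fun l => Φk k ((x l).1 k * h.1 k)) (fun l => bk k 1 l) (Φk k (h.1 k))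
    K hK1 (fun l => (E1 l).le) (fun l => (E2 l).le) (fun l => (E3 l).le) E4.le E5.le ?_ ?_ ⟨l0, E6.le⟩
    ε hε0.le hε1 ((g ^ N).1 k) ((h * g ^ N).1 k) (fun i => (g ^ N * x i).1 k)
    (hma m (by omega) k) (hmb m (by omega) k) (fun i => hmc i m (hmcm i) k)
    (lam k ^ N) hlN (Matrix.of fun l l' => bk k ((x l).1 k * (g ^ N).1 k) l' / lam k ^ N)
    (Matrix.of fun l l' => bk k ((x l).1 k * (h * g ^ N).1 k) l' / lam k ^ N)
    (fun i => Matrix.of fun l l' => bk k ((x l).1 k * (g ^ N * x i).1 k) l' / lam k ^ N)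
    (fun l l' => (E7 l l').le) (fun l l' => (E8 l l').le) (fun i l l' => (E9 i l l').le)
    (fun y l => hact _ y l) (fun y l => hact _ y l) (fun i y l => hact _ y l)
  · intro y hy
    have h1 := hrel y⁻¹ y
    rw [inv_mul_cancel, E10'] at h1
    have : ∀ l, Φk k ((x l).1 k * y) = 0 := fun l => congrFun hy l
    simp [this] at h1
  · have h1 := hrel 1 1
    simp only [mul_one] at h1
    rw [E10'] at h1
    exact h1.symm
  · have h1 := hrel 1 (h.1 k)
    simp only [one_mul] at h1
    exact h1.symm

end p6b
end UEG

namespace UEG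

section p6a
open Filter

/-- Arithmetic structure on a ring: finitely many embeddings in valued fields with a product-formula
type inequality and Northcott finiteness. -/
structure Arith (R : Type*) [CommRing R] where
  J : Type
  fin : Fintype J
  ne : Nonempty J
  Ω : J → Type
  fld : ∀ j, Field (Ω j)
  ac : ∀ j, IsAlgClosed (Ω j)
  A : ∀ j, AbsoluteValue (Ω j) ℝ
  σ : ∀ j, R →+* Ω j
  hN : ∀ C : ℝ, {x : R | ∀ j, A j (σ j x) ≤ C}.Finite
  M : ℕ
  hP : ∀ B : ℝ, 1 ≤ B → ∀ x : R, x ≠ 0 → (∀ j, A j (σ j x) ≤ B) → ∀ j, 1 ≤ B ^ M * A j (σ j x)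

attribute [instance] Arith.fin Arith.ne Arith.fld Arith.ac

theorem Arith.σ_inj {R : Type*} [CommRing R] (a : Arith R) (j : a.J) :
    Function.Injective (a.σ j) := by
  rw [injective_iff_map_eq_zero]
  intro x hx
  by_contra hne
  have h1 := a.hP (1 + ∑ i, a.A i (a.σ i x)) (by
    have : 0 ≤ ∑ i, a.A i (a.σ i x) := Finset.sum_nonneg fun i _ => (a.A i).nonneg _
    linarith) x hne (fun i => by
      have := Finset.single_le_sum (f := fun i => a.A i (a.σ i x)) (fun l _ => (a.A l).nonneg _)
        (Finset.mem_univ i)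
      linarith) j
  rw [hx, map_zero, mul_zero] at h1
  linarith

theorem star_escape {G : Type*} [Group G] (S : ℕ → Finset G) (hS : ∀ k, GS (S k)) {F : Type*}
    [Field F] {n : ℕ} (ρ : G →* Matrix (Fin n) (Fin n) F) {q : ℕ} {J' : Type} [Fintype J']
    (ν0 : J' → G) (hν0 : ∀ j, ν0 j ∈ Nq G q) (Ψ : (J' → G) → F)
    (hΨ : ∀ (I : Type) [DecidableEq I] (w : J' → FreeGroup I), ∃ m, ∀ i p,
      (fun x => Ψ (fun j => FreeGroup.lift (Function.update p i x) (w j))) ∈ L1 ρ ^ m)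
    (h0 : Ψ ν0 ≠ 0) :
    ∃ ν : J' → star S hS, (∀ j, ν j ∈ Nq (star S hS) q) ∧ ∀ k, Ψ (fun j => (ν j).1 k) ≠ 0 := by
  classical
  obtain ⟨I, hI, w, p0, hw, hp0⟩ := Nq_word_family hν0
  obtain ⟨m, hm⟩ := hΨ I w
  obtain ⟨L, hL⟩ := escape_multi ρ m
  have : ∀ k, ∃ p : I → G, (∀ i, p i ∈ (S k : Set G) ^ L) ∧
      Ψ (fun j => FreeGroup.lift p (w j)) ≠ 0 := fun k =>
    hL (S k) (hS k) I (fun p => Ψ (fun j => FreeGroup.lift p (w j))) hm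
      ⟨p0, by simpa only [hp0] using h0⟩
  choose p hp hpne using this
  let ps : I → star S hS := fun i => ⟨fun k => p k i, L, fun k => hp k i⟩
  refine ⟨fun j => FreeGroup.lift ps (w j), fun j => Nq_map _ q (hw j), fun k => ?_⟩
  have h1 : ∀ j, (FreeGroup.lift ps (w j)).1 k = FreeGroup.lift (p k) (w j) := by
    intro j
    have : ((Pi.evalMonoidHom (fun _ : ℕ => G) k).comp (star S hS).subtype).comp (FreeGroup.lift ps)
        = FreeGroup.lift (p k) := by
      ext i
      simp [ps]
    exact DFunLike.congr_fun this (w j)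
  simp only [h1]
  exact hpne k

theorem tau_word {G : Type*} [Group G] {q n w : ℕ} {F : Type*} [Field F] (D : PreData G q F n w)
    {I : Type} [DecidableEq I] (x : FreeGroup I) : ∃ m, ∀ i p,
      (fun y => D.τ (FreeGroup.lift (Function.update p i y) x)) ∈ L1 D.ρ ^ m := by
  obtain ⟨m, hm⟩ := word_mem D.ρ x
  refine ⟨m, fun i p => ?_⟩
  simp only [PreData.τ, PreData.β, Matrix.trace, Matrix.diag, Matrix.mul_apply]
  refine L1_sum _ _ fun a _ => L1_sum _ _ fun b _ => L1_mulc _ _ ?_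
  exact L1_sum _ _ fun c _ => L1_cmul _ _ (hm i p _ _)

theorem gram_star {G : Type*} [Group G] (S : ℕ → Finset G) (hS : ∀ k, GS (S k)) {F : Type*}
    [Field F] {q n w : ℕ} (D : PreData G q F n w)
    (h : ∃ ν, (∀ i, ν i ∈ Nq G q) ∧ (D.gram ν).det ≠ 0) :
    ∃ ν : Fin w × Fin w → star S hS, (∀ j, ν j ∈ Nq (star S hS) q) ∧
      ∀ k, (D.gram (fun j => (ν j).1 k)).det ≠ 0 := by
  obtain ⟨ν0, hν0, hdet⟩ := h
  refine star_escape S hS D.ρ ν0 hν0 (fun ν => (D.gram ν).det) ?_ hdet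
  intro I _ x
  choose m hm using fun il : (Fin w × Fin w) × (Fin w × Fin w) => tau_word D (x il.1 * x il.2)
  refine ⟨_, fun i p => L1_det _ (m := ∑ il, m il) fun a b => ?_⟩
  have h1 := hm (a, b) i p
  simp only [map_mul] at h1
  exact L1_mono _ (Finset.single_le_sum (f := m) (fun l _ => Nat.zero_le _) (Finset.mem_univ (a, b))) h1

theorem trace_star {G : Type*} [Group G] (S : ℕ → Finset G) (hS : ∀ k, GS (S k)) {F : Type*}
    [Field F] {q n w : ℕ} (D : PreData G q F n w) (T : Finset F)
    (h : ∃ g ∈ Nq G q, D.τ g ∉ T) :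
    ∃ g ∈ Nq (star S hS) q, ∀ k, D.τ (g.1 k) ∉ T := by
  obtain ⟨g, hg, hgT⟩ := h
  have := star_escape S hS D.ρ (J' := Unit) (fun _ => g) (fun _ => hg)
    (fun ν => ∏ t ∈ T, (D.τ (ν ()) - t)) ?_ ?_
  · obtain ⟨ν, hν, hk⟩ := this
    refine ⟨ν (), hν (), fun k hmem => hk k ?_⟩
    exact Finset.prod_eq_zero hmem (sub_self _)
  · intro I _ x
    obtain ⟨m, hm⟩ := tau_word D (x ())
    refine ⟨_, fun i p => L1_prod _ (m := m) T fun t _ => ?_⟩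
    exact L1_sub _ (hm i p) (L1_const _ _ _)
  · rw [Finset.prod_ne_zero_iff]
    intro t ht h0
    exact hgT ((sub_eq_zero.1 h0) ▸ ht)

section tame
variable {R : Type*} [CommRing R] (a : Arith R) (t : ℕ → ℝ) (h0 : ∀ k, 0 < t k) (h1 : ∀ k, t k ≤ 1)

/-- Sequences of moderate growth. -/
def tame : Subring (ℕ → R) where
  carrier := {y | ∃ C : ℝ, ∀ k j, absPow (a.A j) (t k) (h0 k) (h1 k) (a.σ j (y k)) ≤ C}
  mul_mem' := by
    rintro x y ⟨C, hC⟩ ⟨D, hD⟩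
    refine ⟨C * D, fun k j => ?_⟩
    rw [Pi.mul_apply, map_mul, map_mul]
    exact mul_le_mul (hC k j) (hD k j) (AbsoluteValue.nonneg _ _) ((AbsoluteValue.nonneg _ _).trans (hC k j))
  one_mem' := ⟨1, by simp⟩
  add_mem' := by
    rintro x y ⟨C, hC⟩ ⟨D, hD⟩
    refine ⟨C + D, fun k j => ?_⟩
    rw [Pi.add_apply, map_add]
    exact (AbsoluteValue.add_le _ _ _).trans (add_le_add (hC k j) (hD k j))
  zero_mem' := ⟨0, by simp⟩
  neg_mem' := by
    rintro x ⟨C, hC⟩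
    refine ⟨C, fun k j => ?_⟩
    rw [Pi.neg_apply, map_neg, AbsoluteValue.map_neg]
    exact hC k j

theorem mem_tame {y : ℕ → R} : y ∈ tame a t h0 h1 ↔
    ∃ C : ℝ, ∀ k j, absPow (a.A j) (t k) (h0 k) (h1 k) (a.σ j (y k)) ≤ C := Iff.rfl

theorem tame_lower {y : ℕ → R} (hy : y ∈ tame a t h0 h1) :
    ∃ C : ℝ, 1 ≤ C ∧ ∀ k j, y k ≠ 0 → 1 ≤ C * absPow (a.A j) (t k) (h0 k) (h1 k) (a.σ j (y k)) := by
  obtain ⟨C', hC'⟩ := hy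
  obtain ⟨C, hC1, hC⟩ : ∃ C : ℝ, 1 ≤ C ∧ ∀ k j, absPow (a.A j) (t k) (h0 k) (h1 k) (a.σ j (y k)) ≤ C :=
    ⟨max 1 C', le_max_left _ _, fun k j => (hC' k j).trans (le_max_right _ _)⟩
  refine ⟨C ^ a.M, one_le_pow₀ hC1, fun k j hk => ?_⟩
  have hC0 : 0 ≤ C := by linarith
  have hB : ∀ j, a.A j (a.σ j (y k)) ≤ C ^ (t k)⁻¹ := by
    intro j
    have := Real.rpow_le_rpow (AbsoluteValue.nonneg _ _) (hC k j) (inv_nonneg.2 (h0 k).le)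
    rwa [absPow_apply, Real.rpow_rpow_inv (AbsoluteValue.nonneg _ _) (h0 k).ne'] at this
  have h2 := a.hP _ (Real.one_le_rpow hC1 (inv_nonneg.2 (h0 k).le)) (y k) hk hB j
  have h3 := Real.rpow_le_rpow zero_le_one h2 (h0 k).le
  have h4 : ((C ^ (t k)⁻¹) ^ a.M) ^ (t k) = C ^ a.M := by
    have ht := (h0 k).ne'
    rw [← Real.rpow_natCast, ← Real.rpow_mul hC0, ← Real.rpow_mul hC0,
      show (t k)⁻¹ * (a.M : ℝ) * t k = (a.M : ℝ) by field_simp, Real.rpow_natCast]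
  rw [Real.one_rpow, Real.mul_rpow (by positivity) (AbsoluteValue.nonneg _ _), h4] at h3
  rw [absPow_apply]
  exact h3

theorem tame_div {y z : ℕ → R} (hy : y ∈ tame a t h0 h1) (hne : ∀ k, y k ≠ 0)
    (hyz : y * z ∈ tame a t h0 h1) : z ∈ tame a t h0 h1 := by
  obtain ⟨C, hC1, hC⟩ := tame_lower a t h0 h1 hy
  obtain ⟨D, hD⟩ := hyz
  refine ⟨C * D, fun k j => ?_⟩
  have h2 := hC k j (hne k)
  have h3 := hD k j
  rw [Pi.mul_apply, map_mul, map_mul] at h3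
  set X := absPow (a.A j) (t k) (h0 k) (h1 k) (a.σ j (y k))
  set Z := absPow (a.A j) (t k) (h0 k) (h1 k) (a.σ j (z k)) with hZ
  have hZ0 : 0 ≤ Z := AbsoluteValue.nonneg _ _
  calc Z ≤ (C * X) * Z := le_mul_of_one_le_left hZ0 h2
    _ = C * (X * Z) := by ring
    _ ≤ C * D := by gcongr

end tame

theorem exists_big_root {Ω : Type*} [Field Ω] [IsAlgClosed Ω] (A : AbsoluteValue Ω ℝ) {w : ℕ}
    (hw : 0 < w) (M : Matrix (Fin w) (Fin w) Ω) :
    ∃ lam, M.charpoly.IsRoot lam ∧ A M.trace ≤ (w + 1 : ℝ) * A lam := by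
  classical
  have hs : M.charpoly.Splits := IsAlgClosed.splits _
  have hcard : Multiset.card M.charpoly.roots = w := by
    rw [← hs.natDegree_eq_card_roots, Matrix.charpoly_natDegree_eq_dim, Fintype.card_fin]
  have hne : M.charpoly.roots.toFinset.Nonempty := by
    rw [Multiset.toFinset_nonempty]
    intro h
    rw [h] at hcard
    simp at hcard
    omega
  obtain ⟨lam, hl, hmax⟩ := Finset.exists_max_image _ (fun x => A x) hne
  rw [Multiset.mem_toFinset] at hl
  refine ⟨lam, (Polynomial.mem_roots'.1 hl).2, ?_⟩
  rw [Matrix.trace_eq_sum_roots_charpoly]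
  have key : ∀ s : Multiset Ω, (∀ x ∈ s, A x ≤ A lam) → A s.sum ≤ (Multiset.card s : ℝ) * A lam := by
    intro s
    induction s using Multiset.induction_on with
    | empty => simp
    | cons x s ih =>
      intro h
      rw [Multiset.sum_cons, Multiset.card_cons]
      push_cast
      have h1 := A.add_le x s.sum
      have h2 := ih fun y hy => h y (Multiset.mem_cons_of_mem hy)
      have h3 := h x (Multiset.mem_cons_self _ _)
      linarith
  have := key M.charpoly.roots fun x hx => hmax x (Multiset.mem_toFinset.2 hx)
  rw [hcard] at this
  nlinarith [A.nonneg lam]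

theorem exists_small_root {G : Type*} [Group G] {q n w : ℕ} {Ω : Type*} [Field Ω] [IsAlgClosed Ω]
    (A : AbsoluteValue Ω ℝ) (D : PreData G q Ω n w) (hn : 0 < n) {g : G} (hg : g ∈ Nq G q) :
    ∃ μ, μ ≠ 0 ∧ (D.β g).charpoly.IsRoot μ ∧ A μ ≤ 1 := by
  classical
  have hdet := D.det_rho_eq_one hg
  rw [Matrix.det_eq_prod_roots_charpoly] at hdet
  have hs : (D.ρ g).charpoly.Splits := IsAlgClosed.splits _
  have hcard : Multiset.card (D.ρ g).charpoly.roots = n := by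
    rw [← hs.natDegree_eq_card_roots, Matrix.charpoly_natDegree_eq_dim, Fintype.card_fin]
  have key : ∀ s : Multiset Ω, (∀ x ∈ s, 1 < A x) → s ≠ 0 → 1 < A s.prod := by
    intro s
    induction s using Multiset.induction_on with
    | empty => simp
    | cons x s ih =>
      intro h _
      rw [Multiset.prod_cons, map_mul]
      have h3 := h x (Multiset.mem_cons_self _ _)
      by_cases hs0 : s = 0
      · simpa [hs0] using h3
      · exact one_lt_mul_of_lt_of_le h3 (ih (fun y hy => h y (Multiset.mem_cons_of_mem hy)) hs0).le
  have : ∃ μ ∈ (D.ρ g).charpoly.roots, A μ ≤ 1 := by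
    by_contra hno
    push Not at hno
    have := key _ hno (by intro h; rw [h] at hcard; simp at hcard; omega)
    rw [hdet, map_one] at this
    exact lt_irrefl _ this
  obtain ⟨μ, hμ, hA⟩ := this
  refine ⟨μ, ?_, ?_, hA⟩
  · rintro rfl
    rw [Multiset.prod_eq_zero hμ] at hdet
    exact zero_ne_one hdet
  · obtain ⟨v, hv, hvM⟩ := exists_eigenvec _ (Polynomial.mem_roots'.1 hμ).2
    have h1 := aeval_mulVec _ v hvM (D.β g).charpoly
    have h2 : (Polynomial.aeval (D.ρ g)) (D.β g).charpoly = 0 := D.hkill g hg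
    rw [h2, Matrix.zero_mulVec] at h1
    exact (smul_eq_zero.1 h1.symm).resolve_right hv

theorem root_germ {Ω : Type*} [Field Ω] {𝒰 : Ultrafilter ℕ} {F : Subfield (Germ (𝒰 : Filter ℕ) Ω)}
    {ι : Type*} [Fintype ι] [DecidableEq ι] {M : ℕ → Matrix ι ι Ω} {Z : Matrix ι ι F}
    (h : ∀ i j, Rep F (fun k => M k i j) (Z i j)) (r : ℕ → Ω) (hr : ∀ k, (M k).charpoly.IsRoot (r k)) :
    (Z.charpoly.map F.subtype).IsRoot (r : Germ (𝒰 : Filter ℕ) Ω) := by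
  set N : Matrix ι ι (ℕ → Ω) := Matrix.of fun i j => (fun k => M k i j) with hN
  have h1 := Rep.mat_aux h
  rw [← Matrix.charpoly_map, ← h1, Matrix.charpoly_map]
  change Polynomial.eval (Germ.coeRingHom (𝒰 : Filter ℕ) r) _ = 0
  rw [Polynomial.eval_map, Polynomial.eval₂_hom]
  have h2 : N.charpoly.eval r = 0 := by
    funext k
    have h3 := hr k
    have h4 : N.map (Pi.evalRingHom (fun _ : ℕ => Ω) k) = M k := by
      ext i j; rfl
    rw [← h4, Matrix.charpoly_map, Polynomial.IsRoot.def, Polynomial.eval_map] at h3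
    have h5 := Polynomial.hom_eval₂ N.charpoly (RingHom.id _) (Pi.evalRingHom (fun _ : ℕ => Ω) k) r
    rw [RingHom.comp_id] at h5
    exact h5.trans h3
  rw [h2, map_zero]

theorem exists_c {G : Type*} [Group G] (S : ℕ → Finset G) (hS : ∀ k, GS (S k)) {Ω : Type*} [Field Ω]
    {𝒰 : Ultrafilter ℕ} (F : Subfield (Germ (𝒰 : Filter ℕ) Ω))
    {ι : Type*} [Fintype ι] [DecidableEq ι] (ck : ℕ → G → Matrix ι ι Ω)
    (h1 : ∀ k, ck k 1 = 1) (hmul : ∀ k x y, ck k (x * y) = ck k x * ck k y)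
    (hmem : ∀ γ : star S hS, ∃ Z : Matrix ι ι F, ∀ i j, Rep F (fun k => ck k (γ.1 k) i j) (Z i j)) :
    ∃ c : star S hS →* Matrix ι ι F, ∀ γ i j, Rep F (fun k => ck k (γ.1 k) i j) (c γ i j) := by
  choose Z hZ using hmem
  refine ⟨{ toFun := Z, map_one' := ?_, map_mul' := ?_ }, hZ⟩
  · ext i j
    have h2 := hZ 1 i j
    have h3 : Rep F (fun k => ck k ((1 : star S hS).1 k) i j) ((1 : Matrix ι ι F) i j) := by
      have : ∀ k, ck k ((1 : star S hS).1 k) = 1 := h1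
      simp only [this, Matrix.one_apply]
      split_ifs
      · exact Rep.one
      · exact Rep.zero
    rw [(h2.eq_iff h3).2 (Eventually.of_forall fun k => rfl)]
  · intro x y
    ext i j
    have h2 := hZ (x * y) i j
    have h3 := Rep.matmul (hZ x) (hZ y) i j
    rw [(h2.eq_iff h3).2 (Eventually.of_forall fun k => ?_)]
    have := hmul k (x.1 k) (y.1 k)
    exact congrFun (congrFun this i) j

end p6a
end UEG

namespace UEG

section p6
open Filter

theorem sub_det {R : Type*} [CommRing R] (Rs : Subring (ℕ → R)) {ι : Type*} [Fintype ι] [DecidableEq ι]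
    (M : ℕ → Matrix ι ι R) (h : ∀ i j, (fun k => M k i j) ∈ Rs) : (fun k => (M k).det) ∈ Rs := by
  let N : Matrix ι ι Rs := Matrix.of fun i j => ⟨_, h i j⟩
  have h1 : (fun k => (M k).det) = Rs.subtype N.det := by
    funext k
    have h2 := ((Pi.evalRingHom (fun _ : ℕ => R) k).comp Rs.subtype).map_det N
    exact h2.symm
  rw [h1]
  exact N.det.2

theorem sub_adj {R : Type*} [CommRing R] (Rs : Subring (ℕ → R)) {ι : Type*} [Fintype ι] [DecidableEq ι]
    (M : ℕ → Matrix ι ι R) (h : ∀ i j, (fun k => M k i j) ∈ Rs) (i j : ι) :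
    (fun k => (M k).adjugate i j) ∈ Rs := by
  simp only [Matrix.adjugate_apply]
  refine sub_det Rs (fun k => (M k).updateRow j (Pi.single i 1)) fun a b => ?_
  simp only [Matrix.updateRow_apply]
  split_ifs with hab
  · by_cases hb : b = i
    · subst hb; simp only [Pi.single_eq_same]; exact Rs.one_mem
    · simp only [Pi.single_apply, hb, if_false]; exact Rs.zero_mem
  · exact h a b

theorem sub_mul {R : Type*} [CommRing R] (Rs : Subring (ℕ → R)) {ι : Type*} [Fintype ι] [DecidableEq ι]
    (M M' : ℕ → Matrix ι ι R) (h : ∀ i j, (fun k => M k i j) ∈ Rs) (h' : ∀ i j, (fun k => M' k i j) ∈ Rs)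
    (i j : ι) : (fun k => (M k * M' k) i j) ∈ Rs := by
  simp only [Matrix.mul_apply]
  have : (fun k => ∑ l, M k i l * M' k l j) = ∑ l, (fun k => M k i l) * (fun k => M' k l j) := by
    funext k; simp
  rw [this]
  exact Rs.sum_mem fun l _ => Rs.mul_mem (h i l) (h' l j)

variable {G : Type*} [Group G] {R : Type*} [CommRing R] (a : Arith R) {q n w : ℕ}
  (D : PreData G q R n w)

theorem exists_H (S : Finset G) (ν : Fin w × Fin w → G) :
    ∃ H : ℝ, Real.exp 1 ≤ H ∧ (∀ s ∈ S, ∀ j i l, a.A j (a.σ j (D.T ν s i l)) ≤ H) ∧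
      (H = Real.exp 1 ∨ ∃ s ∈ S, ∃ p : a.J × (Fin w × Fin w) × (Fin w × Fin w),
        a.A p.1 (a.σ p.1 (D.T ν s p.2.1 p.2.2)) = H) := by
  classical
  let f : G × (a.J × (Fin w × Fin w) × (Fin w × Fin w)) → ℝ := fun x =>
    a.A x.2.1 (a.σ x.2.1 (D.T ν x.1 x.2.2.1 x.2.2.2))
  let X : Finset ℝ := insert (Real.exp 1) ((S ×ˢ Finset.univ).image f)
  have hX : X.Nonempty := Finset.insert_nonempty _ _
  refine ⟨X.max' hX, X.le_max' _ (Finset.mem_insert_self _ _), ?_, ?_⟩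
  · intro s hs j i l
    refine X.le_max' _ (Finset.mem_insert_of_mem (Finset.mem_image.2 ⟨(s, j, i, l), ?_, rfl⟩))
    exact Finset.mem_product.2 ⟨hs, Finset.mem_univ _⟩
  · rcases Finset.mem_insert.1 (X.max'_mem hX) with h | h
    · exact Or.inl h
    · obtain ⟨⟨s, p⟩, hs, he⟩ := Finset.mem_image.1 h
      exact Or.inr ⟨s, (Finset.mem_product.1 hs).1, p, he⟩

theorem T_mul_ring (a : Arith R) (ν : Fin w × Fin w → G) (hdet : (D.gram ν).det ≠ 0) (hν : ∀ i, ν i ∈ Nq G q)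
    (γ γ' : G) (i l) : (D.gram ν).det * D.T ν (γ * γ') i l
      = (D.T ν γ' * (D.gram ν).adjugate * D.T ν γ) i l := by
  obtain ⟨j⟩ := a.ne
  have hinj := a.σ_inj j
  have hdet' : ((D.map (a.σ j)).gram ν).det ≠ 0 := by
    rw [PreData.map_gram_det]
    exact (map_ne_zero_iff _ hinj).2 hdet
  apply hinj
  have h1 := (D.map (a.σ j)).T_mul ν hdet' hν γ γ'
  rw [Matrix.inv_def, Ring.inverse_eq_inv', Matrix.mul_smul, Matrix.smul_mul] at h1
  have h2 := congrArg (fun M => ((D.map (a.σ j)).gram ν).det • M) h1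
  simp only [smul_inv_smul₀ hdet'] at h2
  have h3 := congrFun (congrFun h2 i) l
  rw [Matrix.smul_apply, smul_eq_mul, PreData.map_gram_det, PreData.map_gram, PreData.map_T,
    PreData.map_T, PreData.map_T] at h3
  have h4 : ((D.gram ν).map (a.σ j)).adjugate = (D.gram ν).adjugate.map (a.σ j) :=
    ((a.σ j).map_adjugate _).symm
  rw [h4, ← Matrix.map_mul, ← Matrix.map_mul] at h3
  rw [map_mul]
  exact h3

theorem T_tame (S : ℕ → Finset G) (hS : ∀ k, GS (S k)) (t : ℕ → ℝ) (h0 : ∀ k, 0 < t k)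
    (h1 : ∀ k, t k ≤ 1) (ν : ℕ → Fin w × Fin w → G) (hdet : ∀ k, (D.gram (ν k)).det ≠ 0)
    (hν : ∀ k i, ν k i ∈ Nq G q)
    (hbase : ∀ s : ℕ → G, (∀ k, s k ∈ S k) → ∀ i l, (fun k => D.T (ν k) (s k) i l) ∈ tame a t h0 h1)
    (m : ℕ) : ∀ γ : ℕ → G, (∀ k, γ k ∈ (S k : Set G) ^ m) → ∀ i l,
      (fun k => D.T (ν k) (γ k) i l) ∈ tame a t h0 h1 := by
  have hg : ∀ i l, (fun k => D.gram (ν k) i l) ∈ tame a t h0 h1 := by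
    intro i l
    have := hbase (fun _ => 1) (fun k => (hS k).1) i l
    simpa only [PreData.T_one] using this
  induction m with
  | zero =>
    intro γ hγ
    refine hbase γ fun k => ?_
    have := hγ k
    rw [pow_zero, Set.mem_one] at this
    rw [this]
    exact (hS k).1
  | succ m ih =>
    intro γ hγ i l
    have : ∀ k, ∃ x ∈ (S k : Set G) ^ m, ∃ s ∈ (S k : Set G), x * s = γ k := fun k => by
      have := hγ k
      rw [pow_succ] at this
      exact Set.mem_mul.1 this
    choose x hx s hs hxs using this
    refine tame_div a t h0 h1 (sub_det _ (fun k => D.gram (ν k)) hg) hdet ?_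
    have h2 : ((fun k => (D.gram (ν k)).det) * fun k => D.T (ν k) (γ k) i l) =
        fun k => (D.T (ν k) (s k) * (D.gram (ν k)).adjugate * D.T (ν k) (x k)) i l := by
      funext k
      rw [Pi.mul_apply, ← hxs k]
      exact T_mul_ring D a (ν k) (hdet k) (hν k) _ _ i l
    rw [h2]
    refine sub_mul _ (fun k => D.T (ν k) (s k) * (D.gram (ν k)).adjugate) _ ?_ (ih x hx) i l
    exact sub_mul _ _ _ (hbase s hs) (sub_adj _ _ hg)

theorem cmat_L1 {Ω : Type*} [Field Ω] (D : PreData G q Ω n w) (ν : Fin w × Fin w → G)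
    (P Q : Matrix (Fin w × Fin w) (Fin w × Fin w) Ω) :
    (fun y => (P * D.cmat ν y * P + Q).det) ∈ L1 D.ρ ^ (2 * Fintype.card (Fin w × Fin w)) := by
  refine L1_det _ (f := fun y => P * D.cmat ν y * P + Q) fun i j => ?_
  have hT : ∀ i l, (fun y => D.T ν y i l) ∈ L1 D.ρ ^ 2 := by
    intro i l
    simp only [PreData.T, PreData.τ, PreData.β, Matrix.trace, Matrix.diag, Matrix.of_apply, map_mul,
      Matrix.mul_apply]
    refine L1_sum _ _ fun a _ => L1_sum _ _ fun b _ => L1_mulc _ _ (L1_sum _ _ fun c _ => L1_cmul _ _ ?_)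
    refine L1_sum _ _ fun d _ => L1_mulc _ _ (L1_sum _ _ fun e _ => L1_mul _ (m := 1) (m' := 1) ?_ ?_)
    · refine L1_sum _ _ fun f _ => L1_mulc _ _ ?_
      rw [pow_one]
      exact rho_mem_L1 _ _ _
    · rw [pow_one]
      exact rhoinv_mem_L1 _ _ _
  simp only [Matrix.add_apply, Matrix.mul_apply, PreData.cmat, Matrix.transpose_apply]
  refine L1_add _ ?_ (L1_const _ _ _)
  refine L1_sum _ _ fun a _ => L1_mulc _ _ (L1_sum _ _ fun b _ => L1_cmul _ _ ?_)
  exact L1_sum _ _ fun c _ => L1_mulc _ _ (hT _ _)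

end p6
end UEG

namespace UEG

section p6
open Filter

theorem p6 {G : Type*} [Group G] {R : Type*} [CommRing R] (a : Arith R) {q n w : ℕ} (hwn : w ≤ n)
    (hq : ∀ m, 1 ≤ m → m ≤ (w * w + 1) ^ (w * w) → m ∣ q)
    (D : PreData G q R n w) (hD : D.Good) : Dbl G := by
  classical
  by_contra hbad
  obtain ⟨S, hSb⟩ := exists_bad hbad
  have hS : ∀ k, GS (S k) := fun k => (hSb k).1
  obtain ⟨j0⟩ := a.ne
  have hinj := a.σ_inj
  -- the Gram basis
  obtain ⟨νs, hνs, hνdet⟩ := gram_star S hS (D.map (a.σ j0)) (by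
    obtain ⟨ν, h1, h2⟩ := hD.1
    refine ⟨ν, h1, ?_⟩
    rw [PreData.map_gram_det]
    exact (map_ne_zero_iff _ (hinj j0)).2 h2)
  set ν : ℕ → Fin w × Fin w → G := fun k i => (νs i).1 k with hνdef
  have hdetR : ∀ k, (D.gram (ν k)).det ≠ 0 := by
    intro k h
    apply hνdet k
    rw [PreData.map_gram_det]
    change a.σ j0 (D.gram (ν k)).det = 0
    rw [h, map_zero]
  have hdet : ∀ j k, ((D.map (a.σ j)).gram (ν k)).det ≠ 0 := by
    intro j k
    rw [PreData.map_gram_det]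
    exact (map_ne_zero_iff _ (hinj j)).2 (hdetR k)
  have hNk : ∀ g ∈ Nq (star S hS) q, ∀ k, g.1 k ∈ Nq G q := fun g hg k =>
    Nq_map ((Pi.evalMonoidHom (fun _ : ℕ => G) k).comp (star S hS).subtype) q hg
  have hν : ∀ k i, ν k i ∈ Nq G q := fun k i => hNk _ (hνs i) k
  -- heights
  choose H hH1 hH2 hH3 using fun k => exists_H a D (S k) (ν k)
  have hlog : ∀ k, 1 ≤ Real.log (H k) := fun k => by
    rw [Real.le_log_iff_exp_le (lt_of_lt_of_le (Real.exp_pos 1) (hH1 k))]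
    exact hH1 k
  set t : ℕ → ℝ := fun k => (Real.log (H k))⁻¹ with ht
  have h0 : ∀ k, 0 < t k := fun k => inv_pos.2 (lt_of_lt_of_le one_pos (hlog k))
  have h1 : ∀ k, t k ≤ 1 := fun k => inv_le_one_of_one_le₀ (hlog k)
  have hHt : ∀ k, H k ^ t k = Real.exp 1 := fun k => by
    have hp : 0 < H k := lt_of_lt_of_le (Real.exp_pos 1) (hH1 k)
    rw [Real.rpow_def_of_pos hp, ht, mul_inv_cancel₀ (by have := hlog k; positivity)]
  have hbase : ∀ s : ℕ → G, (∀ k, s k ∈ S k) → ∀ i l,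
      (fun k => D.T (ν k) (s k) i l) ∈ tame a t h0 h1 := by
    intro s hs i l
    refine ⟨Real.exp 1, fun k j => ?_⟩
    rw [absPow_apply, ← hHt k]
    exact Real.rpow_le_rpow (AbsoluteValue.nonneg _ _) (hH2 k _ (hs k) j i l) (h0 k).le
  have hTt : ∀ γ : star S hS, ∀ i l, (fun k => D.T (ν k) (γ.1 k) i l) ∈ tame a t h0 h1 := by
    intro γ
    obtain ⟨m, hm⟩ := mem_star.1 γ.2
    exact T_tame a D S hS t h0 h1 ν hdetR hν hbase m γ.1 hm
  -- ultrafilter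
  set 𝒰 : Ultrafilter ℕ := hyperfilter ℕ with h𝒰
  let AP : ∀ j : a.J, ℕ → AbsoluteValue (a.Ω j) ℝ := fun j k => absPow (a.A j) (t k) (h0 k) (h1 k)
  have hultra := fun j => ultra_field (AP j) 𝒰 ((tame a t h0 h1).map (RingHom.compLeft (a.σ j) ℕ))
    (by
      rintro _ ⟨y, ⟨C, hC⟩, rfl⟩
      exact ⟨C, Eventually.of_forall fun k => hC k j⟩)
    (by
      rintro _ ⟨y, hy, rfl⟩ hne
      obtain ⟨C, -, hC⟩ := tame_lower a t h0 h1 hy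
      refine ⟨C, ?_⟩
      filter_upwards [hne] with k hk
      refine hC k j fun h => hk ?_
      change a.σ j (y k) = 0
      rw [h, map_zero])
  choose F hFac hFmem hFroot Bv hBv using hultra
  have hB : ∀ j x z, Rep (F j) x z → Tendsto (fun k => AP j k (x k)) (𝒰 : Filter ℕ) (nhds (Bv j z)) := by
    intro j x z hx
    have hx' : (x : Germ (𝒰 : Filter ℕ) (a.Ω j)) ∈ F j := by
      rw [show (x : Germ (𝒰 : Filter ℕ) (a.Ω j)) = z from hx]; exact z.2
    have h2 : z = ⟨x, hx'⟩ := Subtype.ext hx.symm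
    rw [h2]
    exact hBv j x hx'
  -- the representations
  have hTrep : ∀ j (γ : star S hS), ∃ Z : Matrix (Fin w × Fin w) (Fin w × Fin w) (F j), ∀ i l,
      Rep (F j) (fun k => (D.map (a.σ j)).T (ν k) (γ.1 k) i l) (Z i l) := by
    intro j γ
    refine ⟨Matrix.of fun i l => ⟨_, hFmem j _ ⟨_, hTt γ i l, rfl⟩⟩, fun i l => ?_⟩
    simp only [PreData.map_T]
    rfl
  have hc := fun j => exists_c S hS (F j) (fun k g => (D.map (a.σ j)).cmat (ν k) g)
    (fun k => PreData.cmat_one _ _ (hdet j k))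
    (fun k x y => PreData.cmat_mul _ _ (hdet j k) (hν k) x y) (by
      intro γ
      obtain ⟨Z, hZ⟩ := hTrep j γ
      obtain ⟨Z1, hZ1⟩ := hTrep j 1
      have hZ1' : ∀ i l, Rep (F j) (fun k => (D.map (a.σ j)).gram (ν k) i l) (Z1 i l) := by
        intro i l
        have := hZ1 i l
        simpa only [OneMemClass.coe_one, Pi.one_apply, PreData.T_one] using this
      refine ⟨(Z * Z1⁻¹)ᵀ, fun i l => ?_⟩
      exact Rep.matmul hZ (Rep.matinv hZ1') l i)
  choose c hc using hc
  -- part (a)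
  have parta : ∃ j, ∃ g ∈ Nq (star S hS) q, ∃ a0, (c j g).charpoly.IsRoot a0 ∧ 1 < Bv j a0 := by
    by_contra hno
    push Not at hno
    have D1 : ∀ j, ∀ g ∈ Nq (star S hS) q, ∀ δ : ℝ, 1 < δ → ∀ᶠ k in (𝒰 : Filter ℕ),
        AP j k (a.σ j (D.τ (g.1 k))) ≤ (w + 1 : ℝ) ^ t k * δ := by
      intro j g hg δ hδ
      rcases Nat.eq_zero_or_pos w with hw | hw
      · refine Eventually.of_forall fun k => ?_
        have : D.τ (g.1 k) = 0 := by
          subst hw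
          simp [PreData.τ]
        rw [this, map_zero, map_zero]
        positivity
      choose lam hlam hlamA using fun k => exists_big_root (a.A j) hw ((D.map (a.σ j)).β (g.1 k))
      choose μ hμ0 hμ hμA using fun k =>
        exists_small_root (a.A j) (D.map (a.σ j)) (by omega) (hNk g hg k)
      have hr := fun k => PreData.cmat_root _ _ (hdet j k) (hν k) (hNk g hg k) _ _ (hlam k) (hμ k)
      have hroot := root_germ (hc j g) (fun k => lam k / μ k) hr
      have hmemF := hFroot j _ (Matrix.charpoly_monic _).ne_zero _ hroot
      have hrootF : (c j g).charpoly.IsRoot ⟨_, hmemF⟩ := by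
        have hinjF : Function.Injective (F j).subtype := Subtype.val_injective
        have h1 := hroot
        rw [Polynomial.IsRoot.def, Polynomial.eval_map] at h1
        apply hinjF
        rw [map_zero, ← Polynomial.eval₂_at_apply]
        exact h1
      have hle := hno j g hg _ hrootF
      have hlt := (hB j _ ⟨_, hmemF⟩ rfl).eventually_lt_const (lt_of_le_of_lt hle hδ)
      filter_upwards [hlt] with k hk
      have e1 : AP j k (lam k) ≤ δ := by
        have e2 : AP j k (lam k) = AP j k (lam k / μ k) * AP j k (μ k) := by
          rw [← map_mul, div_mul_cancel₀ _ (hμ0 k)]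
        have e3 : AP j k (μ k) ≤ 1 := Real.rpow_le_one (AbsoluteValue.nonneg _ _) (hμA k) (h0 k).le
        rw [e2]
        calc _ ≤ AP j k (lam k / μ k) * 1 := by
              gcongr
          _ ≤ δ := by rw [mul_one]; exact hk.le
      have e4 : a.A j (a.σ j (D.τ (g.1 k))) ≤ (w + 1 : ℝ) * a.A j (lam k) := by
        rw [← PreData.map_τ]
        exact hlamA k
      have e5 := Real.rpow_le_rpow (AbsoluteValue.nonneg _ _) e4 (h0 k).le
      rw [Real.mul_rpow (by positivity) (AbsoluteValue.nonneg _ _)] at e5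
      refine e5.trans ?_
      gcongr
      exact e1
    by_cases hcase : ∃ t0 : ℝ, 0 < t0 ∧ ∀ᶠ k in (𝒰 : Filter ℕ), t0 ≤ t k
    · obtain ⟨t0, ht0, hev⟩ := hcase
      set C : ℝ := (w + 1 : ℝ) * 2 ^ t0⁻¹ with hC
      have hfin := a.hN C
      obtain ⟨g, hg, hgT⟩ := trace_star S hS (D.map (a.σ j0)) (hfin.toFinset.image (a.σ j0)) (by
        obtain ⟨x, ⟨g, hg, rfl⟩, hx⟩ := hD.2.exists_notMem_finset hfin.toFinset
        refine ⟨g, hg, fun h => hx ?_⟩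
        obtain ⟨y, hy, hyx⟩ := Finset.mem_image.1 h
        rw [PreData.map_τ] at hyx
        rwa [← hinj j0 hyx])
      have hall := eventually_all.2 fun j => D1 j g hg 2 one_lt_two
      obtain ⟨k, hk1, hk2⟩ := (hall.and hev).exists
      apply hgT k
      rw [PreData.map_τ]
      refine Finset.mem_image_of_mem _ (hfin.mem_toFinset.2 fun j => ?_)
      have e1 := Real.rpow_le_rpow (AbsoluteValue.nonneg _ _) (hk1 j) (inv_nonneg.2 (h0 k).le)
      have hx : AP j k (a.σ j (D.τ (g.1 k))) = a.A j (a.σ j (D.τ (g.1 k))) ^ t k := rfl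
      rw [hx, Real.rpow_rpow_inv (AbsoluteValue.nonneg _ _) (h0 k).ne',
        Real.mul_rpow (by positivity) (by positivity), Real.rpow_rpow_inv (by positivity) (h0 k).ne'] at e1
      refine e1.trans ?_
      rw [hC]
      gcongr
      · exact one_le_two
    · push Not at hcase
      have ht0 : ∀ t0 : ℝ, 0 < t0 → ∀ᶠ k in (𝒰 : Filter ℕ), t k < t0 := by
        exact hcase
      have htend : Tendsto t (𝒰 : Filter ℕ) (nhds 0) := by
        rw [Metric.tendsto_nhds]
        intro ε hε
        filter_upwards [ht0 ε hε] with k hk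
        rw [Real.dist_eq, sub_zero, abs_of_pos (h0 k)]
        exact hk
      have hex : ∀ k, ∃ s ∈ S k, t k < 1 → ∃ p : a.J × (Fin w × Fin w) × (Fin w × Fin w),
          a.A p.1 (a.σ p.1 (D.T (ν k) s p.2.1 p.2.2)) = H k := by
        intro k
        rcases hH3 k with h | ⟨s, hs, h⟩
        · refine ⟨1, (hS k).1, fun hlt => ?_⟩
          have : t k = 1 := by rw [ht]; simp [h]
          linarith
        · exact ⟨s, hs, fun _ => h⟩
      choose s hs hsp using hex
      have hp : ∀ᶠ k in (𝒰 : Filter ℕ), ∃ p : a.J × (Fin w × Fin w) × (Fin w × Fin w),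
          a.A p.1 (a.σ p.1 (D.T (ν k) (s k) p.2.1 p.2.2)) = H k := by
        filter_upwards [ht0 1 one_pos] with k hk using hsp k hk
      rw [Ultrafilter.eventually_exists_iff] at hp
      obtain ⟨⟨j, i, l⟩, hp⟩ := hp
      let ss : star S hS := ⟨s, 1, fun k => by rw [pow_one]; exact hs k⟩
      have hg : ss * νs i * ss⁻¹ * νs l ∈ Nq (star S hS) q :=
        mul_mem (Nq_conj q ss _ (hνs i)) (hνs l)
      have e1 := D1 j _ hg (11 / 10) (by norm_num)
      have e2 : Tendsto (fun k => (w + 1 : ℝ) ^ t k) (𝒰 : Filter ℕ) (nhds 1) := by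
        have := (Real.continuousAt_const_rpow (a := (w + 1 : ℝ)) (b := 0) (by positivity)).tendsto.comp htend
        simpa [Function.comp_def] using this
      have e3 := e2.eventually_lt_const (show (1 : ℝ) < 11 / 10 by norm_num)
      obtain ⟨k, hk1, hk2, hk3⟩ := (e1.and (e3.and hp)).exists
      have e4 : AP j k (a.σ j (D.τ ((ss * νs i * ss⁻¹ * νs l).1 k))) = Real.exp 1 := by
        rw [← hHt k, ← hk3]
        rfl
      rw [e4] at hk1
      have := Real.add_one_le_exp (1 : ℝ)
      nlinarith
  -- part (b)
  obtain ⟨j, g, hg, a0, ha0, ha01⟩ := parta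
  haveI := hFac j
  obtain ⟨P, Q, Λ, Φ, hΦ, hΛ, hΦ1, hlim, ⟨h, hh, x0, hx0⟩, u, x, γ, hV, hrel⟩ :=
    lemB (Bv j) (c j) q (by simpa using hq) g hg a0 ha0 ha01
  choose Pk hPk using fun i l => Rep.exists (P i l)
  choose Qk hQk using fun i l => Rep.exists (Q i l)
  obtain ⟨m, hm⟩ := p6b S hS 𝒰 (AP j) (F j) (Bv j) (hB j) (D.map (a.σ j)).ρ _
    (fun k y => ((Matrix.of fun i l => Pk i l k) * (D.map (a.σ j)).cmat (ν k) y *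
      (Matrix.of fun i l => Pk i l k) + (Matrix.of fun i l => Qk i l k)).det)
    (fun k => cmat_L1 _ _ _ _) Φ (by
      intro y
      rw [hΦ]
      refine Rep.det (M := fun k => ((Matrix.of fun i l => Pk i l k) * (D.map (a.σ j)).cmat (ν k) (y.1 k) *
        (Matrix.of fun i l => Pk i l k) + (Matrix.of fun i l => Qk i l k))) fun i l => ?_
      exact (Rep.matmul (Rep.matmul hPk (hc j y)) hPk i l).add (hQk i l))
    g Λ hΛ hΦ1 hlim h hh x0 hx0 u x γ hV hrel
  have hge : ∀ᶠ k in (𝒰 : Filter ℕ), m ≤ k :=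
    (Nat.hyperfilter_le_atTop) (eventually_ge_atTop m)
  obtain ⟨k, hk1, hk2⟩ := (hm.and hge).exists
  exact (hSb k).2 (hk1.mono (hS k).1 hk2)

end p6
end UEG

namespace UEG
open Filter Topology

/-- The absolute value extends to some algebraically closed field. -/
def Ext {k : Type} [Field k] (v : AbsoluteValue k ℝ) : Prop :=
  ∃ (Ω : Type) (_ : Field Ω) (_ : IsAlgClosed Ω) (φ : k →+* Ω) (A : AbsoluteValue Ω ℝ),
    ∀ x, A (φ x) = v x

theorem ext_complete (κ : Type) [NontriviallyNormedField κ] [IsUltrametricDist κ] [CompleteSpace κ] :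
    Ext (NormedField.toAbsoluteValue κ) := by
  letI := spectralNorm.normedField κ (AlgebraicClosure κ)
  refine ⟨AlgebraicClosure κ, inferInstance, inferInstance, algebraMap _ _,
    NormedField.toAbsoluteValue (AlgebraicClosure κ), fun x => ?_⟩
  exact spectralNorm_extends x

theorem Ext.comap {k k' : Type} [Field k] [Field k'] (v : AbsoluteValue k ℝ) (v' : AbsoluteValue k' ℝ)
    (f : k →+* k') (hf : ∀ x, v' (f x) = v x) (h : Ext v') : Ext v := by
  obtain ⟨Ω, i1, i2, φ, A, hA⟩ := h
  exact ⟨Ω, i1, i2, φ.comp f, A, fun x => by rw [RingHom.comp_apply, hA, hf]⟩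

theorem ext_nonarch {k : Type} [Field k] (v : AbsoluteValue k ℝ) (hv : IsNonarchimedean v)
    (hnt : ∃ x, 1 < v x) : Ext v := by
  have hc : ∀ x : k, ‖((WithAbs.toAbs v x : WithAbs v) : v.Completion)‖ = v x := fun x => by
    rw [UniformSpace.Completion.norm_coe]
    rfl
  letI : NontriviallyNormedField v.Completion :=
    { (inferInstance : NormedField v.Completion) with
      non_trivial := by
        obtain ⟨x, hx⟩ := hnt
        exact ⟨_, by rw [hc x]; exact hx⟩ }
  haveI : IsUltrametricDist v.Completion := by
    refine IsUltrametricDist.isUltrametricDist_of_forall_norm_add_le_max_norm fun x y => ?_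
    refine UniformSpace.Completion.induction_on₂ x y ?_ ?_
    · exact isClosed_le (by fun_prop) (by fun_prop)
    · intro a b
      rw [← UniformSpace.Completion.coe_add]
      simp only [UniformSpace.Completion.norm_coe]
      exact hv _ _
  refine Ext.comap v _ ((UniformSpace.Completion.coeRingHom : WithAbs v →+* v.Completion).comp
    (WithAbs.equiv v).symm.toRingHom) (fun x => hc x) (ext_complete v.Completion)

theorem ext_real : Ext Rat.AbsoluteValue.real := by
  refine ⟨ℂ, inferInstance, inferInstance, algebraMap ℚ ℂ, NormedField.toAbsoluteValue ℂ, fun x => ?_⟩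
  simp [NormedField.toAbsoluteValue]

theorem ext_padic (p : ℕ) [Fact p.Prime] : Ext (Rat.AbsoluteValue.padic p) := by
  refine Ext.comap _ _ (algebraMap ℚ ℚ_[p]) (fun x => ?_) (ext_complete ℚ_[p])
  simp [NormedField.toAbsoluteValue]

/-- Transfer of `Arith` along injective homs. -/
def Arith.comap {R R' : Type*} [CommRing R] [CommRing R'] (a : Arith R) (f : R' →+* R)
    (hf : Function.Injective f) : Arith R' where
  J := a.J
  fin := a.fin
  ne := a.ne
  Ω := a.Ω
  fld := a.fld
  ac := a.ac
  A := a.A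
  σ j := (a.σ j).comp f
  hN C := (a.hN C).preimage hf.injOn
  M := a.M
  hP B hB x hx h j := a.hP B hB (f x) (by rwa [Ne, map_eq_zero_iff f hf]) h j
end UEG

namespace UEG
open Filter Topology

section
variable {k Ω : Type} [Field k] [Field Ω] [IsAlgClosed Ω] (φ : k →+* Ω) (A : AbsoluteValue Ω ℝ)

theorem bnd_coeff (p : Polynomial k) (hp : p.Monic) (d : ℕ) (hd : p.natDegree ≤ d) (C : ℝ)
    (h : ∀ z ∈ (p.map φ).roots, A z ≤ C) (i : ℕ) :
    A (φ (p.coeff i)) ≤ max C 1 ^ d * d.choose (d / 2) := by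
  letI : NormedField Ω := A.toNormedField
  have := Polynomial.coeff_bdd_of_roots_le φ hp (IsAlgClosed.splits _) hd h i
  rw [Polynomial.coeff_map] at this
  exact this

theorem bnd_const (p : Polynomial k) (hp : p.Monic) :
    A (φ (p.coeff 0)) = (((p.map φ).roots).map A).prod := by
  have h1 := (IsAlgClosed.splits (p.map φ)).coeff_zero_eq_prod_roots_of_monic (hp.map φ)
  rw [Polynomial.coeff_map] at h1
  rw [h1, map_mul, map_pow, map_neg_eq_map, map_one, one_pow, one_mul, map_multiset_prod]

theorem prod_le (s : Multiset Ω) (B : ℝ) (hB : 1 ≤ B) (h : ∀ z ∈ s, A z ≤ B) (N : ℕ)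
    (hN : s.card ≤ N) : (s.map A).prod ≤ B ^ N := by
  have h1 : (s.map A).prod ≤ B ^ s.card := by
    induction s using Multiset.induction with
    | empty => simp
    | cons a s ih =>
      rw [Multiset.map_cons, Multiset.prod_cons, Multiset.card_cons, pow_succ, mul_comm]
      have := ih (fun z hz => h z (Multiset.mem_cons_of_mem hz)) (by simp at hN; omega)
      have h2 := h a (Multiset.mem_cons_self a s)
      have h3 : 0 ≤ (s.map A).prod := Multiset.prod_nonneg (by
        intro x hx
        obtain ⟨y, -, rfl⟩ := Multiset.mem_map.1 hx
        exact A.nonneg y)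
      gcongr
  exact h1.trans (pow_le_pow_right₀ hB hN)

theorem prod_le' (s : Multiset Ω) (B : ℝ) (hB : 1 ≤ B) (h : ∀ z ∈ s, A z ≤ B) (N : ℕ)
    (hN : s.card ≤ N) (r : Ω) (hr : r ∈ s) : (s.map A).prod ≤ A r * B ^ N := by
  obtain ⟨t, rfl⟩ := Multiset.exists_cons_of_mem hr
  rw [Multiset.map_cons, Multiset.prod_cons]
  have := prod_le A t B hB (fun z hz => h z (Multiset.mem_cons_of_mem hz)) N (by simp at hN; omega)
  have := A.nonneg r
  gcongr
end

theorem arith_of_base {k E O : Type} [Field k] [Field E] [Algebra k E] [FiniteDimensional k E]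
    [CommRing O] [IsDomain O] [IsIntegrallyClosed O] [Algebra O k] [IsFractionRing O k] [Algebra O E]
    [IsScalarTower O k E] {S : Type} [Fintype S] [Nonempty S] (v : S → AbsoluteValue k ℝ)
    (hv : ∀ i, Ext (v i)) (hN : ∀ C : ℝ, {x : O | ∀ i, v i (algebraMap O k x) ≤ C}.Finite)
    (hP : ∀ x : O, x ≠ 0 → 1 ≤ ∏ i, v i (algebraMap O k x)) :
    Nonempty (Arith (integralClosure O E)) := by
  classical
  choose Ω fld ac φ A hA using hv
  letI alg : ∀ i, Algebra k (Ω i) := fun i => (φ i).toAlgebra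
  have hroots : ∀ (i : S) (x : E) (z : Ω i), z ∈ ((minpoly k x).map (φ i)).roots ↔
      ∃ σ : E →ₐ[k] Ω i, σ x = z := by
    intro i x z
    have h1 := Algebra.IsAlgebraic.range_eval_eq_rootSet_minpoly (F := k) (K := E) (Ω i) x
    have h2 : z ∈ (minpoly k x).rootSet (Ω i) ↔ ∃ σ : E →ₐ[k] Ω i, σ x = z := by
      rw [← h1]; rfl
    rw [← h2, Polynomial.rootSet_def, Finset.mem_coe, Multiset.mem_toFinset]
    rfl
  set N := Module.finrank k E with hNdef
  have hintegral : ∀ x : E, IsIntegral k x := fun x => Algebra.IsIntegral.isIntegral x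
  have hdeg : ∀ x : E, (minpoly k x).natDegree ≤ N := fun x => minpoly.natDegree_le x
  have hcard : ∀ (i : S) (x : E), ((minpoly k x).map (φ i)).roots.card ≤ N := fun i x =>
    ((Polynomial.card_roots' _).trans Polynomial.natDegree_map_le).trans (hdeg x)
  have hmp : ∀ x : integralClosure O E, minpoly k (x : E) = (minpoly O (x : E)).map (algebraMap O k) :=
    fun x => minpoly.isIntegrallyClosed_eq_field_fractions' k x.2
  refine ⟨{ J := Σ i, (E →ₐ[k] Ω i)
            fin := inferInstance
            ne := ⟨⟨Classical.arbitrary S, IsAlgClosed.lift⟩⟩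
            Ω := fun j => Ω j.1
            fld := fun j => fld j.1
            ac := fun j => ac j.1
            A := fun j => A j.1
            σ := fun j => (j.2 : E →+* Ω j.1).comp (integralClosure O E).val.toRingHom
            hN := ?_
            M := N * Fintype.card S
            hP := ?_ }⟩
  · intro C
    have hU := hN (max C 1 ^ N * N.choose (N / 2))
    have hfin := Polynomial.bUnion_roots_finite (algebraMap O E) N hU
    refine Set.Finite.of_finite_image (f := fun x : integralClosure O E => (x : E)) (hfin.subset ?_)
      Subtype.val_injective.injOn
    rintro _ ⟨x, hx, rfl⟩
    refine Set.mem_biUnion (x := minpoly O (x : E)) ⟨?_, fun l i => ?_⟩ ?_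
    · have := hdeg (x : E)
      rwa [hmp x, (minpoly.monic x.2).natDegree_map] at this
    · rw [← Polynomial.coeff_map, ← hmp x, ← hA]
      refine bnd_coeff (φ i) (A i) _ (minpoly.monic (hintegral _)) N (hdeg _) C (fun z hz => ?_) l
      obtain ⟨σ, rfl⟩ := (hroots i _ z).1 hz
      exact hx ⟨i, σ⟩
    · rw [Finset.mem_coe, Multiset.mem_toFinset, Polynomial.mem_roots ((minpoly.monic x.2).map _).ne_zero,
        Polynomial.IsRoot.def, Polynomial.eval_map_algebraMap]
      exact minpoly.aeval _ _
  · rintro B hB x hx hxB ⟨i0, σ0⟩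
    have h0 : (minpoly O (x : E)).coeff 0 ≠ 0 := by
      intro h
      have h2 : (minpoly k (x : E)).coeff 0 = 0 := by rw [hmp x, Polynomial.coeff_map, h, map_zero]
      rw [minpoly.coeff_zero_eq_zero (hintegral _)] at h2
      exact hx (Subtype.ext h2)
    have h1 := hP _ h0
    have hle : ∀ i, ∀ z ∈ ((minpoly k (x : E)).map (φ i)).roots, A i z ≤ B := by
      intro i z hz
      obtain ⟨σ, rfl⟩ := (hroots i _ z).1 hz
      exact hxB ⟨i, σ⟩
    have hb : ∀ i, v i (algebraMap O k ((minpoly O (x : E)).coeff 0)) =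
        ((((minpoly k (x : E)).map (φ i)).roots).map (A i)).prod := by
      intro i
      rw [← Polynomial.coeff_map, ← hmp x, ← hA]
      exact bnd_const (φ i) (A i) _ (minpoly.monic (hintegral _))
    simp_rw [hb] at h1
    refine h1.trans ?_
    rw [← Finset.mul_prod_erase _ _ (Finset.mem_univ i0)]
    have hnn : ∀ i, 0 ≤ ((((minpoly k (x : E)).map (φ i)).roots).map (A i)).prod := fun i => by
      rw [← hb]; exact (v i).nonneg _
    have e1 := prod_le' (A i0) _ B hB (hle i0) N (hcard i0 _) (σ0 (x : E)) ((hroots i0 _ _).2 ⟨σ0, rfl⟩)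
    have e2 : ∏ i ∈ Finset.univ.erase i0, ((((minpoly k (x : E)).map (φ i)).roots).map (A i)).prod ≤
        ∏ i ∈ Finset.univ.erase i0, B ^ N :=
      Finset.prod_le_prod (fun i _ => hnn i) fun i _ => prod_le (A i) _ B hB (hle i) N (hcard i _)
    rw [Finset.prod_const] at e2
    have hc : (Finset.univ.erase i0).card + 1 = Fintype.card S := by
      rw [Finset.card_erase_add_one (Finset.mem_univ i0), Finset.card_univ]
    calc _ ≤ (A i0 (σ0 (x : E)) * B ^ N) * (B ^ N) ^ (Finset.univ.erase i0).card := by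
          have : 0 ≤ A i0 (σ0 (x : E)) * B ^ N := mul_nonneg ((A i0).nonneg _) (by positivity)
          exact mul_le_mul e1 e2 (Finset.prod_nonneg fun i _ => hnn i) this
      _ = _ := by
          rw [← hc, pow_mul, pow_succ]
          change _ = _ * A i0 (σ0 (x : E))
          ring
end UEG

namespace UEG
open Filter Topology

theorem arith_closure {k Ω O : Type} [Field k] [Field Ω] [Algebra k Ω]
    [CommRing O] [IsDomain O] [IsIntegrallyClosed O] [Algebra O k] [IsFractionRing O k] [Algebra O Ω]
    [IsScalarTower O k Ω] {S : Type} [Fintype S] [Nonempty S] (v : S → AbsoluteValue k ℝ)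
    (hv : ∀ i, Ext (v i)) (hN : ∀ C : ℝ, {x : O | ∀ i, v i (algebraMap O k x) ≤ C}.Finite)
    (hP : ∀ x : O, x ≠ 0 → 1 ≤ ∏ i, v i (algebraMap O k x))
    (s : Finset Ω) (hs : ∀ x ∈ s, IsIntegral O x) :
    Nonempty (Arith (Subring.closure (s : Set Ω))) := by
  let E := IntermediateField.adjoin k (s : Set Ω)
  haveI : FiniteDimensional k E :=
    IntermediateField.finiteDimensional_adjoin fun x hx => (hs x hx).tower_top
  obtain ⟨a⟩ := arith_of_base (E := E) v hv hN hP
  have hle : Subring.closure (s : Set Ω) ≤ E.toSubfield.toSubring :=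
    Subring.closure_le.2 (IntermediateField.subset_adjoin k _)
  have hintegral : ∀ x : Subring.closure (s : Set Ω), (⟨x.1, hle x.2⟩ : E) ∈ integralClosure O E := by
    intro x
    have h1 : IsIntegral O (x : Ω) := by
      have h2 : Subring.closure (s : Set Ω) ≤ (integralClosure O Ω).toSubring := Subring.closure_le.2 hs
      exact h2 x.2
    haveI : IsScalarTower O E Ω := IsScalarTower.of_algebraMap_eq fun x => by
      rw [IsScalarTower.algebraMap_apply O k Ω, IsScalarTower.algebraMap_apply O k E]
      rfl
    have h3 : Function.Injective (IsScalarTower.toAlgHom O E Ω) := Subtype.val_injective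
    exact (isIntegral_algHom_iff (IsScalarTower.toAlgHom O E Ω) h3).1 h1
  let f : Subring.closure (s : Set Ω) →+* E := Subring.inclusion hle
  refine ⟨a.comap (f.codRestrict (integralClosure O E) hintegral) fun x y hxy => ?_⟩
  have := congrArg (fun z : integralClosure O E => ((z : E) : Ω)) hxy
  exact Subtype.ext this

open Classical in
/-- The degree absolute value on `F_p(X)`. -/
noncomputable def degAbv (F : Type) [Field F] : AbsoluteValue (RatFunc F) ℝ where
  toFun x := if x = 0 then 0 else (2 : ℝ) ^ x.intDegree
  map_mul' x y := by
    by_cases hx : x = 0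
    · simp [hx]
    by_cases hy : y = 0
    · simp [hy]
    simp only [hx, hy, mul_eq_zero, or_self, if_false, RatFunc.intDegree_mul hx hy]
    rw [zpow_add₀ two_ne_zero]
  nonneg' x := by split_ifs <;> positivity
  eq_zero' x := by
    split_ifs with h
    · simp [h]
    · simp only [h, iff_false]; positivity
  add_le' x y := by
    by_cases hx : x = 0
    · simp [hx]
    by_cases hy : y = 0
    · simp [hy]
    by_cases hxy : x + y = 0
    · simp only [hxy, if_true, hx, hy, if_false]; positivity
    simp only [hx, hy, hxy, if_false]
    have h := RatFunc.intDegree_add_le hy hxy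
    have h1 : (0 : ℝ) < 2 ^ x.intDegree := by positivity
    have h2 : (0 : ℝ) < 2 ^ y.intDegree := by positivity
    rcases le_max_iff.1 h with h | h
    · have := zpow_le_zpow_right₀ (one_le_two (α := ℝ)) h; linarith
    · have := zpow_le_zpow_right₀ (one_le_two (α := ℝ)) h; linarith

open Classical in
theorem degAbv_nonarch (F : Type) [Field F] : IsNonarchimedean (degAbv F) := by
  intro x y
  by_cases hx : x = 0
  · simp [hx]
  by_cases hy : y = 0
  · simp [hy]
  by_cases hxy : x + y = 0
  · rw [hxy, map_zero]; exact le_max_of_le_left ((degAbv F).nonneg x)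
  change (if x + y = 0 then 0 else (2 : ℝ) ^ (x + y).intDegree) ≤
    max (if x = 0 then 0 else (2 : ℝ) ^ (x).intDegree) (if y = 0 then 0 else (2 : ℝ) ^ (y).intDegree)
  simp only [hx, hy, hxy, if_false]
  have h := RatFunc.intDegree_add_le hy hxy
  rcases le_max_iff.1 h with h | h
  · exact le_max_of_le_left (zpow_le_zpow_right₀ (one_le_two (α := ℝ)) h)
  · exact le_max_of_le_right (zpow_le_zpow_right₀ (one_le_two (α := ℝ)) h)

open Classical in
theorem degAbv_poly (F : Type) [Field F] (p : Polynomial F) (hp : p ≠ 0) :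
    degAbv F (algebraMap _ _ p) = 2 ^ p.natDegree := by
  change (if algebraMap (Polynomial F) (RatFunc F) p = 0 then 0 else _) = _
  rw [if_neg (by simpa using hp), RatFunc.intDegree_polynomial, zpow_natCast]

theorem arith_funfield {p : ℕ} [Fact p.Prime] {Ω : Type} [Field Ω] [Algebra (ZMod p) Ω]
    (y : Ω) (hy : Transcendental (ZMod p) y) (s : Finset Ω)
    (hs : ∀ x ∈ s, ((Polynomial.aeval y : Polynomial (ZMod p) →ₐ[ZMod p] Ω) :
      Polynomial (ZMod p) →+* Ω).IsIntegralElem x) :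
    Nonempty (Arith (Subring.closure (s : Set Ω))) := by
  letI : Algebra (Polynomial (ZMod p)) Ω := (Polynomial.aeval y).toRingHom.toAlgebra
  have hinj : Function.Injective (algebraMap (Polynomial (ZMod p)) Ω) :=
    transcendental_iff_injective.1 hy
  letI : Algebra (RatFunc (ZMod p)) Ω := (IsFractionRing.lift hinj : RatFunc (ZMod p) →+* Ω).toAlgebra
  haveI : IsScalarTower (Polynomial (ZMod p)) (RatFunc (ZMod p)) Ω :=
    IsScalarTower.of_algebraMap_eq fun x => (IsFractionRing.lift_algebraMap hinj x).symm
  refine arith_closure (O := Polynomial (ZMod p)) (k := RatFunc (ZMod p)) (S := Unit)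
    (fun _ => degAbv (ZMod p)) (fun _ => ext_nonarch _ (degAbv_nonarch _) ⟨RatFunc.X, ?_⟩) ?_ ?_ s ?_
  · rw [← RatFunc.algebraMap_X, degAbv_poly _ _ Polynomial.X_ne_zero]
    simp
  · intro C
    obtain ⟨d, hd⟩ := pow_unbounded_of_one_lt C (one_lt_two (α := ℝ))
    have hfin : (Polynomial.degreeLT (ZMod p) d : Set (Polynomial (ZMod p))).Finite := by
      haveI : Finite (Polynomial.degreeLT (ZMod p) d) :=
        Finite.of_equiv _ (Polynomial.degreeLTEquiv (ZMod p) d).symm.toEquiv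
      exact Set.toFinite _
    refine hfin.subset fun x hx => ?_
    rw [SetLike.mem_coe, Polynomial.mem_degreeLT]
    by_cases h0 : x = 0
    · simp [h0]
    have := hx ()
    rw [degAbv_poly _ _ h0] at this
    have h2 : (2 : ℝ) ^ x.natDegree < 2 ^ d := this.trans_lt hd
    rw [pow_lt_pow_iff_right₀ one_lt_two] at h2
    rw [Polynomial.degree_eq_natDegree h0]
    exact_mod_cast h2
  · intro x hx
    simp only [Finset.univ_unique, Finset.prod_const, Finset.card_singleton, pow_one]
    rw [degAbv_poly _ _ hx]
    exact one_le_pow₀ one_le_two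
  · intro x hx
    exact hs x hx
end UEG

namespace UEG
open Filter Topology

instance factPF (f : ℕ) (p : f.primeFactors) : Fact (p : ℕ).Prime := ⟨Nat.prime_of_mem_primeFactors p.2⟩

/-- The infinite place and the primes dividing `f`. -/
noncomputable def ratAbv (f : ℕ) : Option f.primeFactors → AbsoluteValue ℚ ℝ
  | none => Rat.AbsoluteValue.real
  | some p => Rat.AbsoluteValue.padic p

theorem ratAbv_ext (f : ℕ) (i) : Ext (ratAbv f i) := by
  cases i with
  | none => exact ext_real
  | some p => exact ext_padic p

theorem padic_nat (p : ℕ) [Fact p.Prime] (n : ℕ) (hn : n ≠ 0) :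
    Rat.AbsoluteValue.padic p (n : ℚ) = ((p : ℝ) ^ n.factorization p)⁻¹ := by
  rw [Rat.AbsoluteValue.padic_eq_padicNorm, padicNorm.eq_zpow_of_nonzero (by exact_mod_cast hn),
    padicValRat.of_nat, Nat.factorization_def _ (Fact.out : p.Prime)]
  simp

theorem prod_le_nat (P : Finset ℕ) (n : ℕ) (hn : n ≠ 0) :
    ∏ p ∈ P, p ^ n.factorization p ≤ n := by
  have h : ∏ p ∈ P, p ^ n.factorization p = ∏ p ∈ P ∩ n.primeFactors, p ^ n.factorization p := by
    symm
    apply Finset.prod_subset Finset.inter_subset_left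
    intro p hp hp2
    have : n.factorization p = 0 := by
      rw [← Finsupp.notMem_support_iff, Nat.support_factorization]
      intro h
      exact hp2 (Finset.mem_inter.2 ⟨hp, h⟩)
    rw [this, pow_zero]
  rw [h]
  have h2 : ∏ p ∈ n.primeFactors, p ^ n.factorization p = n := Nat.prod_factorization_pow_eq_self hn
  apply Nat.le_of_dvd (Nat.pos_of_ne_zero hn)
  conv_rhs => rw [← h2]
  exact Finset.prod_dvd_prod_of_subset _ _ _ Finset.inter_subset_right

theorem prod_eq_nat (P : Finset ℕ) (n : ℕ) (hn : n ≠ 0) (hP : n.primeFactors ⊆ P) :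
    ∏ p ∈ P, p ^ n.factorization p = n := by
  have h2 : ∏ p ∈ n.primeFactors, p ^ n.factorization p = n := Nat.prod_factorization_pow_eq_self hn
  conv_rhs => rw [← h2]
  symm
  apply Finset.prod_subset hP
  intro p hp hp2
  have : n.factorization p = 0 := by
    rw [← Finsupp.notMem_support_iff, Nat.support_factorization]
    exact hp2
  rw [this, pow_zero]

theorem prod_ratAbv (f : ℕ) (n : ℕ) (hn : n ≠ 0) :
    ∏ i, ratAbv f i (n : ℚ) = (n : ℝ) * ((∏ p ∈ f.primeFactors, p ^ n.factorization p : ℕ) : ℝ)⁻¹ := by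
  rw [Fintype.prod_option]
  congr 1
  · simp [ratAbv]
  · push_cast
    rw [← Finset.prod_inv_distrib, ← Finset.prod_coe_sort f.primeFactors
      (fun p : ℕ => ((p : ℝ) ^ n.factorization p)⁻¹)]
    exact Finset.prod_congr rfl fun (p : f.primeFactors) _ => padic_nat (p : ℕ) n hn

theorem prod_ratAbv_int (f : ℕ) (n : ℤ) (hn : n ≠ 0) : 1 ≤ ∏ i, ratAbv f i (n : ℚ) := by
  have h : ∏ i, ratAbv f i (n : ℚ) = ∏ i, ratAbv f i (n.natAbs : ℚ) := by
    refine Finset.prod_congr rfl fun i _ => ?_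
    rcases Int.natAbs_eq n with h | h
    · conv_lhs => rw [h]
      simp
    · conv_lhs => rw [h]
      rw [Int.cast_neg, map_neg_eq_map, Int.cast_natCast]
  have hn' : n.natAbs ≠ 0 := Int.natAbs_ne_zero.2 hn
  rw [h, prod_ratAbv f _ hn']
  have h1 := prod_le_nat f.primeFactors _ hn'
  have h2 : 0 < ∏ p ∈ f.primeFactors, p ^ (n.natAbs).factorization p :=
    Finset.prod_pos fun p hp => pow_pos (Nat.prime_of_mem_primeFactors hp).pos _
  rw [← div_eq_mul_inv, one_le_div (by exact_mod_cast h2)]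
  exact_mod_cast h1

theorem ratAbv_finite (f : ℕ) (hf : f ≠ 0) (C : ℝ) :
    {x : ℚ | (∃ (a : ℤ) (m : ℕ), x = a * ((f : ℚ) ^ m)⁻¹) ∧ ∀ i, ratAbv f i x ≤ C}.Finite := by
  set D : ℝ := max C 1 ^ f.primeFactors.card with hD
  obtain ⟨N, hN⟩ := exists_nat_ge (max (C * D) D)
  refine ((Set.finite_Icc (-(N : ℤ)) N).prod (Set.finite_Icc 0 N)).image
    (fun z : ℤ × ℕ => (z.1 : ℚ) / z.2) |>.subset ?_
  rintro x ⟨⟨a, m, hx⟩, hC⟩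
  have hpf : x.den.primeFactors ⊆ f.primeFactors := by
    have h1 : x.den ∣ f ^ m := by
      have h3 : x = Rat.divInt a ((f ^ m : ℕ) : ℤ) := by
        rw [hx, Rat.divInt_eq_div]; push_cast; rw [div_eq_mul_inv]
      have := Rat.den_dvd a ((f ^ m : ℕ) : ℤ)
      rw [← h3] at this
      exact_mod_cast this
    intro p hp
    rw [Nat.mem_primeFactors] at hp ⊢
    exact ⟨hp.1, hp.1.dvd_of_dvd_pow (hp.2.1.trans h1), hf⟩
  have hden : (x.den : ℝ) ≤ D := by
    have h1 := prod_eq_nat f.primeFactors x.den x.den_nz hpf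
    conv_lhs => rw [← h1]
    push_cast
    rw [hD, ← Finset.prod_const]
    refine Finset.prod_le_prod (fun p _ => by positivity) fun p hp => ?_
    haveI : Fact p.Prime := ⟨Nat.prime_of_mem_primeFactors hp⟩
    by_cases hpd : p ∣ x.den
    · refine le_max_of_le_left ?_
      have h2 : Rat.AbsoluteValue.padic p x ≤ C := hC (some ⟨p, hp⟩)
      have h3 : Rat.AbsoluteValue.padic p x = (p : ℝ) ^ x.den.factorization p := by
        conv_lhs => rw [← Rat.num_div_den x]
        rw [map_div₀, padic_nat p _ x.den_nz, div_inv_eq_mul]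
        have : padicNorm p (x.num : ℚ) = 1 := by
          rw [padicNorm.int_eq_one_iff]
          intro hnum
          have h5 : p ∣ x.num.natAbs := Int.natCast_dvd.1 hnum
          have := Nat.eq_one_of_dvd_coprimes x.reduced h5 hpd
          exact (Fact.out : p.Prime).one_lt.ne' this
        rw [Rat.AbsoluteValue.padic_eq_padicNorm, this]
        simp
      rw [← h3]; exact h2
    · rw [Nat.factorization_eq_zero_of_not_dvd hpd, pow_zero]
      exact le_max_right _ _
  have hnum : |(x.num : ℝ)| ≤ C * D := by
    have h1 : |(x : ℝ)| ≤ C := by simpa [ratAbv] using hC none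
    have h2 : (x.num : ℝ) = x * x.den := by exact_mod_cast (Rat.mul_den_eq_num x).symm
    rw [h2, abs_mul, Nat.abs_cast]
    have := abs_nonneg (x : ℝ)
    have h3 : 0 ≤ C := this.trans h1
    gcongr
  refine ⟨(x.num, x.den), ⟨?_, ?_⟩, Rat.num_div_den x⟩
  · have := hnum.trans ((le_max_left _ _).trans hN)
    rw [abs_le] at this
    exact ⟨by exact_mod_cast this.1, by exact_mod_cast this.2⟩
  · have := hden.trans ((le_max_right _ _).trans hN)
    exact ⟨Nat.zero_le _, by exact_mod_cast this⟩

theorem arith_rat {Ω : Type} [Field Ω] [Algebra ℚ Ω] [Algebra.IsAlgebraic ℚ Ω] (s : Finset Ω) :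
    Nonempty (Arith (Subring.closure (s : Set Ω))) := by
  haveI : Algebra.IsAlgebraic ℤ ℚ := IsLocalization.isAlgebraic ℚ (nonZeroDivisors ℤ)
  haveI : Algebra.IsAlgebraic ℤ Ω := Algebra.IsAlgebraic.trans ℤ ℚ Ω
  obtain ⟨z, hz0, hz⟩ := Algebra.IsAlgebraic.exists_integral_multiples ℤ s
  obtain ⟨f, hf0, hfi⟩ : ∃ f : ℕ, f ≠ 0 ∧ ∀ x ∈ s, IsIntegral ℤ ((f : Ω) * x) := by
    obtain ⟨f, rfl | rfl⟩ := Int.eq_nat_or_neg z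
    · refine ⟨f, by exact_mod_cast hz0, fun x hx => ?_⟩
      simpa using hz x hx
    · refine ⟨f, by simpa using hz0, fun x hx => ?_⟩
      simpa using (hz x hx).neg
  have hS : Submonoid.powers (f : ℤ) ≤ nonZeroDivisors ℤ :=
    powers_le_nonZeroDivisors_of_noZeroDivisors (by exact_mod_cast hf0)
  let O := Localization.subalgebra.ofField ℚ (Submonoid.powers (f : ℤ)) hS
  have hO : ∀ x : O, ∃ (a : ℤ) (m : ℕ), (x : ℚ) = a * ((f : ℚ) ^ m)⁻¹ := by
    rintro ⟨x, a, _, ⟨m, rfl⟩, hx⟩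
    exact ⟨a, m, by simpa using hx⟩
  haveI : IsIntegrallyClosed O := isIntegrallyClosed_of_isLocalization O (Submonoid.powers (f : ℤ)) hS
  refine arith_closure (O := O) (k := ℚ) (ratAbv f) (ratAbv_ext f) ?_ ?_ s ?_
  · intro C
    refine Set.Finite.of_finite_image (f := fun x : O => (x : ℚ)) ((ratAbv_finite f hf0 C).subset ?_)
      Subtype.val_injective.injOn
    rintro _ ⟨x, hx, rfl⟩
    exact ⟨hO x, hx⟩
  · intro x hx
    obtain ⟨a, m, h⟩ := hO x
    have ha : a ≠ 0 := by
      rintro rfl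
      apply hx
      apply Subtype.ext
      simpa using h
    change 1 ≤ ∏ i, ratAbv f i (x : ℚ)
    rw [h]
    simp only [map_mul, map_inv₀, map_pow, Finset.prod_mul_distrib, Finset.prod_inv_distrib,
      Finset.prod_pow]
    rw [prod_ratAbv f f hf0, prod_eq_nat _ _ hf0 subset_rfl, mul_inv_cancel₀ (by exact_mod_cast hf0),
      one_pow, inv_one, mul_one]
    exact prod_ratAbv_int f a ha
  · intro x hx
    have hmem : ((f : ℚ))⁻¹ ∈ O := ⟨1, f, ⟨1, by simp⟩, by simp⟩
    have h1 : IsIntegral O ((f : Ω) * x) := (hfi x hx).tower_top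
    have h2 : IsIntegral O (algebraMap O Ω ⟨_, hmem⟩) := isIntegral_algebraMap
    have h3 : algebraMap O Ω ⟨_, hmem⟩ = (f : Ω)⁻¹ := by
      change algebraMap ℚ Ω ((f : ℚ)⁻¹) = _
      simp
    have h4 := h2.mul h1
    haveI : CharZero Ω := algebraRat.charZero Ω
    rwa [h3, ← mul_assoc, inv_mul_cancel₀ (by exact_mod_cast hf0), one_mul] at h4
end UEG

namespace UEG
open Filter Topology

section
variable {κ Ω : Type} [Field κ] [Field Ω] [Algebra κ Ω]

theorem integral_t (t : Ω) (f : Polynomial κ) (hf : Polynomial.aeval t f ≠ 0) (y : Ω)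
    (hy : y = t + (Polynomial.aeval t f)⁻¹) :
    ((Polynomial.aeval y : Polynomial κ →ₐ[κ] Ω) : Polynomial κ →+* Ω).IsIntegralElem t := by
  have hf0 : f ≠ 0 := by rintro rfl; simp at hf
  set c := f.leadingCoeff⁻¹ with hc
  have hc0 : c ≠ 0 := inv_ne_zero (by simpa using hf0)
  let g : Polynomial κ := Polynomial.C c * f
  have hgm : g.Monic := by
    rw [Polynomial.Monic.def, Polynomial.leadingCoeff_mul, Polynomial.leadingCoeff_C, hc,
      inv_mul_cancel₀ (by simpa using hf0)]
  let G : Polynomial (Polynomial κ) := g.map Polynomial.C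
  have hGm : G.Monic := hgm.map _
  let P : Polynomial (Polynomial κ) := Polynomial.X * G +
    (-(Polynomial.C Polynomial.X * G) + Polynomial.C (Polynomial.C c))
  refine ⟨P, ?_, ?_⟩
  · refine Polynomial.Monic.add_of_left (Polynomial.monic_X.mul hGm) ?_
    have hG0 : G ≠ 0 := hGm.ne_zero
    have h1 : (Polynomial.X * G).degree = ((G.natDegree + 1 : ℕ) : WithBot ℕ) := by
      rw [Polynomial.degree_mul, Polynomial.degree_X, Polynomial.degree_eq_natDegree hG0, add_comm]
      norm_cast
    rw [h1]
    refine (Polynomial.degree_add_le _ _).trans_lt (max_lt ?_ ?_)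
    · rw [Polynomial.degree_neg]
      rw [Polynomial.degree_mul, Polynomial.degree_C Polynomial.X_ne_zero, zero_add,
        Polynomial.degree_eq_natDegree hG0]
      exact_mod_cast Nat.lt_succ_self _
    · refine Polynomial.degree_C_le.trans_lt ?_
      exact_mod_cast Nat.succ_pos _
  · have hG : Polynomial.eval₂ ((Polynomial.aeval y : Polynomial κ →ₐ[κ] Ω) : Polynomial κ →+* Ω) t G =
        algebraMap κ Ω c * Polynomial.aeval t f := by
      rw [Polynomial.eval₂_map]
      have : (((Polynomial.aeval y : Polynomial κ →ₐ[κ] Ω) : Polynomial κ →+* Ω).comp Polynomial.C) =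
          algebraMap κ Ω := by
        ext x; simp
      rw [this, ← Polynomial.aeval_def]
      simp [g]
    simp only [P, Polynomial.eval₂_add, Polynomial.eval₂_mul, Polynomial.eval₂_neg, Polynomial.eval₂_X,
      Polynomial.eval₂_C, hG]
    simp only [RingHom.coe_coe, Polynomial.aeval_X, Polynomial.aeval_C]
    rw [hy]
    field_simp
    ring

theorem integral_all (t : Ω) (ht : ∀ x : Ω, ∃ r : Polynomial κ, Polynomial.aeval t r ≠ 0 ∧
      ((Polynomial.aeval t : Polynomial κ →ₐ[κ] Ω) : Polynomial κ →+* Ω).IsIntegralElem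
        (Polynomial.aeval t r * x)) (s : Finset Ω) :
    ∃ y : Ω, ((Polynomial.aeval y : Polynomial κ →ₐ[κ] Ω) : Polynomial κ →+* Ω).IsIntegralElem t ∧
      ∀ x ∈ s, ((Polynomial.aeval y : Polynomial κ →ₐ[κ] Ω) : Polynomial κ →+* Ω).IsIntegralElem x := by
  classical
  choose r hr hri using ht
  let f := ∏ x ∈ s, r x
  have hf : Polynomial.aeval t f ≠ 0 := by
    rw [map_prod]; exact Finset.prod_ne_zero_iff.2 fun x _ => hr x
  obtain ⟨y, hy⟩ : ∃ y, y = t + (Polynomial.aeval t f)⁻¹ := ⟨_, rfl⟩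
  have hty := integral_t t f hf y hy
  refine ⟨y, hty, fun x hx => ?_⟩
  letI : Algebra (Polynomial κ) Ω :=
    ((Polynomial.aeval y : Polynomial κ →ₐ[κ] Ω) : Polynomial κ →+* Ω).toAlgebra
  let C := integralClosure (Polynomial κ) Ω
  have hκ : ∀ a : κ, algebraMap κ Ω a ∈ C := fun a => by
    have : IsIntegral (Polynomial κ) (algebraMap (Polynomial κ) Ω (Polynomial.C a)) :=
      isIntegral_algebraMap
    have h2 : algebraMap (Polynomial κ) Ω (Polynomial.C a) = algebraMap κ Ω a :=
      Polynomial.aeval_C y a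
    rwa [h2] at this
  have hpt : ∀ p : Polynomial κ, Polynomial.aeval t p ∈ C := by
    intro p
    rw [Polynomial.aeval_eq_sum_range]
    refine sum_mem fun i _ => ?_
    rw [Algebra.smul_def]
    exact mul_mem (hκ _) (pow_mem (show t ∈ C from hty) i)
  have hyC : y ∈ C := by
    have : IsIntegral (Polynomial κ) (algebraMap (Polynomial κ) Ω Polynomial.X) := isIntegral_algebraMap
    have h2 : algebraMap (Polynomial κ) Ω Polynomial.X = y := Polynomial.aeval_X y
    rwa [h2] at this
  have hinv : (Polynomial.aeval t f)⁻¹ ∈ C := by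
    have : (Polynomial.aeval t f)⁻¹ = y - t := by rw [hy]; ring
    rw [this]; exact sub_mem hyC hty
  have hrx : Polynomial.aeval t (r x) * x ∈ C := by
    obtain ⟨P, hP, hP0⟩ := hri x
    let g : Polynomial κ →+* C :=
      ((Polynomial.aeval t : Polynomial κ →ₐ[κ] Ω) : Polynomial κ →+* Ω).codRestrict C hpt
    have h1 : IsIntegral C (Polynomial.aeval t (r x) * x) := by
      refine ⟨P.map g, hP.map g, ?_⟩
      rw [Polynomial.eval₂_map]
      exact hP0
    exact isIntegral_trans _ h1
  have e : x = (Polynomial.aeval t (∏ z ∈ s.erase x, r z)) * (Polynomial.aeval t f)⁻¹ *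
      (Polynomial.aeval t (r x) * x) := by
    have h2 : Polynomial.aeval t f = Polynomial.aeval t (r x) * Polynomial.aeval t (∏ z ∈ s.erase x, r z) := by
      rw [← map_mul, Finset.mul_prod_erase _ _ hx]
    rw [h2] at hf ⊢
    have h3 := (mul_ne_zero_iff.1 hf).1
    have h4 := (mul_ne_zero_iff.1 hf).2
    field_simp
  have h5 : x ∈ C := by
    rw [e]; exact mul_mem (mul_mem (hpt _) hinv) hrx
  exact h5
end

theorem arith_ff {p : ℕ} [Fact p.Prime] (s : Finset (AlgebraicClosure (RatFunc (ZMod p)))) :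
    Nonempty (Arith (Subring.closure (s : Set (AlgebraicClosure (RatFunc (ZMod p)))))) := by
  let Ω := AlgebraicClosure (RatFunc (ZMod p))
  haveI : Algebra.IsAlgebraic (Polynomial (ZMod p)) (RatFunc (ZMod p)) :=
    IsLocalization.isAlgebraic _ (nonZeroDivisors (Polynomial (ZMod p)))
  haveI : Algebra.IsAlgebraic (Polynomial (ZMod p)) Ω :=
    Algebra.IsAlgebraic.trans _ (RatFunc (ZMod p)) _
  let t : Ω := algebraMap (Polynomial (ZMod p)) Ω Polynomial.X
  have haev : ∀ q : Polynomial (ZMod p), Polynomial.aeval t q = algebraMap (Polynomial (ZMod p)) Ω q := by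
    intro q
    have := Polynomial.aeval_algebraMap_apply Ω (Polynomial.X : Polynomial (ZMod p)) q
    rw [this]
    simp
  have hinj : Function.Injective (algebraMap (Polynomial (ZMod p)) Ω) := by
    rw [IsScalarTower.algebraMap_eq (Polynomial (ZMod p)) (RatFunc (ZMod p)) Ω]
    exact (algebraMap (RatFunc (ZMod p)) Ω).injective.comp (IsFractionRing.injective _ _)
  have hring : ((Polynomial.aeval t : Polynomial (ZMod p) →ₐ[ZMod p] Ω) : Polynomial (ZMod p) →+* Ω) =
      algebraMap (Polynomial (ZMod p)) Ω := RingHom.ext haev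
  have htt : Transcendental (ZMod p) t := by
    rw [transcendental_iff_injective]
    intro a b h
    rw [haev, haev] at h
    exact hinj h
  obtain ⟨y, hty, hys⟩ := integral_all (κ := ZMod p) t (fun x => by
    obtain ⟨r, hr, hri⟩ := (Algebra.IsAlgebraic.isAlgebraic (R := Polynomial (ZMod p)) x).exists_integral_multiple
    refine ⟨r, ?_, ?_⟩
    · rw [haev]; simpa using fun h => hr (hinj (by simpa using h))
    · rw [hring, haev, ← Algebra.smul_def]; exact hri) s
  refine arith_funfield y (fun halg => htt ?_) s hys
  have h1 : Algebra.IsIntegral (ZMod p) (Algebra.adjoin (ZMod p) {y}) :=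
    (Algebra.IsIntegral.adjoin (fun x hx => by rw [Set.mem_singleton_iff.1 hx]; exact halg.isIntegral))
  have h2 : IsIntegral (Algebra.adjoin (ZMod p) {y}) t := by
    obtain ⟨P, hP, hP0⟩ := hty
    let g : Polynomial (ZMod p) →+* Algebra.adjoin (ZMod p) {y} :=
      ((Polynomial.aeval y : Polynomial (ZMod p) →ₐ[ZMod p] Ω) : Polynomial (ZMod p) →+* Ω).codRestrict
        _ (fun q => Polynomial.aeval_mem_adjoin_singleton _ _)
    refine ⟨P.map g, hP.map g, ?_⟩
    rw [Polynomial.eval₂_map]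
    exact hP0
  exact (isIntegral_trans t h2).isAlgebraic
end UEG

namespace UEG

/-- Nullstellensatz: points in the algebraic closure. -/
theorem null_hom {k A : Type*} [Field k] [CommRing A] [Algebra k A] [Algebra.FiniteType k A]
    (I : Ideal A) (hI : I ≠ ⊤) :
    ∃ θ : A →ₐ[k] AlgebraicClosure k, (∀ x ∈ I, θ x = 0) ∧ Module.Finite k θ.range := by
  obtain ⟨M, hM, hIM⟩ := Ideal.exists_le_maximal I hI
  letI : Field (A ⧸ M) := Ideal.Quotient.field M
  have hfin : Module.Finite k (A ⧸ M) := finite_of_finite_type_of_isJacobsonRing k (A ⧸ M)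
  have halg : Algebra.IsAlgebraic k (A ⧸ M) := Algebra.IsAlgebraic.of_finite k (A ⧸ M)
  let f : (A ⧸ M) →ₐ[k] AlgebraicClosure k := IsAlgClosed.lift
  refine ⟨f.comp (Ideal.Quotient.mkₐ k M), fun x hx => ?_, ?_⟩
  · have : Ideal.Quotient.mkₐ k M x = 0 := Ideal.Quotient.eq_zero_iff_mem.mpr (hIM hx)
    simp only [AlgHom.comp_apply, this, map_zero]
  · have h1 : (f.comp (Ideal.Quotient.mkₐ k M)).range ≤ f.range := by
      rintro x ⟨y, rfl⟩
      exact ⟨Ideal.Quotient.mkₐ k M y, rfl⟩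
    haveI : Module.Finite k f.range := Module.Finite.range f.toLinearMap
    exact Module.Finite.of_injective (Subalgebra.inclusion h1).toLinearMap
      (Subalgebra.inclusion_injective h1)

theorem null_hom_inj {k A : Type*} [Field k] [CommRing A] [IsDomain A] [Algebra k A]
    {L : Type*} [Field L] [Algebra k L] (θ : A →ₐ[k] L) {x y : A} (hx : IsAlgebraic k x)
    (hy : IsAlgebraic k y) (h : θ x = θ y) : x = y := by
  by_contra hne
  have h1 : IsIntegral k (x - y) := (hx.isIntegral).sub hy.isIntegral
  have h2 : IsUnit (x - y) := h1.isUnit (sub_ne_zero.mpr hne) 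
  have h3 := h2.map θ
  rw [map_sub, h, sub_self] at h3
  exact not_isUnit_zero h3

theorem null_trans {k F : Type*} [Field k] [Field F] [Algebra k F] (s : Finset F) (t : F)
    (ht : Transcendental k t) :
    ∃ θ : Algebra.adjoin k (s : Set F) →ₐ[k] AlgebraicClosure (RatFunc k),
      ∀ h : t ∈ Algebra.adjoin k (s : Set F), θ ⟨t, h⟩ = algebraMap (RatFunc k) _ RatFunc.X := by
  classical
  have hinj : Function.Injective (Polynomial.aeval t : Polynomial k →ₐ[k] F) :=
    transcendental_iff_injective.mp ht
  let f : RatFunc k →ₐ[k] F := RatFunc.liftAlgHom (Polynomial.aeval t) (by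
    intro p hp
    simp only [Submonoid.mem_comap, mem_nonZeroDivisors_iff_ne_zero] at hp ⊢
    intro h0
    exact hp (hinj (h0.trans (map_zero _).symm)))
  have hfX : f RatFunc.X = t := by
    change RatFunc.liftAlgHom _ _ _ = t
    rw [RatFunc.liftAlgHom_apply, RatFunc.num_X, RatFunc.denom_X]
    simp
  letI : Algebra (RatFunc k) F := f.toRingHom.toAlgebra
  haveI : IsScalarTower k (RatFunc k) F := IsScalarTower.of_algebraMap_eq (fun x => (f.commutes x).symm)
  haveI : Algebra.FiniteType (RatFunc k) (Algebra.adjoin (RatFunc k) (s : Set F)) :=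
    (Subalgebra.fg_iff_finiteType _).mp (Subalgebra.fg_adjoin_finset s)
  obtain ⟨θ, -⟩ := null_hom (k := RatFunc k) (⊥ : Ideal (Algebra.adjoin (RatFunc k) (s : Set F))) bot_ne_top
  have hle : Algebra.adjoin k (s : Set F) ≤ (Algebra.adjoin (RatFunc k) (s : Set F)).restrictScalars k :=
    Algebra.adjoin_le (fun x hx => Algebra.subset_adjoin (R := RatFunc k) hx)
  let i : Algebra.adjoin k (s : Set F) →ₐ[k] (Algebra.adjoin (RatFunc k) (s : Set F)).restrictScalars k := Subalgebra.inclusion hle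
  let θ' : (Algebra.adjoin (RatFunc k) (s : Set F)).restrictScalars k →ₐ[k] AlgebraicClosure (RatFunc k) :=
    θ.restrictScalars k
  refine ⟨θ'.comp i, fun h => ?_⟩
  rw [← θ.commutes]
  change θ _ = θ _
  congr 1
  exact Subtype.ext hfX.symm

/-- an integer `c > w` such that `t - c` is not a unit. -/
theorem nonunit {k F : Type*} [Field k] [CharZero k] [Field F] [Algebra k F] (s : Finset F) (t : Algebra.adjoin k (s : Set F))
    (ht : Transcendental k (t : F)) (w : ℕ) :
    ∃ c : ℕ, w < c ∧ ¬ IsUnit (t - (c : Algebra.adjoin k (s : Set F))) := by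
  classical
  obtain ⟨θ, hθ⟩ := null_trans s (t : F) ht
  have hθt := hθ t.2
  let Ω := AlgebraicClosure (RatFunc k)
  have : Algebra.IsAlgebraic (Polynomial k) Ω := by
    have : Algebra.IsAlgebraic (Polynomial k) (RatFunc k) := IsLocalization.isAlgebraic  _ (nonZeroDivisors (Polynomial k))
    exact Algebra.IsAlgebraic.trans _ (RatFunc k) _
  obtain ⟨g, hg0, hg⟩ := Algebra.IsAlgebraic.exists_integral_multiples (Polynomial k)
    (s.attach.image (fun x : {x // x ∈ s} => θ ⟨(x : F), Algebra.subset_adjoin x.2⟩))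
  have key : ∀ a : Algebra.adjoin k (s : Set F), ∃ N : ℕ, IsIntegral (Polynomial k) (g ^ N • θ a) := by
    rintro ⟨a, ha⟩
    induction ha using Algebra.adjoin_induction with
    | mem x hx =>
      refine ⟨1, ?_⟩
      rw [pow_one]
      exact hg _ (Finset.mem_image.mpr ⟨⟨x, hx⟩, Finset.mem_attach _ _, rfl⟩)
    | algebraMap r =>
      refine ⟨0, ?_⟩
      rw [pow_zero, one_smul]
      have : θ ⟨algebraMap k F r, Subalgebra.algebraMap_mem _ r⟩
          = algebraMap (Polynomial k) (AlgebraicClosure (RatFunc k)) (Polynomial.C r) := by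
        refine (θ.commutes r).trans ?_
        rw [← Polynomial.algebraMap_eq, ← IsScalarTower.algebraMap_apply]
      rw [this]
      exact isIntegral_algebraMap
    | add x y hx hy h1 h2 =>
      obtain ⟨N, hN⟩ := h1
      obtain ⟨M, hM⟩ := h2
      refine ⟨N + M, ?_⟩
      have : θ ⟨x + y, add_mem hx hy⟩ = θ ⟨x, hx⟩ + θ ⟨y, hy⟩ := by rw [← map_add]; rfl
      rw [this, smul_add]
      refine IsIntegral.add ?_ ?_
      · rw [add_comm, pow_add, mul_smul]; exact hN.smul _
      · rw [pow_add, mul_smul]; exact hM.smul _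
    | mul x y hx hy h1 h2 =>
      obtain ⟨N, hN⟩ := h1
      obtain ⟨M, hM⟩ := h2
      refine ⟨N + M, ?_⟩
      have : θ ⟨x * y, mul_mem hx hy⟩ = θ ⟨x, hx⟩ * θ ⟨y, hy⟩ := by rw [← map_mul]; rfl
      rw [this, pow_add, ← smul_mul_smul_comm]
      exact hN.mul hM
  obtain ⟨c, hcw, hc⟩ : ∃ c : ℕ, w < c ∧ g.eval (c : k) ≠ 0 := by
    by_contra hcon
    push Not at hcon
    have h1 : (Set.Ioi w).Infinite := Set.Ioi_infinite w
    have h2 : ((fun c : ℕ => (c : k)) '' Set.Ioi w).Infinite := h1.image Nat.cast_injective.injOn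
    refine h2 (Set.Finite.subset (g.roots.toFinset.finite_toSet) ?_)
    rintro _ ⟨c, hc, rfl⟩
    simp [hg0, hcon c hc]
  refine ⟨c, hcw, fun hu => ?_⟩
  obtain ⟨u, hu⟩ := hu.exists_right_inv
  have h1 := congrArg θ hu
  rw [map_mul, map_sub, map_natCast, map_one] at h1
  have h2 : θ t = algebraMap (RatFunc k) (AlgebraicClosure (RatFunc k)) RatFunc.X := hθt
  have hne : (RatFunc.X : RatFunc k) - (c : RatFunc k) ≠ 0 := by
    intro h0
    rw [h2, ← map_natCast (algebraMap (RatFunc k) (AlgebraicClosure (RatFunc k))), ← map_sub, h0, map_zero, zero_mul] at h1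
    exact zero_ne_one h1
  have h3 : θ u = algebraMap (RatFunc k) (AlgebraicClosure (RatFunc k)) ((RatFunc.X - (c : RatFunc k))⁻¹) := by
    rw [map_inv₀, map_sub, map_natCast, ← h2]
    exact eq_inv_of_mul_eq_one_right h1
  obtain ⟨N, hN⟩ := key u
  rw [h3, Algebra.smul_def, IsScalarTower.algebraMap_apply (Polynomial k) (RatFunc k) (AlgebraicClosure (RatFunc k)),
    ← map_mul, isIntegral_algebraMap_iff (algebraMap (RatFunc k) (AlgebraicClosure (RatFunc k))).injective,
    IsIntegrallyClosed.isIntegral_iff] at hN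
  obtain ⟨p, hp⟩ := hN
  have h4 : algebraMap (Polynomial k) (RatFunc k) (p * (Polynomial.X - Polynomial.C (c : k)))
      = algebraMap (Polynomial k) (RatFunc k) (g ^ N) := by
    rw [map_mul, hp, map_sub, RatFunc.algebraMap_X]
    have : algebraMap (Polynomial k) (RatFunc k) (Polynomial.C (c : k)) = (c : RatFunc k) := by
      rw [map_natCast, map_natCast]
    rw [this, mul_assoc, inv_mul_cancel₀ hne, mul_one]
  have h5 := congrArg (Polynomial.eval (c : k)) (RatFunc.algebraMap_injective k h4)
  simp only [Polynomial.eval_mul, Polynomial.eval_sub, Polynomial.eval_X, Polynomial.eval_C, sub_self,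
    mul_zero, Polynomial.eval_pow] at h5
  exact pow_ne_zero N hc h5.symm
end UEG

namespace UEG
namespace PreData
variable {G : Type*} [Group G] {q : ℕ} {n w : ℕ}
section
variable {F : Type*} [Field F] (D : PreData G q F n w) (ν : Fin w × Fin w → G)

lemma β_pow {g : G} (hg : g ∈ Nq G q) (m : ℕ) : D.β (g ^ m) = D.β g ^ m := by
  induction m with
  | zero => simp [D.β_one]
  | succ m ih => rw [pow_succ, D.β_mul _ hg, ih, pow_succ]

lemma beta_torsion (hdet : (D.gram ν).det ≠ 0) (hν : ∀ i, ν i ∈ Nq G q)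
    (hfin : (D.τ '' (Nq G q : Set G)).Finite) {g : G} (hg : g ∈ Nq G q) :
    ∃ m, 0 < m ∧ D.β g ^ m = 1 := by
  classical
  have h1 : (D.β '' (Nq G q : Set G)).Finite := by
    let Φ : ((Fin w × Fin w) → F) → Matrix (Fin w) (Fin w) F := fun x =>
      ∑ m', (∑ m, x m * (D.gram ν)⁻¹ m m') • D.β (ν m')
    have h2 : (Set.pi Set.univ (fun _ : Fin w × Fin w => D.τ '' (Nq G q : Set G))).Finite :=
      Set.Finite.pi' (fun _ => hfin) |>.subset (fun x hx i => hx i trivial)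
    refine (h2.image Φ).subset ?_
    rintro _ ⟨x, hx, rfl⟩
    refine ⟨fun m => D.τ (x * ν m), fun m _ => ⟨x * ν m, mul_mem hx (hν m), rfl⟩, ?_⟩
    have h3 := D.expand ν hdet hν (D.β x)
    rw [h3]
    simp only [Φ]
    refine Finset.sum_congr rfl fun m' _ => ?_
    congr 1
    refine Finset.sum_congr rfl fun m _ => ?_
    rw [← D.β_mul _ (hν m)]
    rfl
  have h4 : ¬ Function.Injective (fun m : ℕ => D.β (g ^ m)) := by
    intro hinj
    exact (Set.infinite_range_of_injective hinj) (h1.subset (by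
      rintro _ ⟨m, rfl⟩
      exact ⟨g ^ m, pow_mem hg m, rfl⟩))
  have h5 : ∀ a b : ℕ, a < b → D.β (g ^ a) = D.β (g ^ b) → ∃ m, 0 < m ∧ D.β g ^ m = 1 := by
    intro a b hab h
    refine ⟨b - a, by omega, ?_⟩
    have e1 : g ^ (b - a) = (g ^ a)⁻¹ * g ^ b := by
      rw [eq_inv_mul_iff_mul_eq, ← pow_add]; congr 1; omega
    rw [← D.β_pow hg, e1, D.β_mul _ (pow_mem hg b), ← h, ← D.β_mul _ (pow_mem hg a), inv_mul_cancel, D.β_one]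
  simp only [Function.Injective, not_forall] at h4
  obtain ⟨a, b, hab, hne⟩ := h4
  rcases lt_or_gt_of_ne hne with h | h
  · exact h5 a b h hab
  · exact h5 b a h hab.symm
end

lemma root_pow {F : Type*} [Field F] {w m : ℕ} (M : Matrix (Fin w) (Fin w) F) (h : M ^ m = 1) {r : F}
    (hr : r ∈ M.charpoly.roots) : r ^ m = 1 := by
  have h1 : M.charpoly.IsRoot r := (Polynomial.mem_roots'.mp hr).2
  have h2 : Module.End.HasEigenvalue (Matrix.toLin' M) r := by
    rw [Module.End.hasEigenvalue_iff_isRoot_charpoly]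
    rwa [Matrix.charpoly_toLin']
  obtain ⟨v, hv⟩ := h2.exists_hasEigenvector
  have h3 := hv.pow_apply m
  rw [← Matrix.toLin'_pow, h, Matrix.toLin'_one, LinearMap.id_apply] at h3
  have h4 : (r ^ m - 1) • v = 0 := by rw [sub_smul, one_smul, ← h3, sub_self]
  rcases smul_eq_zero.mp h4 with h | h
  · exact sub_eq_zero.mp h
  · exact absurd h hv.2

lemma trace_integral {k F : Type*} [Field k] [Field F] [IsAlgClosed F] [Algebra k F] {w m : ℕ}
    (M : Matrix (Fin w) (Fin w) F) (hm : 0 < m) (h : M ^ m = 1) : IsIntegral k M.trace := by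
  rw [Matrix.trace_eq_sum_roots_charpoly]
  refine IsIntegral.multiset_sum fun r hr => ?_
  have := root_pow M h hr
  exact IsIntegral.of_pow hm (by rw [this]; exact isIntegral_one)

lemma trace_bound {F : Type*} [Field F] [IsAlgClosed F] (σ : F →+* ℂ) {w m : ℕ}
    (M : Matrix (Fin w) (Fin w) F) (hm : 0 < m) (h : M ^ m = 1) : ‖σ M.trace‖ ≤ w := by
  rw [Matrix.trace_eq_sum_roots_charpoly, map_multiset_sum]
  refine (norm_multiset_sum_le _).trans ?_
  rw [Multiset.map_map]
  have h1 : ∀ x ∈ Multiset.map (fun x => ‖x‖) (Multiset.map σ M.charpoly.roots), x ≤ 1 := by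
    intro x hx
    simp only [Multiset.map_map, Multiset.mem_map, Function.comp] at hx
    obtain ⟨r, hr, rfl⟩ := hx
    have := congrArg σ (root_pow M h hr)
    rw [map_pow, map_one] at this
    exact (Complex.norm_eq_one_of_pow_eq_one this hm.ne').le
  have h2 := Multiset.sum_le_card_nsmul _ _ h1
  rw [Multiset.map_map] at h2
  refine h2.trans ?_
  rw [Multiset.card_map, nsmul_eq_mul, mul_one]
  have := M.charpoly.card_roots'
  rw [Matrix.charpoly_natDegree_eq_dim, Fintype.card_fin] at this
  exact_mod_cast this
end PreData
end UEG

namespace UEG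
namespace PreData
variable {G : Type*} [Group G] {q : ℕ} {n w : ℕ}

/-- descent of data along an injective ring homomorphism -/
lemma restrict {F A : Type*} [CommRing A] [Field F] (f : A →+* F) (hf : Function.Injective f) (D : PreData G q F n w)
    (hρ : ∀ g i j, D.ρ g i j ∈ f.range) (hB : ∀ i j, D.B i j ∈ f.range) (hB' : ∀ i j, D.B' i j ∈ f.range) :
    ∃ D0 : PreData G q A n w, D0.map f = D := by
  choose r hr using hρ
  choose b hb using hB
  choose b' hb' using hB'
  have hinj : ∀ {a c : ℕ}, Function.Injective (fun M : Matrix (Fin a) (Fin c) A => M.map f) := fun {a c} =>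
    Matrix.map_injective hf
  have er : ∀ g, (Matrix.of (r g)).map f = D.ρ g := fun g => by ext i j; exact hr g i j
  have eb : (Matrix.of b).map f = D.B := by ext i j; exact hb i j
  have eb' : (Matrix.of b').map f = D.B' := by ext i j; exact hb' i j
  have m1 : ∀ a : ℕ, (1 : Matrix (Fin a) (Fin a) A).map f = 1 := fun a => Matrix.map_one f (map_zero f) (map_one f)
  let ρ0 : G →* Matrix (Fin n) (Fin n) A :=
    { toFun := fun g => Matrix.of (r g)
      map_one' := hinj (by simp only [er, m1, map_one])
      map_mul' := fun x y => hinj (by simp only [er, Matrix.map_mul, map_mul]) }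
  have er0 : ∀ g, (ρ0 g).map f = D.ρ g := er
  have ec : ∀ g, (Matrix.of b * ρ0 g * Matrix.of b').charpoly.map f = (D.B * D.ρ g * D.B').charpoly := by
    intro g
    rw [← Matrix.charpoly_map, Matrix.map_mul, Matrix.map_mul, eb, eb', er0]
  refine ⟨{ ρ := ρ0, B := Matrix.of b, B' := Matrix.of b', hB := ?_, hinv := ?_, hchar := ?_, hkill := ?_ }, ?_⟩
  · refine hinj ?_
    simp only [Matrix.map_mul, eb, eb', m1]
    exact D.hB
  · intro ν hν
    refine hinj ?_
    simp only [Matrix.map_mul, eb, eb', er0]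
    exact D.hinv ν hν
  · intro ν hν y
    refine Polynomial.map_injective f hf ?_
    rw [ec, ec]
    exact D.hchar ν hν y
  · intro ν hν
    refine hinj ?_
    change RingHom.mapMatrix f _ = (0 : Matrix (Fin n) (Fin n) A).map f
    rw [Matrix.map_zero f (map_zero f), ← D.hkill ν hν, ← ec, ← er0]
    rw [Polynomial.aeval_def, Polynomial.aeval_def, Polynomial.eval₂_map, Polynomial.hom_eval₂]
    congr 1
    ext x i j
    simp [Matrix.algebraMap_matrix_apply, apply_ite f]
  · cases D
    simp only [PreData.map, PreData.mk.injEq]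
    refine ⟨MonoidHom.ext er, eb, eb'⟩
end PreData

open PreData

section p4
variable {G : Type*} [Group G] {q n w : ℕ} {F : Type*} [Field F]

lemma exists_finset_entries [Group.FG G] (D : PreData G q F n w) (z : F) : ∃ s : Finset F,
    (∀ g i j, D.ρ g i j ∈ Subring.closure (s : Set F)) ∧ (∀ i j, D.B i j ∈ Subring.closure (s : Set F)) ∧
    (∀ i j, D.B' i j ∈ Subring.closure (s : Set F)) ∧ z ∈ Subring.closure (s : Set F) := by
  classical
  obtain ⟨S, hS⟩ := Group.fg_def.mp (inferInstance : Group.FG G)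
  let s1 : Finset F := S.biUnion fun g => Finset.univ.image fun p : Fin n × Fin n => D.ρ g p.1 p.2
  let s2 : Finset F := S.biUnion fun g => Finset.univ.image fun p : Fin n × Fin n => D.ρ g⁻¹ p.1 p.2
  let s3 : Finset F := Finset.univ.image fun p : Fin w × Fin n => D.B p.1 p.2
  let s4 : Finset F := Finset.univ.image fun p : Fin n × Fin w => D.B' p.1 p.2
  refine ⟨s1 ∪ s2 ∪ s3 ∪ s4 ∪ {z}, ?_, ?_, ?_, ?_⟩
  · set A := Subring.closure ((s1 ∪ s2 ∪ s3 ∪ s4 ∪ {z} : Finset F) : Set F) with hA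
    have hmul : ∀ x y : G, (∀ i j, D.ρ x i j ∈ A) → (∀ i j, D.ρ y i j ∈ A) → ∀ i j, D.ρ (x * y) i j ∈ A := by
      intro x y hx hy i j
      rw [map_mul, Matrix.mul_apply]
      exact sum_mem fun l _ => mul_mem (hx i l) (hy l j)
    intro g
    have hg : g ∈ Subgroup.closure (S : Set G) := by rw [hS]; trivial
    have : (∀ i j, D.ρ g i j ∈ A) ∧ (∀ i j, D.ρ g⁻¹ i j ∈ A) := by
      induction hg using Subgroup.closure_induction with
      | mem x hx =>
        constructor
        · intro i j
          refine Subring.subset_closure ?_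
          have : D.ρ x i j ∈ s1 := Finset.mem_biUnion.mpr ⟨x, hx, Finset.mem_image.mpr ⟨(i, j), Finset.mem_univ _, rfl⟩⟩
          simp only [Finset.coe_union, Set.mem_union, Finset.mem_coe]
          tauto
        · intro i j
          refine Subring.subset_closure ?_
          have : D.ρ x⁻¹ i j ∈ s2 := Finset.mem_biUnion.mpr ⟨x, hx, Finset.mem_image.mpr ⟨(i, j), Finset.mem_univ _, rfl⟩⟩
          simp only [Finset.coe_union, Set.mem_union, Finset.mem_coe]
          tauto
      | one =>
        have : ∀ i j, D.ρ 1 i j ∈ A := by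
          intro i j
          rw [map_one, Matrix.one_apply]
          split_ifs
          · exact one_mem _
          · exact zero_mem _
        exact ⟨this, by rwa [inv_one]⟩
      | mul x y _ _ hx hy =>
        refine ⟨hmul _ _ hx.1 hy.1, ?_⟩
        rw [_root_.mul_inv_rev]
        exact hmul _ _ hy.2 hx.2
      | inv x _ hx =>
        exact ⟨hx.2, by rw [inv_inv]; exact hx.1⟩
    exact this.1
  · intro i j
    refine Subring.subset_closure ?_
    have : D.B i j ∈ s3 := Finset.mem_image.mpr ⟨(i, j), Finset.mem_univ _, rfl⟩
    simp only [Finset.coe_union, Set.mem_union, Finset.mem_coe]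
    tauto
  · intro i j
    refine Subring.subset_closure ?_
    have : D.B' i j ∈ s4 := Finset.mem_image.mpr ⟨(i, j), Finset.mem_univ _, rfl⟩
    simp only [Finset.coe_union, Set.mem_union, Finset.mem_coe]
    tauto
  · exact Subring.subset_closure (by simp)

lemma finish (hwn : w ≤ n) (hq : ∀ m, 1 ≤ m → m ≤ (w * w + 1) ^ (w * w) → m ∣ q)
    (s : Finset F) (D0 : PreData G q (Subring.closure (s : Set F)) n w)
    (ν : Fin w × Fin w → G) (hν : ∀ i, ν i ∈ Nq G q) (hu : IsUnit (D0.gram ν).det)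
    {Ω : Type*} [Field Ω] (hA : ∀ s' : Finset Ω, Nonempty (Arith (Subring.closure (s' : Set Ω))))
    (θ : Subring.closure (s : Set F) →+* Ω) (hinf : ((D0.map θ).τ '' (Nq G q : Set G)).Infinite) : Dbl G := by
  classical
  let s' : Finset Ω := s.attach.image fun x : {x // x ∈ s} => θ ⟨(x : F), Subring.subset_closure x.2⟩
  have hmem : ∀ a, θ a ∈ Subring.closure (s' : Set Ω) := by
    rintro ⟨a, ha⟩
    induction ha using Subring.closure_induction with
    | mem x hx =>
      exact Subring.subset_closure (Finset.mem_coe.mpr (Finset.mem_image.mpr ⟨⟨x, hx⟩, Finset.mem_attach _ _, rfl⟩))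
    | zero => exact (map_zero θ) ▸ zero_mem (Subring.closure (s' : Set Ω))
    | one => exact (map_one θ) ▸ one_mem (Subring.closure (s' : Set Ω))
    | add x y hx hy h1 h2 =>
      exact (map_add θ ⟨x, hx⟩ ⟨y, hy⟩) ▸ add_mem h1 h2
    | neg x hx h1 => exact (map_neg θ ⟨x, hx⟩) ▸ neg_mem h1
    | mul x y hx hy h1 h2 => exact (map_mul θ ⟨x, hx⟩ ⟨y, hy⟩) ▸ mul_mem h1 h2
  let θ' : Subring.closure (s : Set F) →+* Subring.closure (s' : Set Ω) := θ.codRestrict _ hmem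
  obtain ⟨a⟩ := hA s'
  refine p6 a hwn hq (D0.map θ') ⟨⟨ν, hν, ?_⟩, ?_⟩
  · rw [map_gram_det]
    exact (hu.map θ').ne_zero
  · have h1 : (D0.map θ).τ = (Subring.closure (s' : Set Ω)).subtype ∘ (D0.map θ').τ := by
      ext g
      simp only [map_τ, Function.comp]
      rfl
    rw [h1, Set.image_comp] at hinf
    exact hinf.of_image _


lemma qbar_isAlgebraic : Algebra.IsAlgebraic ℚ (AlgebraicClosure ℚ) := by
  have h := AlgebraicClosure.isAlgebraic ℚ
  have e : (DivisionRing.toRatAlgebra : Algebra ℚ (AlgebraicClosure ℚ)) = AlgebraicClosure.instAlgebra ℚ :=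
    Subsingleton.elim _ _
  rw [e]
  exact h

lemma finish_int (hwn : w ≤ n) (hq : ∀ m, 1 ≤ m → m ≤ (w * w + 1) ^ (w * w) → m ∣ q)
    (s : Finset F) (D0 : PreData G q (Subring.closure (s : Set F)) n w)
    (ν : Fin w × Fin w → G) (hν : ∀ i, ν i ∈ Nq G q) (hu : IsUnit (D0.gram ν).det)
    {Ω : Type*} [Field Ω] (hA : ∀ s' : Finset Ω, Nonempty (Arith (Subring.closure (s' : Set Ω))))
    (θ : Subring.closure (s : Set F) →+* Ω) [IsAlgClosed Ω] (k : Type*) [Field k] [Algebra k Ω]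
    {g : G} (hg : g ∈ Nq G q) (hx : ¬ IsIntegral k (θ (D0.τ g))) : Dbl G := by
  refine finish hwn hq s D0 ν hν hu hA θ ?_
  intro hfin
  obtain ⟨m, hm, hβ⟩ := (D0.map θ).beta_torsion ν (by rw [map_gram_det]; exact (hu.map θ).ne_zero) hν hfin hg
  have h1 := trace_integral (k := k) _ hm hβ
  rw [← map_τ] at hx
  exact hx h1

lemma finish_bound (hwn : w ≤ n) (hq : ∀ m, 1 ≤ m → m ≤ (w * w + 1) ^ (w * w) → m ∣ q)
    (s : Finset F) (D0 : PreData G q (Subring.closure (s : Set F)) n w)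
    (ν : Fin w × Fin w → G) (hν : ∀ i, ν i ∈ Nq G q) (hu : IsUnit (D0.gram ν).det)
    {Ω : Type*} [Field Ω] (hA : ∀ s' : Finset Ω, Nonempty (Arith (Subring.closure (s' : Set Ω))))
    (θ : Subring.closure (s : Set F) →+* Ω) [IsAlgClosed Ω] (σ : Ω →+* ℂ)
    {g : G} (hg : g ∈ Nq G q) (hx : (w : ℝ) < ‖σ (θ (D0.τ g))‖) : Dbl G := by
  refine finish hwn hq s D0 ν hν hu hA θ ?_
  intro hfin
  obtain ⟨m, hm, hβ⟩ := (D0.map θ).beta_torsion ν (by rw [map_gram_det]; exact (hu.map θ).ne_zero) hν hfin hg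
  have h1 := trace_bound σ _ hm hβ
  rw [← map_τ] at hx
  exact absurd h1 (not_le.mpr hx)

lemma closure_le_adjoin (k : Type*) [Field k] [Algebra k F] (s : Finset F) :
    Subring.closure (s : Set F) ≤ (Algebra.adjoin k (s : Set F)).toSubring :=
  Subring.closure_le.mpr (fun _ hx => Algebra.subset_adjoin hx)

/-- P4 + P5 + P6 -/
theorem dbl_of_good [Group.FG G] (hwn : w ≤ n) (hq : ∀ m, 1 ≤ m → m ≤ (w * w + 1) ^ (w * w) → m ∣ q)
    (D : PreData G q F n w) (hD : D.Good) : Dbl G := by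
  classical
  obtain ⟨⟨ν, hν, hdet⟩, hinf⟩ := hD
  obtain ⟨s, hs1, hs2, hs3, hs4⟩ := exists_finset_entries D ((D.gram ν).det)⁻¹
  have hr : (Subring.closure (s : Set F)).subtype.range = Subring.closure (s : Set F) := Subring.range_subtype _
  obtain ⟨D0, hD0⟩ := D.restrict (Subring.closure (s : Set F)).subtype Subtype.val_injective
    (by rw [hr]; exact hs1) (by rw [hr]; exact hs2) (by rw [hr]; exact hs3)
  have hτ : ∀ g, ((D0.τ g : Subring.closure (s : Set F)) : F) = D.τ g := by
    intro g; rw [← hD0, map_τ]; rfl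
  have hu : IsUnit (D0.gram ν).det := by
    refine IsUnit.of_mul_eq_one ⟨_, hs4⟩ (Subtype.ext ?_)
    have : (((D0.gram ν).det : Subring.closure (s : Set F)) : F) = (D.gram ν).det := by
      rw [← hD0, map_gram_det]; rfl
    change (((D0.gram ν).det : Subring.closure (s : Set F)) : F) * _ = 1
    rw [this, mul_inv_cancel₀ hdet]
  -- inclusion into the algebra over the prime field
  have main : ∀ (k : Type) [Field k] [Algebra k F],
      (∀ g ∈ Nq G q, IsAlgebraic k (D.τ g)) →
      ∃ θ : Subring.closure (s : Set F) →+* AlgebraicClosure k,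
        ((D0.map θ).τ '' (Nq G q : Set G)).Infinite ∧ ∃ L : Subalgebra k (AlgebraicClosure k), Module.Finite k L ∧ ∀ x, θ x ∈ L := by
    intro k _ _ halg
    haveI : Algebra.FiniteType k (Algebra.adjoin k (s : Set F)) :=
      (Subalgebra.fg_iff_finiteType _).mp (Subalgebra.fg_adjoin_finset s)
    obtain ⟨θ, -, hL⟩ := null_hom (k := k) (⊥ : Ideal (Algebra.adjoin k (s : Set F))) bot_ne_top
    let ι : Subring.closure (s : Set F) →+* Algebra.adjoin k (s : Set F) := Subring.inclusion (closure_le_adjoin k s)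
    refine ⟨(θ : _ →+* _).comp ι, ?_, θ.range, hL, fun x => ⟨ι x, rfl⟩⟩
    have hinj : Set.InjOn (fun x : F => if h : x ∈ Algebra.adjoin k (s : Set F) then θ ⟨x, h⟩ else 0)
        (D.τ '' (Nq G q : Set G)) := by
      rintro _ ⟨g, hg, rfl⟩ _ ⟨g', hg', rfl⟩ h
      have m1 : ∀ g, D.τ g ∈ Algebra.adjoin k (s : Set F) := fun g => by
        rw [← hτ]; exact closure_le_adjoin k s (D0.τ g).2
      simp only [m1, dif_pos] at h
      have h' := null_hom_inj θ (x := ⟨D.τ g, m1 g⟩) (y := ⟨D.τ g', m1 g'⟩)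
        ((isAlgebraic_algebraMap_iff (A := F) Subtype.val_injective).mp (halg g hg))
        ((isAlgebraic_algebraMap_iff (A := F) Subtype.val_injective).mp (halg g' hg')) h
      exact congrArg Subtype.val h'
    have h2 := hinf.image hinj
    refine h2.mono ?_
    rintro _ ⟨_, ⟨g, hg, rfl⟩, rfl⟩
    refine ⟨g, hg, ?_⟩
    have m1 : D.τ g ∈ Algebra.adjoin k (s : Set F) := by
      rw [← hτ]; exact closure_le_adjoin k s (D0.τ g).2
    simp only [m1, dif_pos, map_τ]
    change θ (ι (D0.τ g)) = _
    congr 1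
    exact Subtype.ext (hτ g)
  obtain ⟨p, hp⟩ := CharP.exists F
  rcases CharP.char_is_prime_or_zero F p with hpp | hp0
  · haveI : Fact p.Prime := ⟨hpp⟩
    letI : Algebra (ZMod p) F := ZMod.algebra F p
    by_cases halg : ∀ g ∈ Nq G q, IsAlgebraic (ZMod p) (D.τ g)
    · exfalso
      obtain ⟨θ, h1, L, hL, hθ⟩ := main (ZMod p) halg
      have : Finite L := Module.finite_of_finite (ZMod p)
      refine h1 ((Set.toFinite (L : Set (AlgebraicClosure (ZMod p)))).subset ?_)
      rintro _ ⟨g, -, rfl⟩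
      rw [map_τ]
      exact hθ _
    · push Not at halg
      obtain ⟨g, hg, hga⟩ := halg
      obtain ⟨θ, hθ⟩ := null_trans s (D.τ g) hga
      let ι : Subring.closure (s : Set F) →+* Algebra.adjoin (ZMod p) (s : Set F) :=
        Subring.inclusion (closure_le_adjoin (ZMod p) s)
      have m1 : D.τ g ∈ Algebra.adjoin (ZMod p) (s : Set F) := by
        rw [← hτ]; exact closure_le_adjoin (ZMod p) s (D0.τ g).2
      have h2 : θ (ι (D0.τ g)) = algebraMap (RatFunc (ZMod p)) _ RatFunc.X := by
        rw [← hθ m1]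
        congr 1
        exact Subtype.ext (hτ g)
      refine finish_int hwn hq s D0 ν hν hu (Ω := AlgebraicClosure (RatFunc (ZMod p))) (fun s' => arith_ff s')
        (θ.toRingHom.comp ι) (ZMod p) hg ?_
      change ¬ IsIntegral (ZMod p) (θ (ι (D0.τ g)))
      intro h1
      rw [h2] at h1
      have h3 : IsAlgebraic (ZMod p) (RatFunc.X : RatFunc (ZMod p)) :=
        ((isIntegral_algebraMap_iff (algebraMap (RatFunc (ZMod p)) (AlgebraicClosure (RatFunc (ZMod p)))).injective).mp h1).isAlgebraic
      exact RatFunc.transcendental_X h3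
  · subst hp0
    haveI : CharZero F := CharP.charP_to_charZero F
    haveI := qbar_isAlgebraic
    by_cases halg : ∀ g ∈ Nq G q, IsAlgebraic ℚ (D.τ g)
    · obtain ⟨θ, h1, -⟩ := main ℚ halg
      exact finish hwn hq s D0 ν hν hu (fun s' => arith_rat s') θ h1
    · push Not at halg
      obtain ⟨g, hg, hga⟩ := halg
      let ι : Subring.closure (s : Set F) →+* Algebra.adjoin ℚ (s : Set F) :=
        Subring.inclusion (closure_le_adjoin ℚ s)
      have hι : ((ι (D0.τ g) : Algebra.adjoin ℚ (s : Set F)) : F) = D.τ g := hτ g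
      obtain ⟨c, hwc, hc⟩ := nonunit s (ι (D0.τ g)) (by rw [hι]; exact hga) w
      haveI : Algebra.FiniteType ℚ (Algebra.adjoin ℚ (s : Set F)) :=
        (Subalgebra.fg_iff_finiteType _).mp (Subalgebra.fg_adjoin_finset s)
      obtain ⟨θ, hθ, -⟩ := null_hom (k := ℚ) (Ideal.span {ι (D0.τ g) - (c : Algebra.adjoin ℚ (s : Set F))})
        (by rwa [Ne, Ideal.span_singleton_eq_top])
      have h2 := hθ _ (Ideal.mem_span_singleton_self _)
      rw [map_sub, map_natCast, sub_eq_zero] at h2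
      let σ : AlgebraicClosure ℚ →ₐ[ℚ] ℂ := IsAlgClosed.lift
      refine finish_bound hwn hq s D0 ν hν hu (fun s' => arith_rat s') (θ.toRingHom.comp ι) σ.toRingHom hg ?_
      change (w : ℝ) < ‖σ (θ (ι (D0.τ g)))‖
      rw [h2, map_natCast, Complex.norm_natCast]
      exact_mod_cast hwc
end p4
end UEG

namespace UEG

theorem dbl_linear {K : Type*} [Field K] {d : ℕ}
    (Γ : Subgroup (GL (Fin d) K)) (hfg : Group.FG Γ)
    (hns : ¬ ∃ H : Subgroup Γ, H.FiniteIndex ∧ IsSolvable ↥H) : Dbl Γ := by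
  let F := AlgebraicClosure K
  let ρ : Γ →* Matrix (Fin d) (Fin d) F :=
    ((algebraMap K F).mapMatrix.toMonoidHom.comp (Units.coeHom _)).comp Γ.subtype
  have hinj : Function.Injective ρ := by
    intro x y h
    refine Subtype.ext (Units.ext ?_)
    exact Matrix.map_injective (algebraMap K F).injective h
  obtain ⟨H, hH, n, hdata⟩ := exists_data ρ hinj hns
  haveI : Group.FG H := Subgroup.fg_of_index_ne_zero H
  obtain ⟨w, hw, D, hD⟩ := hdata (Nat.factorial ((n * n + 1) ^ (n * n))) (Nat.factorial_pos _)
  refine Dbl.of_finiteIndex H (dbl_of_good hw ?_ D hD)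
  intro m hm1 hm2
  refine Nat.dvd_factorial hm1 (hm2.trans ?_)
  have h1 : w * w ≤ n * n := Nat.mul_le_mul hw hw
  calc (w * w + 1) ^ (w * w) ≤ (n * n + 1) ^ (w * w) := Nat.pow_le_pow_left (by omega) _
    _ ≤ (n * n + 1) ^ (n * n) := Nat.pow_le_pow_right (by omega) h1
end UEG

/-- **Uniform exponential growth with a uniform base.** If `Γ ≤ GL_d(K)` is finitely generated
and not virtually solvable, there is `ε > 0` such that for every finite symmetric generating
set `S` of `Γ` containing `1` and every `n ≥ 1`, `#(S ^ n) ≥ #S · (1 + ε) ^ (n - 1)`. -/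
theorem uniform_exponential_growth {K : Type*} [Field K] {d : ℕ}
    (Γ : Subgroup (GL (Fin d) K)) (hfg : Group.FG Γ)
    (hns : ¬ ∃ H : Subgroup Γ, H.FiniteIndex ∧ IsSolvable ↥H) :
    ∃ ε : ℝ, 0 < ε ∧
      ∀ S : Finset Γ, (1 : Γ) ∈ S → (∀ s ∈ S, s⁻¹ ∈ S) →
        Subgroup.closure (S : Set Γ) = ⊤ →
        ∀ n : ℕ, 1 ≤ n →
          (S.card : ℝ) * (1 + ε) ^ (n - 1) ≤ ((S : Set Γ) ^ n).ncard := by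
  exact UEG.Dbl.growth (UEG.dbl_linear Γ hfg hns)
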